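/- Let p ∈ (1,2], p' = p/(p−1), b ∈ ℝ∖{0} and h ≥ 0. There exists a constant C = C(p,h,b) > 0 such that for every r > 0, every g ∈ L^p[0,1] with ‖g‖_{L^p[0,1]} ≤ r, and every δ > 0, there exists a set I ⊆ ℤ with card(ℤ∖I) ≤ C·(r/δ)^{p'} such that 𝓕[g](bλ) < δ for all λ ∈ ⋃_{n∈I} [n,n+1] × [−h,h]. -/

import Mathlib

open MeasureTheory

/-- The "maximal" Fourier transform `𝓕[g](λ) = sup_{x ∈ [0,1]} |∫₀ˣ g(t) e^{iλt} dt|`. -/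
noncomputable def maxFourier (g : ℝ → ℂ) (lam : ℂ) : ℝ :=
  ⨆ x : Set.Icc (0:ℝ) 1, ‖∫ t in (0:ℝ)..(x : ℝ), g t * Complex.exp (Complex.I * lam * t)‖

/-- The `L^p`-norm of `g` on `[0,1]`. -/
noncomputable def lpNorm01 (p : ℝ) (g : ℝ → ℂ) : ℝ :=
  (∫ t in (0:ℝ)..1, ‖g t‖ ^ p) ^ (1 / p)

/-! ### Polynomially decaying weights on the integers -/

/-- The weight `1 + |x - c| / R`. -/
noncomputable def decayWt (R : ℝ) (c x : ℤ) : ℝ := 1 + |(x : ℝ) - c| / R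

/-- The weight adapted to the dyadic interval of scale `k` and index `m`. -/
noncomputable def dyWt (k : ℕ) (m x : ℤ) : ℝ := 1 + |(x : ℝ) - m * 2 ^ k| / 2 ^ k

lemma dyWt_eq (k : ℕ) (m x : ℤ) : dyWt k m x = decayWt (2 ^ k) (m * 2 ^ k) x := by
  simp [dyWt, decayWt]

lemma one_le_decayWt {R : ℝ} (hR : 0 < R) (c x : ℤ) : 1 ≤ decayWt R c x := by
  unfold decayWt
  have : 0 ≤ |(x : ℝ) - c| / R := by positivity
  linarith

lemma one_le_dyWt (k : ℕ) (m x : ℤ) : 1 ≤ dyWt k m x := by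
  rw [dyWt_eq]; exact one_le_decayWt (by positivity) _ _

lemma dyWt_pos (k : ℕ) (m x : ℤ) : 0 < dyWt k m x := by
  have := one_le_dyWt k m x; linarith

lemma decayWt_pos {R : ℝ} (hR : 0 < R) (c x : ℤ) : 0 < decayWt R c x := by
  have := one_le_decayWt hR c x; linarith

lemma sum_range_inv_sq_le {R : ℝ} (hR : 1 ≤ R) {y : ℝ} (hy : 1 ≤ y) (n : ℕ) :
    ∑ i ∈ Finset.range n, ((1 + (y + i) / R) ^ 2)⁻¹ ≤
      R * (1 + (y - 1) / R)⁻¹ - R * (1 + (y + n - 1) / R)⁻¹ := by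
  have hR0 : 0 < R := by linarith
  induction n with
  | zero => simp
  | succ n ih =>
    rw [Finset.sum_range_succ]
    have key : ((1 + (y + n) / R) ^ 2)⁻¹ ≤
        R * (1 + (y + n - 1) / R)⁻¹ - R * (1 + (y + n) / R)⁻¹ := by
      have hn : (0 : ℝ) ≤ n := Nat.cast_nonneg n
      have e1 : 1 + (y + n) / R = (R + y + n) / R := by field_simp; ring
      have e2 : 1 + (y + n - 1) / R = (R + y + n - 1) / R := by field_simp; ring
      rw [e1, e2]
      have h1 : 0 < R + y + n - 1 := by linarith
      have h2 : 0 < R + y + n := by linarith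
      rw [inv_div, inv_div, div_pow, inv_div]
      have : R * (R / (R + y + n - 1)) - R * (R / (R + y + n)) =
          R ^ 2 / ((R + y + n - 1) * (R + y + n)) := by
        field_simp; ring
      rw [this]
      apply div_le_div_of_nonneg_left (by positivity) (by positivity)
      nlinarith
    push_cast
    have : y + (n + 1) - 1 = y + (n : ℝ) := by ring
    rw [this]
    linarith

lemma sum_decayWt_right {R : ℝ} (hR : 1 ≤ R) {c b : ℤ} (hcb : c < b) (S : Finset ℤ)
    (hS : ∀ x ∈ S, b ≤ x) :
    ∑ x ∈ S, (decayWt R c x ^ 2)⁻¹ ≤ R * (1 + (b - 1 - c) / R)⁻¹ := by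
  have hR0 : 0 < R := by linarith
  obtain ⟨n, hn⟩ : ∃ n : ℕ, ∀ x ∈ S, x < b + n := by
    obtain ⟨M, hM⟩ := S.bddAbove
    refine ⟨(M - b + 1).toNat, fun x hx => ?_⟩
    have := hM hx
    have := Int.self_le_toNat (M - b + 1)
    omega
  have hsub : S ⊆ (Finset.range n).image (fun i : ℕ => b + (i : ℤ)) := by
    intro x hx
    rw [Finset.mem_image]
    refine ⟨(x - b).toNat, ?_, ?_⟩
    · have := hS x hx; have := hn x hx
      rw [Finset.mem_range]; omega
    · have := hS x hx
      omega
  have hy : (1 : ℝ) ≤ (b : ℝ) - c := by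
    have : c + 1 ≤ b := hcb
    have : (c : ℝ) + 1 ≤ b := by exact_mod_cast this
    linarith
  calc ∑ x ∈ S, (decayWt R c x ^ 2)⁻¹
      ≤ ∑ x ∈ (Finset.range n).image (fun i : ℕ => b + (i : ℤ)), (decayWt R c x ^ 2)⁻¹ := by
        apply Finset.sum_le_sum_of_subset_of_nonneg hsub
        intros; positivity
    _ = ∑ i ∈ Finset.range n, ((1 + (((b : ℝ) - c) + i) / R) ^ 2)⁻¹ := by
        rw [Finset.sum_image (by intro i _ j _ h; simpa using h)]
        apply Finset.sum_congr rfl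
        intro i _
        unfold decayWt
        have : (((b + (i : ℤ) : ℤ)) : ℝ) - c = ((b : ℝ) - c) + i := by push_cast; ring
        rw [this, abs_of_nonneg (by positivity)]
    _ ≤ R * (1 + ((b : ℝ) - c - 1) / R)⁻¹ - R * (1 + ((b : ℝ) - c + n - 1) / R)⁻¹ :=
        sum_range_inv_sq_le hR hy n
    _ ≤ R * (1 + ((b : ℝ) - c - 1) / R)⁻¹ := by
        have : 0 ≤ (b : ℝ) - c + n - 1 := by
          have : (0 : ℝ) ≤ n := Nat.cast_nonneg n
          linarith
        have : 0 ≤ R * (1 + ((b : ℝ) - c + n - 1) / R)⁻¹ := by positivity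
        linarith
    _ = _ := by congr 4; ring

lemma sum_decayWt_right' {R : ℝ} (hR : 1 ≤ R) {c b : ℤ} (hcb : c < b) (S : Finset ℤ)
    (hS : ∀ x ∈ S, b ≤ x) :
    ∑ x ∈ S, (decayWt R c x ^ 2)⁻¹ ≤ 2 * R * (decayWt R c b)⁻¹ := by
  refine (sum_decayWt_right hR hcb S hS).trans ?_
  have hR0 : 0 < R := by linarith
  have hy : (1 : ℝ) ≤ (b : ℝ) - c := by
    have : c + 1 ≤ b := hcb
    have : (c : ℝ) + 1 ≤ b := by exact_mod_cast this
    linarith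
  unfold decayWt
  rw [abs_of_nonneg (by linarith)]
  have e1 : 1 + ((b : ℝ) - 1 - c) / R = (R + b - 1 - c) / R := by field_simp; ring
  have e2 : 1 + ((b : ℝ) - c) / R = (R + b - c) / R := by field_simp; ring
  rw [e1, e2, inv_div, inv_div]
  have h1 : 0 < R + b - 1 - c := by linarith
  have h2 : 0 < R + b - c := by linarith
  rw [mul_div_assoc', mul_div_assoc', div_le_div_iff₀ h1 h2]
  have : 0 ≤ R * R := by positivity
  nlinarith

lemma decayWt_neg (R : ℝ) (c x : ℤ) : decayWt R (-c) (-x) = decayWt R c x := by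
  unfold decayWt
  push_cast
  rw [← abs_neg]
  congr 3; ring

lemma sum_decayWt_left' {R : ℝ} (hR : 1 ≤ R) {c a : ℤ} (hac : a ≤ c) (S : Finset ℤ)
    (hS : ∀ x ∈ S, x < a) :
    ∑ x ∈ S, (decayWt R c x ^ 2)⁻¹ ≤ 2 * R * (decayWt R c a)⁻¹ := by
  have hR0 : 0 < R := by linarith
  have h := sum_decayWt_right' hR (c := -c) (b := -(a - 1)) (by omega) (S.image (fun x => -x))
    (by intro x hx; rw [Finset.mem_image] at hx; obtain ⟨y, hy, rfl⟩ := hx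
        have := hS y hy; omega)
  rw [Finset.sum_image (by intro i _ j _ h; simpa using h)] at h
  simp only [decayWt_neg] at h
  refine h.trans ?_
  have : decayWt R c a ≤ decayWt R c (a - 1) := by
    unfold decayWt
    have : |(a : ℝ) - c| ≤ |((a - 1 : ℤ) : ℝ) - c| := by
      have : (a : ℝ) ≤ c := by exact_mod_cast hac
      push_cast
      rw [abs_of_nonpos (by linarith), abs_of_nonpos (by linarith)]
      linarith
    gcongr
  have h0 := decayWt_pos hR0 c a
  gcongr

lemma sum_decayWt_le {R : ℝ} (hR : 1 ≤ R) (c : ℤ) (S : Finset ℤ) :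
    ∑ x ∈ S, (decayWt R c x ^ 2)⁻¹ ≤ 5 * R := by
  have hR0 : 0 < R := by linarith
  have hself : decayWt R c c = 1 := by simp [decayWt]
  rw [← Finset.sum_filter_add_sum_filter_not S (fun x => x < c)]
  rw [← Finset.sum_filter_add_sum_filter_not (S.filter (fun x => ¬ x < c)) (fun x => c + 1 ≤ x)]
  have h1 := sum_decayWt_left' hR (le_refl c) (S.filter (fun x => x < c))
    (by intro x hx; exact (Finset.mem_filter.1 hx).2)
  rw [hself] at h1
  have h2 := sum_decayWt_right' hR (c := c) (b := c + 1) (by omega)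
    ((S.filter (fun x => ¬ x < c)).filter (fun x => c + 1 ≤ x))
    (by intro x hx; exact (Finset.mem_filter.1 hx).2)
  have h2' : 2 * R * (decayWt R c (c + 1))⁻¹ ≤ 2 * R := by
    have := one_le_decayWt hR0 c (c + 1)
    have : (decayWt R c (c + 1))⁻¹ ≤ 1 := inv_le_one_of_one_le₀ this
    nlinarith
  have h3 : ∑ x ∈ (S.filter (fun x => ¬ x < c)).filter (fun x => ¬ c + 1 ≤ x),
      (decayWt R c x ^ 2)⁻¹ ≤ 1 := by
    calc _ ≤ ∑ x ∈ {c}, (decayWt R c x ^ 2)⁻¹ := by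
          apply Finset.sum_le_sum_of_subset_of_nonneg
          · intro x hx
            simp only [Finset.mem_filter] at hx
            rw [Finset.mem_singleton]; omega
          · intros; positivity
      _ = 1 := by simp [hself]
  linarith

lemma dyWt_mesh (k : ℕ) (m x : ℤ) : decayWt 1 (x / 2 ^ k) m ≤ 2 * dyWt k m x := by
  unfold decayWt dyWt
  have hp : (0 : ℝ) < 2 ^ k := by positivity
  have h1 : ((x / 2 ^ k : ℤ) : ℝ) * 2 ^ k ≤ x := by
    have := Int.ediv_mul_le x (b := 2 ^ k) (by positivity)
    exact_mod_cast this
  have h2 : (x : ℝ) < ((x / 2 ^ k : ℤ) : ℝ) * 2 ^ k + 2 ^ k := by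
    have := Int.lt_ediv_add_one_mul_self x (b := 2 ^ k) (by positivity)
    have h : (x : ℝ) < (((x / 2 ^ k : ℤ) : ℝ) + 1) * 2 ^ k := by exact_mod_cast this
    linarith
  set n : ℝ := ((x / 2 ^ k : ℤ) : ℝ)
  have e : |(x : ℝ) - m * 2 ^ k| / 2 ^ k = |(x : ℝ) / 2 ^ k - m| := by
    rw [← abs_of_pos hp, ← abs_div, abs_of_pos hp]; congr 1; field_simp
  rw [e]
  have h3 : n ≤ x / 2 ^ k := by rw [le_div_iff₀ hp]; exact h1
  have h4 : (x : ℝ) / 2 ^ k < n + 1 := by rw [div_lt_iff₀ hp]; linarith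
  simp only [div_one]
  rcases abs_cases ((m : ℝ) - n) with ⟨h, _⟩ | ⟨h, _⟩ <;>
  rcases abs_cases ((x : ℝ) / 2 ^ k - m) with ⟨h', _⟩ | ⟨h', _⟩ <;> rw [h, h'] <;> linarith

lemma sum_dyWt_mesh (k : ℕ) (x : ℤ) (S : Finset ℤ) :
    ∑ m ∈ S, (dyWt k m x ^ 2)⁻¹ ≤ 20 := by
  have h := sum_decayWt_le (le_refl (1 : ℝ)) (x / 2 ^ k) S
  calc ∑ m ∈ S, (dyWt k m x ^ 2)⁻¹ ≤ ∑ m ∈ S, 4 * (decayWt 1 (x / 2 ^ k) m ^ 2)⁻¹ := by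
        apply Finset.sum_le_sum
        intro m _
        have h1 := dyWt_mesh k m x
        have h2 := decayWt_pos one_pos (x / 2 ^ k) m
        have h3 := dyWt_pos k m x
        rw [← div_eq_mul_inv, inv_eq_one_div, div_le_div_iff₀ (by positivity) (by positivity)]
        nlinarith
    _ ≤ 20 := by rw [← Finset.mul_sum]; linarith

lemma sum_geom_two (K : ℕ) : ∑ k ∈ Finset.range K, (2 : ℝ) ^ k ≤ 2 ^ K := by
  induction K with
  | zero => simp
  | succ K ih => rw [Finset.sum_range_succ, pow_succ]; linarith

/-! ### Dyadic intervals of integers and the dyadic maximal function -/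

/-- The dyadic interval `[n 2^K, (n+1) 2^K)` of integers. -/
noncomputable def dyInt (K : ℕ) (n : ℤ) : Finset ℤ := Finset.Ico (n * 2 ^ K) ((n + 1) * 2 ^ K)

lemma mem_dyInt {K : ℕ} {n x : ℤ} : x ∈ dyInt K n ↔ x / 2 ^ K = n := by
  have hp : (0 : ℤ) < 2 ^ K := by positivity
  rw [dyInt, Finset.mem_Ico]
  constructor
  · rintro ⟨h1, h2⟩
    apply le_antisymm
    · have := (Int.ediv_lt_iff_lt_mul hp).2 h2; omega
    · exact (Int.le_ediv_iff_mul_le hp).2 h1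
  · rintro rfl
    exact ⟨Int.ediv_mul_le x hp.ne', Int.lt_ediv_add_one_mul_self x hp⟩

lemma card_dyInt (K : ℕ) (n : ℤ) : (dyInt K n).card = 2 ^ K := by
  rw [dyInt, Int.card_Ico]
  have : (n + 1) * 2 ^ K - n * 2 ^ K = ((2 ^ K : ℕ) : ℤ) := by push_cast; ring
  rw [this, Int.toNat_natCast]

lemma div_two_pow_of_le {k K : ℕ} (h : k ≤ K) (x : ℤ) : x / 2 ^ k / 2 ^ (K - k) = x / 2 ^ K := by
  rw [Int.ediv_ediv_of_nonneg (by positivity), ← pow_add, Nat.add_sub_cancel' h]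

lemma dyInt_succ (K : ℕ) (n : ℤ) : dyInt (K + 1) n = dyInt K (2 * n) ∪ dyInt K (2 * n + 1) := by
  ext x
  rw [Finset.mem_union, mem_dyInt, mem_dyInt, mem_dyInt, ← div_two_pow_of_le (Nat.le_succ K)]
  simp only [Nat.succ_eq_add_one, Nat.add_sub_cancel_left, pow_one]
  omega

lemma dyInt_disjoint (K : ℕ) {m n : ℤ} (h : m ≠ n) : Disjoint (dyInt K m) (dyInt K n) := by
  rw [Finset.disjoint_left]
  intro x hx hx'
  rw [mem_dyInt] at hx hx'
  exact h (hx.symm.trans hx')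

lemma dyInt_zero (n : ℤ) : dyInt 0 n = {n} := by
  ext x; rw [mem_dyInt]; simp

/-- The average of `f` over a dyadic interval. -/
noncomputable def dyAvg (f : ℤ → ℝ) (K : ℕ) (n : ℤ) : ℝ := (∑ x ∈ dyInt K n, f x) / 2 ^ K

/-- The maximum of the averages of `f` over the dyadic intervals of scale at most `K`
containing `x`. -/
noncomputable def dyMax (f : ℤ → ℝ) : ℕ → ℤ → ℝ
  | 0, x => f x
  | K + 1, x => max (dyMax f K x) (dyAvg f (K + 1) (x / 2 ^ (K + 1)))

lemma dyAvg_le_dyMax (f : ℤ → ℝ) {k K : ℕ} (h : k ≤ K) (x : ℤ) :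
    dyAvg f k (x / 2 ^ k) ≤ dyMax f K x := by
  induction K with
  | zero =>
    obtain rfl : k = 0 := by omega
    simp [dyAvg, dyMax, dyInt_zero]
  | succ K ih =>
    rcases Nat.lt_or_ge K k with h' | h'
    · obtain rfl : k = K + 1 := by omega
      exact le_max_right _ _
    · exact (ih h').trans (le_max_left _ _)

lemma dyMax_nonneg {f : ℤ → ℝ} (hf : ∀ x, 0 ≤ f x) (K : ℕ) (x : ℤ) : 0 ≤ dyMax f K x := by
  have := dyAvg_le_dyMax f (Nat.zero_le K) x
  refine le_trans ?_ this
  unfold dyAvg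
  have : 0 ≤ ∑ x ∈ dyInt 0 (x / 2 ^ 0), f x := Finset.sum_nonneg fun i _ => hf i
  positivity

lemma sum_max_dyMax_sq_le (f : ℤ → ℝ) (K : ℕ) (n : ℤ) {lam : ℝ} (h0 : 0 ≤ lam)
    (hlam : dyAvg f K n ≤ lam) :
    ∑ x ∈ dyInt K n, (max lam (dyMax f K x)) ^ 2 ≤
      4 * ∑ x ∈ dyInt K n, f x ^ 2 - 4 * lam * ∑ x ∈ dyInt K n, f x + 2 * lam ^ 2 * 2 ^ K := by
  induction K generalizing n lam with
  | zero =>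
    simp only [dyInt_zero, Finset.sum_singleton, dyMax, dyAvg, pow_zero, div_one] at *
    rw [max_eq_left hlam]
    nlinarith [sq_nonneg (lam - 2 * f n)]
  | succ K ih =>
    have hd : Disjoint (dyInt K (2 * n)) (dyInt K (2 * n + 1)) := dyInt_disjoint K (by omega)
    have child : ∀ m : ℤ, (∀ x ∈ dyInt K m, x / 2 ^ (K + 1) = n) →
        ∑ x ∈ dyInt K m, (max lam (dyMax f (K + 1) x)) ^ 2 ≤
        4 * ∑ x ∈ dyInt K m, f x ^ 2 - 4 * lam * ∑ x ∈ dyInt K m, f x + 2 * lam ^ 2 * 2 ^ K := by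
      intro m hm
      have h1 : ∑ x ∈ dyInt K m, (max lam (dyMax f (K + 1) x)) ^ 2 ≤
          ∑ x ∈ dyInt K m, (max (max lam (dyAvg f K m)) (dyMax f K x)) ^ 2 := by
        apply Finset.sum_le_sum
        intro x hx
        have : max lam (dyMax f (K + 1) x) ≤ max (max lam (dyAvg f K m)) (dyMax f K x) := by
          simp only [dyMax, hm x hx]
          refine max_le (le_max_of_le_left (le_max_left _ _)) (max_le (le_max_right _ _) ?_)
          exact hlam.trans (le_max_of_le_left (le_max_left _ _))
        have h0' : 0 ≤ max lam (dyMax f (K + 1) x) := h0.trans (le_max_left _ _)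
        gcongr
      refine h1.trans ?_
      refine (ih m (h0.trans (le_max_left _ _)) (le_max_right _ _)).trans ?_
      rcases le_total (dyAvg f K m) lam with h | h
      · rw [max_eq_left h]
      · rw [max_eq_right h]
        have hp : (0 : ℝ) < 2 ^ K := by positivity
        have hS : ∑ x ∈ dyInt K m, f x = dyAvg f K m * 2 ^ K := by
          unfold dyAvg; field_simp
        rw [hS]
        nlinarith [mul_nonneg (sq_nonneg (dyAvg f K m - lam)) hp.le]
    rw [dyInt_succ, Finset.sum_union hd, Finset.sum_union hd, Finset.sum_union hd]
    have hdiv : ∀ m : ℤ, m / 2 = n → ∀ x ∈ dyInt K m, x / 2 ^ (K + 1) = n := by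
      intro m hm x hx
      rw [mem_dyInt] at hx
      rw [← div_two_pow_of_le (Nat.le_succ K), hx]
      simpa using hm
    have c1 := child (2 * n) (hdiv _ (by omega))
    have c2 := child (2 * n + 1) (hdiv _ (by omega))
    have h2 : (2 : ℝ) ^ (K + 1) = 2 ^ K * 2 := pow_succ _ _
    rw [h2]
    nlinarith

lemma sum_dyMax_sq_le {f : ℤ → ℝ} (hf : ∀ x, 0 ≤ f x) (K : ℕ) (n : ℤ) :
    ∑ x ∈ dyInt K n, dyMax f K x ^ 2 ≤ 4 * ∑ x ∈ dyInt K n, f x ^ 2 := by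
  have hs : 0 ≤ ∑ x ∈ dyInt K n, f x := Finset.sum_nonneg fun i _ => hf i
  have h0 : 0 ≤ dyAvg f K n := by unfold dyAvg; positivity
  have h := sum_max_dyMax_sq_le f K n h0 le_rfl
  have h1 : ∑ x ∈ dyInt K n, dyMax f K x ^ 2 ≤
      ∑ x ∈ dyInt K n, (max (dyAvg f K n) (dyMax f K x)) ^ 2 := by
    apply Finset.sum_le_sum
    intro x _
    have := dyMax_nonneg hf K x
    gcongr
    exact le_max_right _ _
  have hS : ∑ x ∈ dyInt K n, f x = dyAvg f K n * 2 ^ K := by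
    unfold dyAvg; field_simp
  rw [hS] at h
  have hp : (0 : ℝ) < 2 ^ K := by positivity
  nlinarith [mul_nonneg (sq_nonneg (dyAvg f K n)) hp.le]

/-! ### Tiles, tree tops and the mass lemma -/

/-- A tile: the dyadic interval of integers of scale `k` and index `m` together with the dyadic
frequency interval `[l / 2 ^ k, (l + 1) / 2 ^ k)`. -/
@[ext] structure Tile where
  /-- the scale -/
  k : ℕ
  /-- the spatial index -/
  m : ℤ
  /-- the frequency index -/
  l : ℤ

/-- The top of a tree: a dyadic interval of integers and a frequency. -/
@[ext] structure TreeTop where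
  /-- the scale -/
  K : ℕ
  /-- the spatial index -/
  M : ℤ
  /-- the frequency -/
  ξ : ℝ

noncomputable instance : DecidableEq Tile := Classical.decEq _
noncomputable instance : DecidableEq TreeTop := Classical.decEq _

/-- The index of the interval of length `32 / 2 ^ k` of the grid based at `τ` containing `ξ`. -/
noncomputable def gridIdx (τ : ℝ) (k : ℕ) (ξ : ℝ) : ℤ := ⌊(ξ - τ) * 2 ^ k / 32⌋

lemma gridIdx_div (τ : ℝ) {k K : ℕ} (h : k ≤ K) (ξ : ℝ) :
    gridIdx τ K ξ / 2 ^ (K - k) = gridIdx τ k ξ := by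
  have h1 : (ξ - τ) * 2 ^ k / 32 = ((ξ - τ) * 2 ^ K / 32) / ((2 ^ (K - k) : ℕ) : ℝ) := by
    have : (2 : ℝ) ^ K = 2 ^ k * 2 ^ (K - k) := by rw [← pow_add]; congr 1; omega
    rw [this]; push_cast; field_simp
  unfold gridIdx
  rw [h1, Int.floor_div_natCast]
  push_cast
  rfl

lemma gridIdx_eq_of_le {τ : ℝ} {k K : ℕ} (h : k ≤ K) {ξ ζ : ℝ}
    (he : gridIdx τ K ξ = gridIdx τ K ζ) : gridIdx τ k ξ = gridIdx τ k ζ := by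
  rw [← gridIdx_div τ h, ← gridIdx_div τ h, he]

/-- The order on tree tops: spatial intervals increase, frequency intervals decrease. -/
def TreeTop.Below (τ : ℝ) (h t : TreeTop) : Prop :=
  h.K ≤ t.K ∧ h.M / 2 ^ (t.K - h.K) = t.M ∧ gridIdx τ h.K h.ξ = gridIdx τ h.K t.ξ

lemma TreeTop.Below.trans {τ : ℝ} {a b c : TreeTop} (h1 : a.Below τ b) (h2 : b.Below τ c) :
    a.Below τ c := by
  obtain ⟨h1, h3, h5⟩ := h1
  obtain ⟨h2, h4, h6⟩ := h2
  refine ⟨h1.trans h2, ?_, h5.trans (gridIdx_eq_of_le h1 h6)⟩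
  rw [← h4, ← h3, Int.ediv_ediv_of_nonneg (by positivity), ← pow_add]
  congr 2; omega

/-- The left end point of the frequency interval of a tile. -/
noncomputable def Tile.c (s : Tile) : ℝ := s.l / 2 ^ s.k

/-- A tile as the top of a tree. -/
noncomputable def Tile.toTop (s : Tile) : TreeTop := ⟨s.k, s.m, s.c⟩

/-- The points of `E` close to a top, in space and in frequency. -/
noncomputable def massSet (τ : ℝ) (η : ℤ → ℝ) (E : Finset ℤ) (j : ℕ) (t : TreeTop) : Finset ℤ :=
  open Classical in
  E.filter fun x => gridIdx τ t.K (η x) = gridIdx τ t.K t.ξ ∧ |x - t.M * 2 ^ t.K| ≤ 2 ^ j * 2 ^ t.K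

/-- The mass of the collection `P` is at most `μ`. -/
def MassLE (τ : ℝ) (η : ℤ → ℝ) (E : Finset ℤ) (P : Finset Tile) (μ : ℝ) : Prop :=
  ∀ s ∈ P, ∀ t : TreeTop, s.toTop.Below τ t → ∀ j : ℕ,
    ((massSet τ η E j t).card : ℝ) ≤ μ * 2 ^ (2 * j) * 2 ^ t.K

lemma MassLE.mono {τ : ℝ} {η : ℤ → ℝ} {E : Finset ℤ} {P P' : Finset Tile} {μ : ℝ}
    (h : MassLE τ η E P μ) (hP : P' ⊆ P) : MassLE τ η E P' μ :=
  fun s hs => h s (hP hs)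

lemma card_massSet_le (τ : ℝ) (η : ℤ → ℝ) (E : Finset ℤ) (j : ℕ) (t : TreeTop) :
    ((massSet τ η E j t).card : ℝ) ≤ 3 * 2 ^ j * 2 ^ t.K := by
  have hsub : massSet τ η E j t ⊆
      Finset.Icc (t.M * 2 ^ t.K - 2 ^ j * 2 ^ t.K) (t.M * 2 ^ t.K + 2 ^ j * 2 ^ t.K) := by
    intro x hx
    simp only [massSet, Finset.mem_filter] at hx
    have := abs_le.1 hx.2.2
    rw [Finset.mem_Icc]
    constructor <;> linarith
  have h1 := Finset.card_le_card hsub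
  have hp : (1 : ℤ) ≤ 2 ^ j * 2 ^ t.K := one_le_mul_of_one_le_of_one_le
    (one_le_pow₀ (by norm_num)) (one_le_pow₀ (by norm_num))
  rw [Int.card_Icc] at h1
  have h2 : ((massSet τ η E j t).card : ℤ) ≤ 3 * (2 ^ j * 2 ^ t.K) := by omega
  have h3 : ((massSet τ η E j t).card : ℝ) ≤ 3 * (2 ^ j * 2 ^ t.K) := by exact_mod_cast h2
  linarith

lemma massLE_four (τ : ℝ) (η : ℤ → ℝ) (E : Finset ℤ) (P : Finset Tile) :
    MassLE τ η E P 4 := by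
  intro s _ t _ j
  refine (card_massSet_le τ η E j t).trans ?_
  have h1 : (1 : ℝ) ≤ 2 ^ j := one_le_pow₀ (by norm_num)
  have h2 : (2 : ℝ) ^ (2 * j) = 2 ^ j * 2 ^ j := by rw [two_mul, pow_add]
  rw [h2]
  gcongr
  · norm_num
  · exact le_mul_of_one_le_left (by positivity) h1

set_option maxHeartbeats 1000000 in
/-- Heavy tops at a fixed distance parameter are dominated by few tops. -/
lemma exists_tops_of_heavy (τ : ℝ) (η : ℤ → ℝ) (j : ℕ) {μ : ℝ} (hμ : 0 < μ) (n : ℕ) :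
    ∀ (H : Finset TreeTop) (E : Finset ℤ), H.card ≤ n →
      (∀ h ∈ H, μ * 2 ^ (2 * j) * 2 ^ h.K ≤ ((massSet τ η E j h).card : ℝ)) →
      ∃ S : Finset TreeTop, (∀ h ∈ H, ∃ t ∈ S, h.Below τ t) ∧
        ∑ t ∈ S, (2 : ℝ) ^ t.K ≤ 8 / (μ * 2 ^ j) * E.card := by
  classical
  induction n with
  | zero =>
    intro H E hc _
    obtain rfl : H = ∅ := by simpa using hc
    exact ⟨∅, by simp, by simp; positivity⟩
  | succ n ih =>
    intro H E hc hH
    rcases H.eq_empty_or_nonempty with rfl | hne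
    · exact ⟨∅, by simp, by simp; positivity⟩
    obtain ⟨h0, hh0, hmax⟩ := Finset.exists_max_image H (fun h => h.K) hne
    set X := massSet τ η E j h0 with hX
    have hXE : X ⊆ E := Finset.filter_subset _ _
    set H' := H.filter fun h => Disjoint (massSet τ η E j h) X with hH'
    have hXpos : (0 : ℝ) < X.card := lt_of_lt_of_le (by positivity) (hH h0 hh0)
    have hXne : X.Nonempty := by
      rw [← Finset.card_pos]; exact_mod_cast hXpos
    have hcard : H'.card ≤ n := by
      have : H'.card < H.card := by
        apply Finset.card_lt_card
        refine Finset.filter_ssubset.2 ⟨h0, hh0, ?_⟩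
        rw [disjoint_self]
        exact hXne.ne_empty
      omega
    obtain ⟨S', hS', hsum⟩ := ih H' (E \ X) hcard (by
      intro h hh
      rw [Finset.mem_filter] at hh
      refine (hH h hh.1).trans ?_
      norm_cast
      apply Finset.card_le_card
      intro x hx
      have hx' : x ∉ X := Finset.disjoint_left.1 hh.2 hx
      simp only [massSet, Finset.mem_filter, Finset.mem_sdiff] at hx ⊢
      exact ⟨⟨hx.1, hx'⟩, hx.2⟩)
    set N : Finset TreeTop := (Finset.Icc (h0.M - (2 * 2 ^ j + 1)) (h0.M + (2 * 2 ^ j + 1))).image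
      fun M => ⟨h0.K, M, h0.ξ⟩ with hN
    refine ⟨N ∪ S', ?_, ?_⟩
    · intro h hh
      by_cases hd : Disjoint (massSet τ η E j h) X
      · obtain ⟨t, ht, hb⟩ := hS' h (by rw [hH', Finset.mem_filter]; exact ⟨hh, hd⟩)
        exact ⟨t, Finset.mem_union_right _ ht, hb⟩
      · obtain ⟨x, hx, hx'⟩ := Finset.not_disjoint_iff.1 hd
        simp only [hX, massSet, Finset.mem_filter] at hx hx'
        have hK : h.K ≤ h0.K := hmax h hh
        refine ⟨⟨h0.K, h.M / 2 ^ (h0.K - h.K), h0.ξ⟩, Finset.mem_union_left _ ?_, hK, rfl, ?_⟩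
        · rw [hN, Finset.mem_image]
          refine ⟨_, ?_, rfl⟩
          set d := h.M / 2 ^ (h0.K - h.K) with hdd
          have hpow : (2 : ℤ) ^ h0.K = 2 ^ (h0.K - h.K) * 2 ^ h.K := by
            rw [← pow_add]; congr 1; omega
          have hp : (0 : ℤ) < 2 ^ (h0.K - h.K) := by positivity
          have hp' : (0 : ℤ) < 2 ^ h.K := by positivity
          have hp0 : (0 : ℤ) < 2 ^ h0.K := by positivity
          have e1 : d * 2 ^ h0.K ≤ h.M * 2 ^ h.K := by
            rw [hpow, ← mul_assoc]
            exact mul_le_mul_of_nonneg_right (Int.ediv_mul_le _ hp.ne') hp'.le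
          have e2 : h.M * 2 ^ h.K < (d + 1) * 2 ^ h0.K := by
            rw [hpow, ← mul_assoc]
            exact mul_lt_mul_of_pos_right (Int.lt_ediv_add_one_mul_self _ hp) hp'
          have e3 := abs_le.1 hx.2.2
          have e4 := abs_le.1 hx'.2.2
          have e5 : (2 : ℤ) ^ j * 2 ^ h.K ≤ 2 ^ j * 2 ^ h0.K := by gcongr; norm_num
          rw [Finset.mem_Icc]
          constructor
          · have : (h0.M - 2 * 2 ^ j - 1) * 2 ^ h0.K < d * 2 ^ h0.K := by nlinarith
            have := lt_of_mul_lt_mul_right this hp0.le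
            linarith
          · have : d * 2 ^ h0.K ≤ (h0.M + 2 * 2 ^ j) * 2 ^ h0.K := by nlinarith
            have := le_of_mul_le_mul_right this hp0
            linarith
        · rw [← hx.2.1]
          exact gridIdx_eq_of_le hK hx'.2.1
    · have hN1 : ∑ t ∈ N, (2 : ℝ) ^ t.K ≤ 8 * 2 ^ j * 2 ^ h0.K := by
        have : ∀ t ∈ N, (2 : ℝ) ^ t.K = 2 ^ h0.K := by
          intro t ht
          obtain ⟨M, _, rfl⟩ := Finset.mem_image.1 ht
          rfl
        rw [Finset.sum_congr rfl this, Finset.sum_const, nsmul_eq_mul]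
        gcongr
        have h1 : N.card ≤ (2 * (2 * 2 ^ j + 1) + 1) := by
          refine Finset.card_image_le.trans ?_
          rw [Int.card_Icc]
          have : (h0.M + (2 * 2 ^ j + 1) + 1 - (h0.M - (2 * 2 ^ j + 1))) =
            ((2 * (2 * 2 ^ j + 1) + 1 : ℕ) : ℤ) := by push_cast; ring
          rw [this, Int.toNat_natCast]
        have h2 : (1 : ℝ) ≤ 2 ^ j := one_le_pow₀ (by norm_num)
        have h3 : (N.card : ℝ) ≤ 2 * (2 * 2 ^ j + 1) + 1 := by exact_mod_cast h1
        linarith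
      have hle : ∑ t ∈ N ∪ S', (2 : ℝ) ^ t.K ≤ ∑ t ∈ N, (2 : ℝ) ^ t.K + ∑ t ∈ S', (2 : ℝ) ^ t.K := by
        rw [← Finset.sum_union_inter]
        have : 0 ≤ ∑ t ∈ N ∩ S', (2 : ℝ) ^ t.K := Finset.sum_nonneg fun _ _ => by positivity
        linarith
      have hEc : (E.card : ℝ) = (E \ X).card + X.card := by
        have := Finset.card_sdiff_add_card_eq_card hXE
        exact_mod_cast this.symm
      have h8 : 8 * 2 ^ j * 2 ^ h0.K ≤ 8 / (μ * 2 ^ j) * (X.card : ℝ) := by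
        have h2 : (2 : ℝ) ^ (2 * j) = 2 ^ j * 2 ^ j := by rw [two_mul, pow_add]
        have := hH h0 hh0
        rw [h2] at this
        rw [div_mul_eq_mul_div, le_div_iff₀ (by positivity)]
        nlinarith
      rw [hEc, mul_add]
      linarith

lemma exists_tops_iUnion (τ : ℝ) (η : ℤ → ℝ) (E : Finset ℤ) {μ : ℝ} (hμ : 0 < μ)
    (H : ℕ → Finset TreeTop)
    (hH : ∀ j, ∀ h ∈ H j, μ * 2 ^ (2 * j) * 2 ^ h.K ≤ ((massSet τ η E j h).card : ℝ)) (J : ℕ) :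
    ∃ S : Finset TreeTop, (∀ j < J, ∀ h ∈ H j, ∃ t ∈ S, h.Below τ t) ∧
      ∑ t ∈ S, (2 : ℝ) ^ t.K ≤ 16 / μ * (1 - 1 / 2 ^ J) * E.card := by
  classical
  induction J with
  | zero => exact ⟨∅, by simp, by simp⟩
  | succ J ih =>
    obtain ⟨S, hS, hsum⟩ := ih
    obtain ⟨S', hS', hsum'⟩ := exists_tops_of_heavy τ η J hμ _ (H J) E le_rfl (hH J)
    refine ⟨S ∪ S', ?_, ?_⟩
    · intro j hj h hh
      rcases Nat.lt_succ_iff_lt_or_eq.1 hj with hj | rfl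
      · obtain ⟨t, ht, hb⟩ := hS j hj h hh
        exact ⟨t, Finset.mem_union_left _ ht, hb⟩
      · obtain ⟨t, ht, hb⟩ := hS' h hh
        exact ⟨t, Finset.mem_union_right _ ht, hb⟩
    · have hle : ∑ t ∈ S ∪ S', (2 : ℝ) ^ t.K ≤ ∑ t ∈ S, (2 : ℝ) ^ t.K + ∑ t ∈ S', (2 : ℝ) ^ t.K := by
        rw [← Finset.sum_union_inter]
        have : 0 ≤ ∑ t ∈ S ∩ S', (2 : ℝ) ^ t.K := Finset.sum_nonneg fun _ _ => by positivity
        linarith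
      have e : 16 / μ * (1 - 1 / 2 ^ (J + 1)) * (E.card : ℝ) =
          16 / μ * (1 - 1 / 2 ^ J) * E.card + 8 / (μ * 2 ^ J) * E.card := by
        rw [pow_succ]; field_simp; ring
      rw [e]
      linarith

/-- **Mass lemma.** -/
lemma mass_lemma (τ : ℝ) (η : ℤ → ℝ) (E : Finset ℤ) (P : Finset Tile) {μ : ℝ} (hμ : 0 < μ) :
    ∃ P' ⊆ P, MassLE τ η E P' (μ / 4) ∧ ∃ S : Finset TreeTop,
      (∀ s ∈ P \ P', ∃ t ∈ S, s.toTop.Below τ t) ∧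
      ∑ t ∈ S, (2 : ℝ) ^ t.K ≤ 64 / μ * E.card := by
  classical
  set light : Tile → Prop := fun s => ∀ t : TreeTop, s.toTop.Below τ t → ∀ j : ℕ,
    ((massSet τ η E j t).card : ℝ) ≤ μ / 4 * 2 ^ (2 * j) * 2 ^ t.K with hl
  have hex : ∀ s : Tile, ∃ q : TreeTop × ℕ, ¬ light s → s.toTop.Below τ q.1 ∧
      μ / 4 * 2 ^ (2 * q.2) * 2 ^ q.1.K ≤ ((massSet τ η E q.2 q.1).card : ℝ) := by
    intro s
    by_cases h : light s
    · exact ⟨⟨s.toTop, 0⟩, fun h' => absurd h h'⟩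
    · have h' := h
      simp only [hl, not_forall, not_le] at h'
      obtain ⟨t, ht, j, hj⟩ := h'
      exact ⟨⟨t, j⟩, fun _ => ⟨ht, hj.le⟩⟩
  choose q hq using hex
  obtain ⟨J, hJ⟩ : ∃ J, ∀ s ∈ P, (q s).2 < J := by
    refine ⟨P.sup (fun s => (q s).2) + 1, fun s hs => ?_⟩
    have := Finset.le_sup (f := fun s => (q s).2) hs
    exact Nat.lt_succ_of_le this
  obtain ⟨S, hS, hsum⟩ := exists_tops_iUnion τ η E (μ := μ / 4) (by positivity)
    (fun j => ((P.filter fun s => ¬ light s ∧ (q s).2 = j).image fun s => (q s).1)) (by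
      intro j h hh
      obtain ⟨s, hs, rfl⟩ := Finset.mem_image.1 hh
      rw [Finset.mem_filter] at hs
      obtain ⟨_, h1, rfl⟩ := hs
      exact (hq s h1).2) J
  refine ⟨P.filter light, Finset.filter_subset _ _, ?_, S, ?_, ?_⟩
  · intro s hs
    exact (Finset.mem_filter.1 hs).2
  · intro s hs
    rw [Finset.mem_sdiff, Finset.mem_filter, not_and] at hs
    have hns := hs.2 hs.1
    obtain ⟨t, ht, hb⟩ := hS (q s).2 (hJ s hs.1) (q s).1 (Finset.mem_image.2
      ⟨s, Finset.mem_filter.2 ⟨hs.1, hns, rfl⟩, rfl⟩)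
    exact ⟨t, ht, (hq s hns).1.trans hb⟩
  · refine hsum.trans ?_
    have h1 : (1 - 1 / 2 ^ J : ℝ) ≤ 1 := by
      have : (0 : ℝ) ≤ 1 / 2 ^ J := by positivity
      linarith
    have h2 : 16 / (μ / 4) = 64 / μ := by field_simp; norm_num
    rw [h2]
    have h3 : 64 / μ * (1 - 1 / 2 ^ J) ≤ 64 / μ * 1 := by gcongr
    have h4 : (0 : ℝ) ≤ E.card := by positivity
    nlinarith

/-! ### Lacunary trees and the greedy selection of tree tops -/

/-- The tile `s` belongs to the lacunary part of the tree with top `t`. -/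
def TreeTop.InLac (t : TreeTop) (s : Tile) : Prop :=
  s.k ≤ t.K ∧ s.m / 2 ^ (t.K - s.k) = t.M ∧ (s.l : ℝ) - 1 / 2 ≤ t.ξ * 2 ^ s.k ∧
    t.ξ * 2 ^ s.k < s.l + 3 / 2

/-- The tile `s` is well inside an interval of the grid based at `τ`. -/
def Tile.Good (τ : ℝ) (s : Tile) : Prop :=
  ∀ ζ : ℝ, (s.l : ℝ) - 8 ≤ ζ * 2 ^ s.k → ζ * 2 ^ s.k < s.l + 2 →
    gridIdx τ s.k ζ = gridIdx τ s.k s.c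

lemma TreeTop.InLac.below {τ : ℝ} {t : TreeTop} {s : Tile} (h : t.InLac s) (hs : s.Good τ) :
    s.toTop.Below τ t :=
  ⟨h.1, h.2.1, (hs t.ξ (by linarith [h.2.2.1]) (by linarith [h.2.2.2])).symm⟩

open Classical in
/-- The energy of the collection `P` with respect to the weight `a` is at most `e`. -/
def EnergyLE (a : Tile → ℝ) (P : Finset Tile) (e : ℝ) : Prop :=
  ∀ t : TreeTop, ∑ s ∈ P.filter t.InLac, a s ≤ e * 2 ^ t.K

lemma EnergyLE.mono {a : Tile → ℝ} (ha : ∀ s, 0 ≤ a s) {P P' : Finset Tile} {e : ℝ}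
    (h : EnergyLE a P e) (hP : P' ⊆ P) : EnergyLE a P' e := by
  classical
  intro t
  exact (Finset.sum_le_sum_of_subset_of_nonneg (Finset.filter_subset_filter _ hP)
    fun s _ _ => ha s).trans (h t)

lemma EnergyLE.apply_le {a : Tile → ℝ} (ha : ∀ s, 0 ≤ a s) {P : Finset Tile} {e : ℝ}
    (h : EnergyLE a P e) {s : Tile} (hs : s ∈ P) : a s ≤ e * 2 ^ s.k := by
  classical
  refine le_trans ?_ (h s.toTop)
  refine Finset.single_le_sum (f := a) (fun i _ => ha i) (Finset.mem_filter.2 ⟨hs, ?_⟩)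
  have : s.c * 2 ^ s.k = s.l := by unfold Tile.c; field_simp
  refine ⟨le_rfl, by simp [Tile.toTop], ?_, ?_⟩ <;> simp only [Tile.toTop, this] <;> linarith

open Classical in
/-- Lowering the frequency of a top to one of finitely many candidates. -/
lemma exists_candidate {P : Finset Tile} (t : TreeTop)
    (hne : (P.filter t.InLac).Nonempty) :
    ∃ s ∈ P, (s.l - 1 / 2 : ℝ) / 2 ^ s.k ≤ t.ξ ∧ ∀ s' ∈ P.filter t.InLac,
      TreeTop.InLac ⟨t.K, t.M, (s.l - 1 / 2 : ℝ) / 2 ^ s.k⟩ s' := by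
  obtain ⟨s, hs, hmax⟩ := Finset.exists_max_image _
    (fun s : Tile => (s.l - 1 / 2 : ℝ) / 2 ^ s.k) hne
  obtain ⟨hsP, hs⟩ := Finset.mem_filter.1 hs
  have hle : (s.l - 1 / 2 : ℝ) / 2 ^ s.k ≤ t.ξ := by
    rw [div_le_iff₀ (by positivity)]; exact hs.2.2.1
  refine ⟨s, hsP, hle, fun s' hs' => ?_⟩
  have h1 := hmax s' hs'
  obtain ⟨_, h2⟩ := Finset.mem_filter.1 hs'
  refine ⟨h2.1, h2.2.1, ?_, lt_of_le_of_lt ?_ h2.2.2.2⟩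
  · rwa [div_le_iff₀ (by positivity)] at h1
  · show (s.l - 1 / 2 : ℝ) / 2 ^ s.k * 2 ^ s'.k ≤ t.ξ * 2 ^ s'.k
    gcongr

open Classical in
/-- Greedy selection of lacunary trees of high energy, by increasing frequency. -/
lemma exists_selection (τ : ℝ) (a : Tile → ℝ) (ha : ∀ s, 0 ≤ a s) {e : ℝ} (he : 0 < e) (n : ℕ) :
    ∀ P : Finset Tile, P.card ≤ n → (∀ s ∈ P, s.Good τ) →
    ∃ P' ⊆ P, ∃ S ⊆ P, ∃ top : Tile → TreeTop, EnergyLE a P' e ∧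
      (∀ s ∈ S, (top s).InLac s) ∧
      (∀ s ∈ S, e * 2 ^ (top s).K < ∑ s' ∈ S.filter (fun s' => top s' = top s), a s') ∧
      (∀ s ∈ P \ P', ∃ s' ∈ S, s.toTop.Below τ (top s')) ∧
      (∀ s ∈ S, ∀ s' ∈ S, (top s).ξ < (top s').ξ → ¬ s'.toTop.Below τ (top s)) := by
  induction n with
  | zero =>
    intro P hP _
    obtain rfl : P = ∅ := by simpa using hP
    exact ⟨∅, by simp, ∅, by simp, fun _ => ⟨0, 0, 0⟩, fun t => by simp; positivity, by simp,
      by simp, by simp, by simp⟩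
  | succ n ih =>
    intro P hP hgood
    by_cases hen : EnergyLE a P e
    · exact ⟨P, subset_rfl, ∅, by simp, fun _ => ⟨0, 0, 0⟩, hen, by simp, by simp, by simp, by simp⟩
    have hviol : ∀ t : TreeTop, e * 2 ^ t.K < ∑ s ∈ P.filter t.InLac, a s →
        ∃ s ∈ P, (s.l - 1 / 2 : ℝ) / 2 ^ s.k ≤ t.ξ ∧
          e * 2 ^ t.K < ∑ s' ∈ P.filter
            (TreeTop.InLac ⟨t.K, t.M, (s.l - 1 / 2 : ℝ) / 2 ^ s.k⟩), a s' := by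
      intro t ht
      have hne : (P.filter t.InLac).Nonempty := by
        by_contra hne
        rw [Finset.not_nonempty_iff_eq_empty] at hne
        rw [hne, Finset.sum_empty] at ht
        have : 0 < e * 2 ^ t.K := by positivity
        linarith
      obtain ⟨s, hs, h1, h2⟩ := exists_candidate t hne
      refine ⟨s, hs, h1, ht.trans_le ?_⟩
      refine Finset.sum_le_sum_of_subset_of_nonneg (fun s' hs' => ?_) fun s _ _ => ha s
      exact Finset.mem_filter.2 ⟨(Finset.mem_filter.1 hs').1, h2 s' hs'⟩
    set Q := P.filter fun s => ∃ K M, e * 2 ^ K < ∑ s' ∈ P.filter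
      (TreeTop.InLac ⟨K, M, (s.l - 1 / 2 : ℝ) / 2 ^ s.k⟩), a s' with hQ
    have hQne : Q.Nonempty := by
      simp only [EnergyLE, not_forall, not_le] at hen
      obtain ⟨t, ht⟩ := hen
      obtain ⟨s, hs, _, h2⟩ := hviol t ht
      exact ⟨s, Finset.mem_filter.2 ⟨hs, t.K, t.M, h2⟩⟩
    obtain ⟨s0, hs0, hmin⟩ := Finset.exists_min_image Q
      (fun s : Tile => (s.l - 1 / 2 : ℝ) / 2 ^ s.k) hQne
    obtain ⟨_, K, M, ht0⟩ := Finset.mem_filter.1 hs0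
    set t0 : TreeTop := ⟨K, M, (s0.l - 1 / 2 : ℝ) / 2 ^ s0.k⟩ with ht0def
    have hlow : ∀ t : TreeTop, e * 2 ^ t.K < ∑ s ∈ P.filter t.InLac, a s → t0.ξ ≤ t.ξ := by
      intro t ht
      obtain ⟨s, hs, h1, h2⟩ := hviol t ht
      exact (hmin s (Finset.mem_filter.2 ⟨hs, t.K, t.M, h2⟩)).trans h1
    set L := P.filter t0.InLac with hL
    set R := P.filter fun s => ¬ s.toTop.Below τ t0 with hR
    have hLR : ∀ s ∈ R, s ∉ L := by
      intro s hs hs'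
      exact (Finset.mem_filter.1 hs).2
        ((Finset.mem_filter.1 hs').2.below (hgood s (Finset.mem_filter.1 hs).1))
    have hLne : L.Nonempty := by
      by_contra hne
      rw [Finset.not_nonempty_iff_eq_empty] at hne
      rw [hne, Finset.sum_empty] at ht0
      have : 0 < e * 2 ^ K := by positivity
      linarith
    have hRP : R ⊆ P := Finset.filter_subset _ _
    have hLP : L ⊆ P := Finset.filter_subset _ _
    have hcard : R.card ≤ n := by
      have : R.card < P.card := by
        refine Finset.card_lt_card ⟨hRP, fun h => ?_⟩
        obtain ⟨s, hs⟩ := hLne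
        exact hLR s (h (hLP hs)) hs
      omega
    obtain ⟨P', hP', S, hS, top, h1, h2, h3, h4, h5⟩ := ih R hcard fun s hs => hgood s (hRP hs)
    have htopL : ∀ s ∈ L, (if s ∈ L then t0 else top s) = t0 := fun s hs => if_pos hs
    have htopS : ∀ s ∈ S, (if s ∈ L then t0 else top s) = top s :=
      fun s hs => if_neg (hLR s (hS hs))
    have hge : ∀ s ∈ S, t0.ξ ≤ (top s).ξ := by
      intro s hs
      refine hlow _ ((h3 s hs).trans_le ?_)
      refine Finset.sum_le_sum_of_subset_of_nonneg (fun s' hs' => ?_) fun s _ _ => ha s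
      obtain ⟨h6, h7⟩ := Finset.mem_filter.1 hs'
      exact Finset.mem_filter.2 ⟨hRP (hS h6), h7 ▸ h2 s' h6⟩
    refine ⟨P', hP'.trans hRP, L ∪ S, Finset.union_subset hLP (hS.trans hRP),
      fun s => if s ∈ L then t0 else top s, h1, ?_, ?_, ?_, ?_⟩
    · intro s hs
      rcases Finset.mem_union.1 hs with hs | hs
      · simp only [htopL s hs]; exact (Finset.mem_filter.1 hs).2
      · simp only [htopS s hs]; exact h2 s hs
    · intro s hs
      rcases Finset.mem_union.1 hs with hs | hs
      · simp only [htopL s hs]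
        refine ht0.trans_le ?_
        refine Finset.sum_le_sum_of_subset_of_nonneg (fun s' hs' => ?_) fun s _ _ => ha s
        exact Finset.mem_filter.2 ⟨Finset.mem_union_left _ hs', htopL s' hs'⟩
      · simp only [htopS s hs]
        refine (h3 s hs).trans_le ?_
        refine Finset.sum_le_sum_of_subset_of_nonneg (fun s' hs' => ?_) fun s _ _ => ha s
        obtain ⟨h6, h7⟩ := Finset.mem_filter.1 hs'
        exact Finset.mem_filter.2 ⟨Finset.mem_union_right _ h6, (htopS s' h6).trans h7⟩
    · intro s hs
      obtain ⟨hsP, hsP'⟩ := Finset.mem_sdiff.1 hs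
      by_cases hb : s.toTop.Below τ t0
      · obtain ⟨s', hs'⟩ := hLne
        refine ⟨s', Finset.mem_union_left _ hs', ?_⟩
        simpa only [htopL s' hs'] using hb
      · obtain ⟨s', hs', hb'⟩ := h4 s (Finset.mem_sdiff.2 ⟨Finset.mem_filter.2 ⟨hsP, hb⟩, hsP'⟩)
        refine ⟨s', Finset.mem_union_right _ hs', ?_⟩
        simpa only [htopS s' hs'] using hb'
    · intro s hs s' hs' hlt
      rcases Finset.mem_union.1 hs with hs | hs <;> rcases Finset.mem_union.1 hs' with hs' | hs'
      · simp only [htopL s hs, htopL s' hs'] at hlt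
        exact absurd hlt (lt_irrefl _)
      · simp only [htopL s hs]
        exact (Finset.mem_filter.1 (hS hs')).2
      · simp only [htopS s hs, htopL s' hs'] at hlt
        exact absurd (hge s hs) (not_le.2 hlt)
      · simp only [htopS s hs, htopS s' hs'] at hlt ⊢
        exact h5 s hs s' hs' hlt

/-! ### The energy lemma -/

lemma two_pow_mul_sub {k K : ℕ} (h : k ≤ K) : (2 : ℝ) ^ K = 2 ^ k * 2 ^ (K - k) := by
  rw [← pow_add]; congr 1; omega

/-- Frequency geometry: scales which are far apart. -/
lemma freq_sep {k k' : ℕ} (hk : k' + 8 ≤ k) {l' ξ ζ : ℝ} (h1 : 0 ≤ (ξ - ζ) * 2 ^ k)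
    (h2 : (ξ - ζ) * 2 ^ k ≤ 10) (h3 : l' - 8 ≤ ζ * 2 ^ k') (h4 : ζ * 2 ^ k' ≤ l' - 1) :
    l' - 8 ≤ ξ * 2 ^ k' ∧ ξ * 2 ^ k' < l' - 1 / 2 := by
  have hN : (256 : ℝ) ≤ 2 ^ (k - k') := by
    calc (256 : ℝ) = 2 ^ 8 := by norm_num
      _ ≤ 2 ^ (k - k') := pow_le_pow_right₀ (by norm_num) (by omega)
  have hp : (0 : ℝ) < 2 ^ (k - k') := by positivity
  rw [two_pow_mul_sub (show k' ≤ k by omega), ← mul_assoc] at h1 h2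
  have h5 : 0 ≤ (ξ - ζ) * 2 ^ k' := nonneg_of_mul_nonneg_left h1 hp
  constructor
  · linarith
  · nlinarith

lemma sum_comp_le_of_fiber {ι κ : Type*} [DecidableEq κ] (F : Finset ι) (g : ι → κ) (f : κ → ℝ)
    (hf : ∀ b, 0 ≤ f b) (n : ℕ) (hn : ∀ b, (F.filter fun a => g a = b).card ≤ n) :
    ∑ a ∈ F, f (g a) ≤ n * ∑ b ∈ F.image g, f b := by
  rw [Finset.sum_comp, Finset.mul_sum]
  refine Finset.sum_le_sum fun b _ => ?_
  rw [nsmul_eq_mul]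
  have := hf b
  have h2 : (((F.filter fun a => g a = b).card : ℕ) : ℝ) ≤ n := by exact_mod_cast hn b
  gcongr

/-- A set of tiles with given scale and position whose frequency indices lie in an interval. -/
lemma card_tiles_le (F : Finset Tile) (k : ℕ) (m : ℤ) (hk : ∀ s ∈ F, s.k = k) (hm : ∀ s ∈ F, s.m = m)
    (a : ℝ) (n : ℕ) (ha : ∀ s ∈ F, a ≤ s.l ∧ (s.l : ℝ) ≤ a + n) : F.card ≤ n + 1 := by
  have h1 : F.card ≤ (Finset.Icc ⌈a⌉ (⌈a⌉ + n)).card := by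
    refine Finset.card_le_card_of_injOn (fun s => s.l) (fun s hs => ?_) (fun s hs s' hs' h => ?_)
    · obtain ⟨h1, h2⟩ := ha s hs
      simp only [Finset.coe_Icc, Set.mem_Icc]
      refine ⟨Int.ceil_le.2 h1, ?_⟩
      have h3 : (s.l : ℝ) ≤ ((⌈a⌉ + n : ℤ) : ℝ) := by push_cast; linarith [Int.le_ceil a]
      exact_mod_cast h3
    · ext1
      · rw [hk s hs, hk s' hs']
      · rw [hm s hs, hm s' hs']
      · exact h
  rw [Int.card_Icc] at h1
  omega

/-- The decay of a tile at the complement of a larger dyadic interval. -/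
noncomputable def tailWt (t : TreeTop) (k : ℕ) (m : ℤ) : ℝ :=
  (dyWt k m (t.M * 2 ^ t.K))⁻¹ + (dyWt k m ((t.M + 1) * 2 ^ t.K))⁻¹

lemma tailWt_nonneg (t : TreeTop) (k : ℕ) (m : ℤ) : 0 ≤ tailWt t k m := by
  have h1 := dyWt_pos k m (t.M * 2 ^ t.K)
  have h2 := dyWt_pos k m ((t.M + 1) * 2 ^ t.K)
  unfold tailWt; positivity

lemma two_pow_le_div {k K : ℕ} (hk : k ≤ K) {m M : ℤ} (hM : m / 2 ^ (K - k) = M) :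
    M * 2 ^ K ≤ m * 2 ^ k ∧ (m + 1) * 2 ^ k ≤ (M + 1) * 2 ^ K := by
  have hpow : (2 : ℤ) ^ K = 2 ^ (K - k) * 2 ^ k := by rw [← pow_add]; congr 1; omega
  have hp : (0 : ℤ) < 2 ^ (K - k) := by positivity
  have h1 : M * 2 ^ (K - k) ≤ m := hM ▸ Int.ediv_mul_le m hp.ne'
  have h2 : m < (M + 1) * 2 ^ (K - k) := hM ▸ Int.lt_ediv_add_one_mul_self m hp
  constructor
  · rw [hpow, ← mul_assoc]; gcongr
  · rw [hpow, ← mul_assoc]; gcongr; omega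

lemma sum_dyWt_compl_le {t : TreeTop} {k : ℕ} {m : ℤ} (hk : k ≤ t.K)
    (hM : m / 2 ^ (t.K - k) = t.M) (X : Finset ℤ) (hX : ∀ x ∈ X, x / 2 ^ t.K ≠ t.M) :
    ∑ x ∈ X, (dyWt k m x ^ 2)⁻¹ ≤ 2 * 2 ^ k * tailWt t k m := by
  obtain ⟨h1, h2⟩ := two_pow_le_div hk hM
  have hp : (0 : ℤ) < 2 ^ k := by positivity
  have hp' : (0 : ℤ) < 2 ^ t.K := by positivity
  rw [← Finset.sum_filter_add_sum_filter_not X (fun x => x < t.M * 2 ^ t.K)]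
  have hR : (1 : ℝ) ≤ 2 ^ k := one_le_pow₀ (by norm_num)
  have e1 := sum_decayWt_left' hR h1 (X.filter fun x => x < t.M * 2 ^ t.K)
    fun x hx => (Finset.mem_filter.1 hx).2
  have e2 := sum_decayWt_right' hR (show m * 2 ^ k < (t.M + 1) * 2 ^ t.K by linarith)
    (X.filter fun x => ¬ x < t.M * 2 ^ t.K) fun x hx => by
      obtain ⟨h3, h4⟩ := Finset.mem_filter.1 hx
      by_contra h5
      refine hX x h3 (mem_dyInt.1 ?_)
      rw [dyInt, Finset.mem_Ico]
      omega
  simp only [← dyWt_eq] at e1 e2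
  unfold tailWt
  rw [mul_add]
  exact add_le_add e1 e2

lemma dyWt_sq_inv_pos (k : ℕ) (m x : ℤ) : 0 < (dyWt k m x ^ 2)⁻¹ := by
  have := dyWt_pos k m x; positivity

/-- Summing over the tiles of a lacunary tree. -/
lemma sum_tailWt_sq_le (t : TreeTop) (T : Finset Tile) (hT : ∀ s ∈ T, t.InLac s) :
    ∑ s ∈ T, 2 ^ s.k * tailWt t s.k s.m ^ 2 ≤ 480 * 2 ^ t.K := by
  have h1 := sum_comp_le_of_fiber T (fun s => (s.k, s.m))
    (fun q => 2 ^ q.1 * tailWt t q.1 q.2 ^ 2) (fun q => by positivity) 3 (by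
      rintro ⟨k, m⟩
      refine card_tiles_le _ k m (fun s hs => ?_) (fun s hs => ?_) (t.ξ * 2 ^ k - 3 / 2) 2
        (fun s hs => ?_)
      · have := (Finset.mem_filter.1 hs).2; simp only [Prod.mk.injEq] at this; exact this.1
      · have := (Finset.mem_filter.1 hs).2; simp only [Prod.mk.injEq] at this; exact this.2
      · obtain ⟨h3, h4⟩ := Finset.mem_filter.1 hs
        simp only [Prod.mk.injEq] at h4
        obtain ⟨_, _, h5, h6⟩ := hT s h3
        rw [h4.1] at h5 h6
        push_cast
        constructor <;> linarith)
  refine h1.trans ?_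
  have h2 : ∑ q ∈ T.image (fun s => (s.k, s.m)), (2 : ℝ) ^ q.1 * tailWt t q.1 q.2 ^ 2 ≤
      ∑ q ∈ Finset.range (t.K + 1) ×ˢ (T.image fun s => s.m),
        (2 : ℝ) ^ q.1 * tailWt t q.1 q.2 ^ 2 := by
    refine Finset.sum_le_sum_of_subset_of_nonneg ?_ fun q _ _ => by positivity
    intro q hq
    obtain ⟨s, hs, rfl⟩ := Finset.mem_image.1 hq
    rw [Finset.mem_product, Finset.mem_range]
    exact ⟨Nat.lt_succ_of_le (hT s hs).1, Finset.mem_image_of_mem _ hs⟩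
  rw [Finset.sum_product] at h2
  have h3 : ∀ k ∈ Finset.range (t.K + 1), ∑ m ∈ T.image (fun s => s.m),
      (2 : ℝ) ^ k * tailWt t k m ^ 2 ≤ 80 * 2 ^ k := by
    intro k _
    rw [← Finset.mul_sum]
    have h4 : ∑ m ∈ T.image (fun s => s.m), tailWt t k m ^ 2 ≤ ∑ m ∈ T.image (fun s => s.m),
        (2 * (dyWt k m (t.M * 2 ^ t.K) ^ 2)⁻¹ + 2 * (dyWt k m ((t.M + 1) * 2 ^ t.K) ^ 2)⁻¹) := by
      refine Finset.sum_le_sum fun m _ => ?_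
      unfold tailWt
      rw [← inv_pow, ← inv_pow]
      nlinarith [sq_nonneg ((dyWt k m (t.M * 2 ^ t.K))⁻¹ - (dyWt k m ((t.M + 1) * 2 ^ t.K))⁻¹)]
    rw [Finset.sum_add_distrib, ← Finset.mul_sum, ← Finset.mul_sum] at h4
    have h5 := sum_dyWt_mesh k (t.M * 2 ^ t.K) (T.image fun s => s.m)
    have h6 := sum_dyWt_mesh k ((t.M + 1) * 2 ^ t.K) (T.image fun s => s.m)
    have hp : (0 : ℝ) < 2 ^ k := by positivity
    nlinarith
  have h4 := h2.trans (Finset.sum_le_sum h3)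
  rw [← Finset.mul_sum] at h4
  have h5 := sum_geom_two (t.K + 1)
  rw [pow_succ] at h5
  push_cast
  linarith

/-- Bounds for a family of wave packets indexed by tiles. -/
structure PacketBound {H : Type*} [NormedAddCommGroup H] [InnerProductSpace ℂ H]
    (v : Tile → H) (B : ℝ) : Prop where
  /-- packets with disjoint frequency supports are orthogonal -/
  orth : ∀ s s', inner ℂ (v s) (v s') ≠ 0 → ∃ ζ : ℝ, ((s.l : ℝ) - 8 ≤ ζ * 2 ^ s.k ∧
    ζ * 2 ^ s.k ≤ s.l - 1) ∧ ((s'.l : ℝ) - 8 ≤ ζ * 2 ^ s'.k ∧ ζ * 2 ^ s'.k ≤ s'.l - 1)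
  /-- decay of inner products -/
  decay : ∀ s s', s'.k ≤ s.k → ‖inner ℂ (v s) (v s')‖ ≤
    B / 2 ^ s.k * (dyWt s.k s.m (s'.m * 2 ^ s'.k) ^ 2)⁻¹

/-- The disjointness provided by the greedy selection. -/
lemma selection_disjoint {τ : ℝ} {S : Finset Tile} {top : Tile → TreeTop}
    (hgood : ∀ s ∈ S, s.Good τ) (hlac : ∀ s ∈ S, (top s).InLac s)
    (hstar : ∀ s ∈ S, ∀ s' ∈ S, (top s).ξ < (top s').ξ → ¬ s'.toTop.Below τ (top s))
    {s s' : Tile} (hs : s ∈ S) (hs' : s' ∈ S) (hk : s'.k ≤ s.k)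
    (h1 : (s'.l : ℝ) - 8 ≤ (top s).ξ * 2 ^ s'.k) (h2 : (top s).ξ * 2 ^ s'.k < s'.l - 1 / 2) :
    s'.m / 2 ^ ((top s).K - s'.k) ≠ (top s).M := by
  intro h
  have h3 := (hlac s' hs').2.2.1
  have h4 : (top s).ξ < (top s').ξ := by
    have : (top s).ξ * 2 ^ s'.k < (top s').ξ * 2 ^ s'.k := by linarith
    exact lt_of_mul_lt_mul_right this (by positivity)
  refine hstar s hs s' hs' h4 ⟨hk.trans (hlac s hs).1, h, ?_⟩
  exact (hgood s' hs' (top s).ξ h1 (by linarith)).symm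

lemma div_chain {k k' K : ℕ} {m m' M : ℤ} (h1 : k' ≤ k) (h2 : k ≤ K) (h3 : m' / 2 ^ (k - k') = m)
    (h4 : m / 2 ^ (K - k) = M) : m' / 2 ^ (K - k') = M := by
  rw [← h4, ← h3, Int.ediv_ediv_of_nonneg (by positivity), ← pow_add]
  congr 2; omega

open Classical in
/-- The off-diagonal sum for a fixed tile. -/
lemma sum_neighbours_le {τ : ℝ} {S : Finset Tile} {top : Tile → TreeTop}
    (hgood : ∀ s ∈ S, s.Good τ) (hlac : ∀ s ∈ S, (top s).InLac s)
    (hstar : ∀ s ∈ S, ∀ s' ∈ S, (top s).ξ < (top s').ξ → ¬ s'.toTop.Below τ (top s))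
    (hsep : ∀ s ∈ S, ∀ s' ∈ S, s'.k < s.k → s'.k + 8 ≤ s.k) {s : Tile} (hs : s ∈ S)
    (N : Finset Tile) (hNS : N ⊆ S) (hN : ∀ s' ∈ N, s'.k < s.k ∧ ∃ ζ : ℝ, ((s.l : ℝ) - 8 ≤ ζ * 2 ^ s.k ∧
      ζ * 2 ^ s.k ≤ s.l - 1) ∧ ((s'.l : ℝ) - 8 ≤ ζ * 2 ^ s'.k ∧ ζ * 2 ^ s'.k ≤ s'.l - 1)) :
    ∑ s' ∈ N, 2 ^ s'.k * (dyWt s.k s.m (s'.m * 2 ^ s'.k) ^ 2)⁻¹ ≤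
      80 * 2 ^ s.k * tailWt (top s) s.k s.m := by
  have hout : ∀ s' ∈ N, s'.m / 2 ^ ((top s).K - s'.k) ≠ (top s).M := by
    intro s' hs'
    obtain ⟨hk, ζ, ⟨h1, h2⟩, h3, h4⟩ := hN s' hs'
    obtain ⟨_, _, h5, h6⟩ := hlac s hs
    obtain ⟨h7, h8⟩ := freq_sep (hsep s hs s' (hNS hs') hk) (ξ := (top s).ξ) (ζ := ζ)
      (by linarith) (by linarith) h3 h4
    exact selection_disjoint hgood hlac hstar hs (hNS hs') hk.le h7 h8
  have hdisj : ∀ s1 ∈ N, ∀ s2 ∈ N, s2.k < s1.k → s2.m / 2 ^ (s1.k - s2.k) ≠ s1.m := by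
    intro s1 hs1 s2 hs2 hk h
    obtain ⟨hk1, ζ1, ⟨h1, h2⟩, h3, h4⟩ := hN s1 hs1
    obtain ⟨hk2, ζ2, ⟨h1', h2'⟩, h3', h4'⟩ := hN s2 hs2
    obtain ⟨hK, hM, h5, h6⟩ := hlac s1 (hNS hs1)
    have hsep1 := hsep s hs s1 (hNS hs1) hk1
    have hNN : (256 : ℝ) ≤ 2 ^ (s.k - s1.k) := by
      calc (256 : ℝ) = 2 ^ 8 := by norm_num
        _ ≤ 2 ^ (s.k - s1.k) := pow_le_pow_right₀ (by norm_num) (by omega)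
    have hz : |(ζ1 - ζ2) * 2 ^ s1.k| ≤ 7 / 256 := by
      have : |(ζ1 - ζ2) * 2 ^ s.k| ≤ 7 := by rw [abs_le]; constructor <;> linarith
      rw [two_pow_mul_sub hk1.le, ← mul_assoc, abs_mul, abs_of_pos (a := (2 : ℝ) ^ (s.k - s1.k))
        (by positivity)] at this
      have h0 := abs_nonneg ((ζ1 - ζ2) * 2 ^ s1.k)
      nlinarith
    obtain ⟨hz1, hz2⟩ := abs_le.1 hz
    obtain ⟨h7, h8⟩ := freq_sep (hsep s1 (hNS hs1) s2 (hNS hs2) hk) (ξ := (top s1).ξ) (ζ := ζ2)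
      (by linarith) (by linarith) h3' h4'
    exact selection_disjoint hgood hlac hstar (hNS hs1) (hNS hs2) hk.le h7 h8
      (div_chain hk.le hK h hM)
  set X := N.biUnion fun s' => dyInt s'.k s'.m with hX
  have hXout : ∀ x ∈ X, x / 2 ^ (top s).K ≠ (top s).M := by
    intro x hx h
    obtain ⟨s', hs', hx'⟩ := Finset.mem_biUnion.1 hx
    refine hout s' hs' ?_
    rw [mem_dyInt] at hx'
    rw [← hx', div_two_pow_of_le ((hN s' hs').1.le.trans (hlac s hs).1), h]
  have hmult : ∀ x, (N.filter fun s' => x ∈ dyInt s'.k s'.m).card ≤ 10 := by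
    intro x
    rcases (N.filter fun s' => x ∈ dyInt s'.k s'.m).eq_empty_or_nonempty with h | ⟨s1, hs1⟩
    · rw [h]; simp
    have hkeq : ∀ s' ∈ N.filter (fun s' => x ∈ dyInt s'.k s'.m), s'.k = s1.k := by
      intro s2 hs2
      obtain ⟨hs1, hx1⟩ := Finset.mem_filter.1 hs1
      obtain ⟨hs2, hx2⟩ := Finset.mem_filter.1 hs2
      rw [mem_dyInt] at hx1 hx2
      rcases lt_trichotomy s2.k s1.k with h | h | h
      · exact absurd (by rw [← hx2, div_two_pow_of_le h.le, hx1]) (hdisj s1 hs1 s2 hs2 h)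
      · exact h
      · exact absurd (by rw [← hx1, div_two_pow_of_le h.le, hx2]) (hdisj s2 hs2 s1 hs1 h)
    refine card_tiles_le _ s1.k (x / 2 ^ s1.k) hkeq (fun s2 hs2 => ?_)
      ((s.l : ℝ) / 2 ^ (s.k - s1.k)) 9 (fun s2 hs2 => ?_)
    · have := (Finset.mem_filter.1 hs2).2
      rw [mem_dyInt, hkeq s2 hs2] at this
      exact this.symm
    · have hk2 := hkeq s2 hs2
      obtain ⟨hk, ζ, ⟨h1, h2⟩, h3, h4⟩ := hN s2 (Finset.mem_filter.1 hs2).1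
      have hsep1 := hsep s hs s2 (hNS (Finset.mem_filter.1 hs2).1) hk
      rw [hk2] at h3 h4 hk hsep1
      have hNN : (256 : ℝ) ≤ 2 ^ (s.k - s1.k) := by
        calc (256 : ℝ) = 2 ^ 8 := by norm_num
          _ ≤ 2 ^ (s.k - s1.k) := pow_le_pow_right₀ (by norm_num) (by omega)
      have hp : (0 : ℝ) < 2 ^ (s.k - s1.k) := by positivity
      rw [two_pow_mul_sub hk.le, ← mul_assoc] at h1 h2
      rw [div_le_iff₀ hp, ← sub_le_iff_le_add, le_div_iff₀ hp]
      push_cast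
      constructor
      · nlinarith
      · nlinarith
  have hpt : ∀ s' ∈ N, 2 ^ s'.k * (dyWt s.k s.m (s'.m * 2 ^ s'.k) ^ 2)⁻¹ ≤
      ∑ x ∈ dyInt s'.k s'.m, 4 * (dyWt s.k s.m x ^ 2)⁻¹ := by
    intro s' hs'
    have hc : (2 : ℝ) ^ s'.k = ((dyInt s'.k s'.m).card : ℝ) := by rw [card_dyInt]; push_cast; rfl
    rw [hc, ← nsmul_eq_mul, ← Finset.sum_const]
    refine Finset.sum_le_sum fun x hx => ?_
    have hd0 := dyWt_pos s.k s.m (s'.m * 2 ^ s'.k)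
    have hd1 := dyWt_pos s.k s.m x
    have hle : dyWt s.k s.m x ≤ 2 * dyWt s.k s.m (s'.m * 2 ^ s'.k) := by
      rw [dyInt, Finset.mem_Ico] at hx
      have hx1 : ((s'.m : ℝ) * 2 ^ s'.k) ≤ x := by exact_mod_cast hx.1
      have hx2 : (x : ℝ) < (s'.m + 1) * 2 ^ s'.k := by exact_mod_cast hx.2
      have hp : (0 : ℝ) < 2 ^ s.k := by positivity
      have hkk : (2 : ℝ) ^ s'.k ≤ 2 ^ s.k := pow_le_pow_right₀ (by norm_num) (hN s' hs').1.le
      have h1 : |(x : ℝ) - s.m * 2 ^ s.k| ≤ 2 ^ s.k + |((s'.m * 2 ^ s'.k : ℤ) : ℝ) - s.m * 2 ^ s.k| := by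
        have : (x : ℝ) - s.m * 2 ^ s.k = (x - s'.m * 2 ^ s'.k) +
          (((s'.m * 2 ^ s'.k : ℤ) : ℝ) - s.m * 2 ^ s.k) := by push_cast; ring
        rw [this]
        refine (abs_add_le _ _).trans ?_
        gcongr
        rw [abs_of_nonneg (by linarith)]
        linarith
      unfold dyWt
      have h2 : |(x : ℝ) - s.m * 2 ^ s.k| / 2 ^ s.k ≤ 1 +
          |((s'.m * 2 ^ s'.k : ℤ) : ℝ) - s.m * 2 ^ s.k| / 2 ^ s.k := by
        rw [div_le_iff₀ hp, add_mul, div_mul_cancel₀ _ hp.ne', one_mul]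
        exact h1
      have h3 : 0 ≤ |((s'.m * 2 ^ s'.k : ℤ) : ℝ) - s.m * 2 ^ s.k| / 2 ^ s.k := by positivity
      linarith
    have h4 : dyWt s.k s.m x ^ 2 ≤ 4 * dyWt s.k s.m (s'.m * 2 ^ s'.k) ^ 2 := by
      calc dyWt s.k s.m x ^ 2 ≤ (2 * dyWt s.k s.m (s'.m * 2 ^ s'.k)) ^ 2 := by gcongr
        _ = _ := by ring
    rw [← div_eq_mul_inv, inv_eq_one_div, div_le_div_iff₀ (by positivity) (by positivity)]
    linarith
  refine (Finset.sum_le_sum hpt).trans ?_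
  have hswap : ∑ s' ∈ N, ∑ x ∈ dyInt s'.k s'.m, 4 * (dyWt s.k s.m x ^ 2)⁻¹ =
      ∑ x ∈ X, ∑ s' ∈ N.filter (fun s' => x ∈ dyInt s'.k s'.m), 4 * (dyWt s.k s.m x ^ 2)⁻¹ := by
    refine Finset.sum_comm' fun s' x => ?_
    simp only [hX, Finset.mem_filter, Finset.mem_biUnion]
    constructor
    · rintro ⟨h1, h2⟩; exact ⟨⟨h1, h2⟩, s', h1, h2⟩
    · rintro ⟨h1, _⟩; exact h1
  rw [hswap]
  have h40 : ∑ x ∈ X, ∑ s' ∈ N.filter (fun s' => x ∈ dyInt s'.k s'.m), 4 * (dyWt s.k s.m x ^ 2)⁻¹ ≤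
      ∑ x ∈ X, 40 * (dyWt s.k s.m x ^ 2)⁻¹ := by
    refine Finset.sum_le_sum fun x _ => ?_
    rw [Finset.sum_const, nsmul_eq_mul]
    have h1 := dyWt_sq_inv_pos s.k s.m x
    have h2 : ((N.filter fun s' => x ∈ dyInt s'.k s'.m).card : ℝ) ≤ 10 := by
      exact_mod_cast hmult x
    nlinarith
  refine h40.trans ?_
  rw [← Finset.mul_sum]
  have := sum_dyWt_compl_le (hlac s hs).1 (hlac s hs).2.1 X hXout
  linarith

open Classical in
/-- The sum over the tiles of the same scale. -/
lemma sum_same_scale_le {s : Tile} (N : Finset Tile)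
    (hN : ∀ s' ∈ N, s'.k = s.k ∧ ∃ ζ : ℝ, ((s.l : ℝ) - 8 ≤ ζ * 2 ^ s.k ∧
      ζ * 2 ^ s.k ≤ s.l - 1) ∧ ((s'.l : ℝ) - 8 ≤ ζ * 2 ^ s'.k ∧ ζ * 2 ^ s'.k ≤ s'.l - 1)) :
    ∑ s' ∈ N, (dyWt s'.k s'.m (s.m * 2 ^ s.k) ^ 2)⁻¹ ≤ 300 := by
  have h0 : ∑ s' ∈ N, (dyWt s'.k s'.m (s.m * 2 ^ s.k) ^ 2)⁻¹ =
      ∑ s' ∈ N, (dyWt s.k s'.m (s.m * 2 ^ s.k) ^ 2)⁻¹ :=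
    Finset.sum_congr rfl fun s' hs' => by rw [(hN s' hs').1]
  rw [h0]
  have h1 := sum_comp_le_of_fiber N (fun s' => s'.m)
    (fun m => (dyWt s.k m (s.m * 2 ^ s.k) ^ 2)⁻¹) (fun m => (dyWt_sq_inv_pos _ _ _).le) 15 (by
      intro m
      refine card_tiles_le _ s.k m (fun s' hs' => (hN s' (Finset.mem_filter.1 hs').1).1)
        (fun s' hs' => (Finset.mem_filter.1 hs').2) (s.l - 7) 14 (fun s' hs' => ?_)
      obtain ⟨hk, ζ, ⟨h1, h2⟩, h3, h4⟩ := hN s' (Finset.mem_filter.1 hs').1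
      rw [hk] at h3 h4
      push_cast
      constructor <;> linarith)
  have h2 := sum_dyWt_mesh s.k (s.m * 2 ^ s.k) (N.image fun s' => s'.m)
  push_cast at h1
  linarith

/-- The frequency supports of the packets of two tiles meet. -/
def Tile.Overlap (s s' : Tile) : Prop :=
  ∃ ζ : ℝ, ((s.l : ℝ) - 8 ≤ ζ * 2 ^ s.k ∧ ζ * 2 ^ s.k ≤ s.l - 1) ∧
    ((s'.l : ℝ) - 8 ≤ ζ * 2 ^ s'.k ∧ ζ * 2 ^ s'.k ≤ s'.l - 1)

lemma Tile.Overlap.symm {s s' : Tile} (h : s.Overlap s') : s'.Overlap s := by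
  obtain ⟨ζ, h1, h2⟩ := h
  exact ⟨ζ, h2, h1⟩

lemma dyWt_comm (k : ℕ) (m m' : ℤ) : dyWt k m (m' * 2 ^ k) = dyWt k m' (m * 2 ^ k) := by
  unfold dyWt; push_cast; rw [abs_sub_comm]

open Classical in
/-- Almost orthogonality for the selected tiles. -/
lemma norm_sum_packets_le {H : Type*} [NormedAddCommGroup H] [InnerProductSpace ℂ H]
    {v : Tile → H} {B : ℝ} (hB : 0 ≤ B) (hv : PacketBound v B)
    {τ : ℝ} {S : Finset Tile} {top : Tile → TreeTop}
    (hgood : ∀ s ∈ S, s.Good τ) (hlac : ∀ s ∈ S, (top s).InLac s)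
    (hstar : ∀ s ∈ S, ∀ s' ∈ S, (top s).ξ < (top s').ξ → ¬ s'.toTop.Below τ (top s))
    (hsep : ∀ s ∈ S, ∀ s' ∈ S, s'.k < s.k → s'.k + 8 ≤ s.k) (α : Tile → ℂ) {ε : ℝ} (hε : 0 < ε)
    (hα : ∀ s ∈ S, ‖α s‖ ≤ ε) :
    ‖∑ s ∈ S, ((2 : ℂ) ^ s.k * α s) • v s‖ ^ 2 ≤ 400 * B * ∑ s ∈ S, 2 ^ s.k * ‖α s‖ ^ 2 +
      80 * B * ε ^ 2 * ∑ s ∈ S, 2 ^ s.k * tailWt (top s) s.k s.m ^ 2 := by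
  set w : Tile → Tile → ℝ := fun s s' =>
    2 ^ s.k * ‖α s‖ * (2 ^ s'.k * ‖α s'‖) * ‖inner ℂ (v s) (v s')‖ with hw
  have hw0 : ∀ s s', 0 ≤ w s s' := fun s s' => by positivity
  have hwsymm : ∀ s s', w s s' = w s' s := by
    intro s s'
    simp only [hw]
    rw [norm_inner_symm]; ring
  have hwov : ∀ s s', ¬ s.Overlap s' → w s s' = 0 := by
    intro s s' h
    have : inner ℂ (v s) (v s') = 0 := by
      by_contra h'
      exact h (hv.orth s s' h')
    simp [hw, this]
  have h1 : ‖∑ s ∈ S, ((2 : ℂ) ^ s.k * α s) • v s‖ ^ 2 ≤ ∑ s ∈ S, ∑ s' ∈ S, w s s' := by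
    rw [← inner_self_eq_norm_sq (𝕜 := ℂ)]
    refine (RCLike.re_le_norm _).trans ?_
    rw [sum_inner]
    refine (norm_sum_le _ _).trans (Finset.sum_le_sum fun s _ => ?_)
    rw [inner_sum]
    refine (norm_sum_le _ _).trans (Finset.sum_le_sum fun s' _ => ?_)
    rw [inner_smul_left, inner_smul_right]
    simp only [norm_mul, RCLike.norm_conj, norm_pow, Complex.norm_ofNat, hw]
    apply le_of_eq; ring
  have h2 : ∑ s ∈ S, ∑ s' ∈ S, w s s' = ∑ s ∈ S, ∑ s' ∈ S.filter (fun s' => s'.k = s.k), w s s' +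
      2 * ∑ s ∈ S, ∑ s' ∈ S.filter (fun s' => s'.k < s.k), w s s' := by
    have e1 : ∀ s ∈ S, ∑ s' ∈ S, w s s' = ∑ s' ∈ S.filter (fun s' => s'.k = s.k), w s s' +
        (∑ s' ∈ S.filter (fun s' => s'.k < s.k), w s s' +
        ∑ s' ∈ S.filter (fun s' => s.k < s'.k), w s s') := by
      intro s _
      simp only [Finset.sum_filter, ← Finset.sum_add_distrib]
      refine Finset.sum_congr rfl fun s' _ => ?_
      rcases lt_trichotomy s'.k s.k with h | h | h
      · simp [h, h.ne, h.not_gt]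
      · simp [h]
      · simp [h, h.ne', h.not_gt]
    have e2 : ∑ s ∈ S, ∑ s' ∈ S.filter (fun s' => s.k < s'.k), w s s' =
        ∑ s ∈ S, ∑ s' ∈ S.filter (fun s' => s'.k < s.k), w s s' := by
      rw [Finset.sum_comm' (t' := S) (s' := fun s' => S.filter fun s => s.k < s'.k)]
      · exact Finset.sum_congr rfl fun s _ => Finset.sum_congr rfl fun s' _ => hwsymm _ _
      · intro s s'
        simp only [Finset.mem_filter]; tauto
    rw [Finset.sum_congr rfl e1, Finset.sum_add_distrib, Finset.sum_add_distrib, e2]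
    ring
  have h3 : ∑ s ∈ S, ∑ s' ∈ S.filter (fun s' => s'.k = s.k), w s s' ≤
      300 * B * ∑ s ∈ S, 2 ^ s.k * ‖α s‖ ^ 2 := by
    set F : Tile → Finset Tile := fun s => S.filter fun s' => s'.k = s.k ∧ s.Overlap s' with hF
    set q : Tile → Tile → ℝ := fun s s' => (dyWt s'.k s'.m (s.m * 2 ^ s.k) ^ 2)⁻¹ with hq
    have hqsum : ∀ s, ∑ s' ∈ F s, q s s' ≤ 300 := fun s =>
      sum_same_scale_le (F s) fun s' hs' => (Finset.mem_filter.1 hs').2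
    have e1 : ∀ s ∈ S, ∑ s' ∈ S.filter (fun s' => s'.k = s.k), w s s' ≤
        ∑ s' ∈ F s, (B / 2 * (2 ^ s.k * ‖α s‖ ^ 2) * q s s' +
          B / 2 * (2 ^ s'.k * ‖α s'‖ ^ 2) * q s s') := by
      intro s _
      have e0 : ∑ s' ∈ S.filter (fun s' => s'.k = s.k), w s s' = ∑ s' ∈ F s, w s s' := by
        symm
        apply Finset.sum_subset
        · intro s' hs'
          rw [Finset.mem_filter] at hs' ⊢
          exact ⟨hs'.1, hs'.2.1⟩
        · intro s' hs' hs''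
          rw [Finset.mem_filter] at hs' hs''
          exact hwov s s' fun h => hs'' ⟨hs'.1, hs'.2, h⟩
      rw [e0]
      refine Finset.sum_le_sum fun s' hs' => ?_
      have hk := (Finset.mem_filter.1 hs').2.1
      have hd := hv.decay s s' hk.le
      rw [hk, dyWt_comm] at hd
      simp only [hw, hq, hk]
      have hq0 := dyWt_sq_inv_pos s.k s'.m (s.m * 2 ^ s.k)
      set Q := (dyWt s.k s'.m (s.m * 2 ^ s.k) ^ 2)⁻¹
      have hp : (0 : ℝ) < 2 ^ s.k := by positivity
      calc 2 ^ s.k * ‖α s‖ * (2 ^ s.k * ‖α s'‖) * ‖inner ℂ (v s) (v s')‖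
          ≤ 2 ^ s.k * ‖α s‖ * (2 ^ s.k * ‖α s'‖) * (B / 2 ^ s.k * Q) := by gcongr
        _ = B * 2 ^ s.k * Q * (‖α s‖ * ‖α s'‖) := by field_simp
        _ ≤ B * 2 ^ s.k * Q * ((‖α s‖ ^ 2 + ‖α s'‖ ^ 2) / 2) := by
            gcongr
            nlinarith [sq_nonneg (‖α s‖ - ‖α s'‖)]
        _ = _ := by ring
    refine (Finset.sum_le_sum e1).trans ?_
    simp only [Finset.sum_add_distrib]
    have e2 : ∑ s ∈ S, ∑ s' ∈ F s, B / 2 * (2 ^ s'.k * ‖α s'‖ ^ 2) * q s s' =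
        ∑ s ∈ S, ∑ s' ∈ F s, B / 2 * (2 ^ s.k * ‖α s‖ ^ 2) * q s s' := by
      rw [Finset.sum_comm' (t' := S) (s' := F)]
      · refine Finset.sum_congr rfl fun s _ => Finset.sum_congr rfl fun s' hs' => ?_
        have hk := (Finset.mem_filter.1 hs').2.1
        simp only [hq, hk]
        rw [dyWt_comm]
      · intro s s'
        simp only [hF, Finset.mem_filter]
        constructor
        · rintro ⟨h1, h2, h3, h4⟩; exact ⟨⟨h1, h3.symm, h4.symm⟩, h2⟩
        · rintro ⟨⟨h1, h3, h4⟩, h2⟩; exact ⟨h1, h2, h3.symm, h4.symm⟩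
    have e3 : ∑ s ∈ S, ∑ s' ∈ F s, B / 2 * (2 ^ s.k * ‖α s‖ ^ 2) * q s s' ≤
        ∑ s ∈ S, 150 * B * (2 ^ s.k * ‖α s‖ ^ 2) := by
      refine Finset.sum_le_sum fun s _ => ?_
      rw [← Finset.mul_sum]
      have h0 : 0 ≤ B / 2 * (2 ^ s.k * ‖α s‖ ^ 2) := by positivity
      have := mul_le_mul_of_nonneg_left (hqsum s) h0
      linarith
    rw [e2]
    rw [← Finset.mul_sum] at e3
    linarith
  have h4 : ∑ s ∈ S, ∑ s' ∈ S.filter (fun s' => s'.k < s.k), w s s' ≤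
      ∑ s ∈ S, 40 * B * (2 ^ s.k * ‖α s‖ ^ 2 + ε ^ 2 * (2 ^ s.k * tailWt (top s) s.k s.m ^ 2)) := by
    refine Finset.sum_le_sum fun s hs => ?_
    set F := S.filter fun s' => s'.k < s.k ∧ s.Overlap s' with hF
    have e0 : ∑ s' ∈ S.filter (fun s' => s'.k < s.k), w s s' = ∑ s' ∈ F, w s s' := by
      symm
      apply Finset.sum_subset
      · intro s' hs'
        rw [Finset.mem_filter] at hs' ⊢
        exact ⟨hs'.1, hs'.2.1⟩
      · intro s' hs' hs''
        rw [Finset.mem_filter] at hs' hs''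
        exact hwov s s' fun h => hs'' ⟨hs'.1, hs'.2, h⟩
    rw [e0]
    have e1 := sum_neighbours_le hgood hlac hstar hsep hs F (Finset.filter_subset _ _)
      fun s' hs' => (Finset.mem_filter.1 hs').2
    have e2 : ∑ s' ∈ F, w s s' ≤ ∑ s' ∈ F, B * ε * ‖α s‖ *
        (2 ^ s'.k * (dyWt s.k s.m (s'.m * 2 ^ s'.k) ^ 2)⁻¹) := by
      refine Finset.sum_le_sum fun s' hs' => ?_
      obtain ⟨hs'S, hk, _⟩ := Finset.mem_filter.1 hs'
      have hd := hv.decay s s' hk.le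
      have ha := hα s' hs'S
      have hq0 := dyWt_sq_inv_pos s.k s.m (s'.m * 2 ^ s'.k)
      simp only [hw]
      set Q := (dyWt s.k s.m (s'.m * 2 ^ s'.k) ^ 2)⁻¹
      calc 2 ^ s.k * ‖α s‖ * (2 ^ s'.k * ‖α s'‖) * ‖inner ℂ (v s) (v s')‖
          ≤ 2 ^ s.k * ‖α s‖ * (2 ^ s'.k * ε) * (B / 2 ^ s.k * Q) := by gcongr
        _ = _ := by field_simp
    rw [← Finset.mul_sum] at e2
    have hρ := tailWt_nonneg (top s) s.k s.m
    set ρ := tailWt (top s) s.k s.m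
    have e3 : B * ε * ‖α s‖ * ∑ s' ∈ F, (2 ^ s'.k * (dyWt s.k s.m (s'.m * 2 ^ s'.k) ^ 2)⁻¹) ≤
        B * ε * ‖α s‖ * (80 * 2 ^ s.k * ρ) := by gcongr
    refine e2.trans (e3.trans ?_)
    have e4 : 2 * (‖α s‖ * (ε * ρ)) ≤ ‖α s‖ ^ 2 + (ε * ρ) ^ 2 := by
      nlinarith [sq_nonneg (‖α s‖ - ε * ρ)]
    have hp : (0 : ℝ) < 2 ^ s.k := by positivity
    calc B * ε * ‖α s‖ * (80 * 2 ^ s.k * ρ) = 40 * B * 2 ^ s.k * (2 * (‖α s‖ * (ε * ρ))) := by ring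
      _ ≤ 40 * B * 2 ^ s.k * (‖α s‖ ^ 2 + (ε * ρ) ^ 2) := by gcongr
      _ = _ := by ring
  rw [← Finset.mul_sum, Finset.sum_add_distrib, ← Finset.mul_sum] at h4
  have h5 : 0 ≤ B * ∑ s ∈ S, 2 ^ s.k * ‖α s‖ ^ 2 := by positivity
  linarith

open Classical in
/-- **Energy lemma.** -/
lemma energy_lemma {H : Type*} [NormedAddCommGroup H] [InnerProductSpace ℂ H]
    {v : Tile → H} {B : ℝ} (hB : 0 ≤ B) (hv : PacketBound v B) (g : H) (τ : ℝ) (P : Finset Tile)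
    (hgood : ∀ s ∈ P, s.Good τ) (hsep : ∀ s ∈ P, ∀ s' ∈ P, s'.k < s.k → s'.k + 8 ≤ s.k)
    {ε : ℝ} (hε : 0 < ε)
    (hE : EnergyLE (fun s => 2 ^ s.k * ‖inner ℂ (v s) g‖ ^ 2) P (ε ^ 2)) :
    ∃ P' ⊆ P, EnergyLE (fun s => 2 ^ s.k * ‖inner ℂ (v s) g‖ ^ 2) P' (ε ^ 2 / 4) ∧
      ∃ S : Finset TreeTop, (∀ s ∈ P \ P', ∃ t ∈ S, s.toTop.Below τ t) ∧
      ∑ t ∈ S, (2 : ℝ) ^ t.K ≤ 1000000 * B / ε ^ 2 * ‖g‖ ^ 2 := by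
  set a : Tile → ℝ := fun s => 2 ^ s.k * ‖inner ℂ (v s) g‖ ^ 2 with ha
  have ha0 : ∀ s, 0 ≤ a s := fun s => by positivity
  obtain ⟨P', hP', S, hSP, top, h1, hlac, h3, h4, hstar⟩ := exists_selection τ a ha0
    (e := ε ^ 2 / 4) (by positivity) _ P le_rfl hgood
  refine ⟨P', hP', h1, S.image top, fun s hs => ?_, ?_⟩
  · obtain ⟨s', hs', hb⟩ := h4 s hs
    exact ⟨_, Finset.mem_image_of_mem _ hs', hb⟩
  set Y := ∑ t ∈ S.image top, (2 : ℝ) ^ t.K with hY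
  have hY0 : 0 ≤ Y := Finset.sum_nonneg fun _ _ => by positivity
  have hfib : ∀ f : Tile → ℝ, ∑ s ∈ S, f s =
      ∑ t ∈ S.image top, ∑ s ∈ S.filter (fun s => top s = t), f s := fun f =>
    (Finset.sum_fiberwise_of_maps_to (fun s hs => Finset.mem_image_of_mem top hs) f).symm
  have hup : ∑ s ∈ S, a s ≤ ε ^ 2 * Y := by
    rw [hfib, hY, Finset.mul_sum]
    refine Finset.sum_le_sum fun t _ => le_trans ?_ (hE t)
    refine Finset.sum_le_sum_of_subset_of_nonneg (fun s hs => ?_) fun s _ _ => ha0 s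
    obtain ⟨h5, rfl⟩ := Finset.mem_filter.1 hs
    exact Finset.mem_filter.2 ⟨hSP h5, hlac s h5⟩
  have hlow : ε ^ 2 / 4 * Y ≤ ∑ s ∈ S, a s := by
    rw [hfib, hY, Finset.mul_sum]
    refine Finset.sum_le_sum fun t ht => ?_
    obtain ⟨s, hs, rfl⟩ := Finset.mem_image.1 ht
    exact (h3 s hs).le
  have htail : ∑ s ∈ S, 2 ^ s.k * tailWt (top s) s.k s.m ^ 2 ≤ 480 * Y := by
    rw [hfib, hY, Finset.mul_sum]
    refine Finset.sum_le_sum fun t _ => ?_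
    refine le_trans (le_of_eq ?_) (sum_tailWt_sq_le t (S.filter fun s => top s = t) fun s hs => ?_)
    · refine Finset.sum_congr rfl fun s hs => ?_
      rw [(Finset.mem_filter.1 hs).2]
    · obtain ⟨h5, rfl⟩ := Finset.mem_filter.1 hs
      exact hlac s h5
  have hα : ∀ s ∈ S, ‖inner ℂ (v s) g‖ ≤ ε := by
    intro s hs
    have := hE.apply_le ha0 (hSP hs)
    simp only [ha] at this
    have hp : (0 : ℝ) < 2 ^ s.k := by positivity
    have h2 : ‖inner ℂ (v s) g‖ ^ 2 ≤ ε ^ 2 := by nlinarith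
    exact le_of_sq_le_sq h2 hε.le
  have hV := norm_sum_packets_le hB hv (fun s hs => hgood s (hSP hs)) hlac hstar
    (fun s hs s' hs' => hsep s (hSP hs) s' (hSP hs')) (fun s => inner ℂ (v s) g) hε hα
  set V := ∑ s ∈ S, ((2 : ℂ) ^ s.k * inner ℂ (v s) g) • v s with hVdef
  have hin : inner ℂ V g = ((∑ s ∈ S, a s : ℝ) : ℂ) := by
    rw [hVdef, sum_inner]
    push_cast
    refine Finset.sum_congr rfl fun s _ => ?_
    have h2 : (starRingEnd ℂ) (2 : ℂ) = 2 := Complex.conj_ofNat 2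
    rw [inner_smul_left, map_mul, map_pow, mul_assoc, RCLike.conj_mul, h2]
    simp [ha]
  have hcs : ∑ s ∈ S, a s ≤ ‖V‖ * ‖g‖ := by
    have h5 := norm_inner_le_norm (𝕜 := ℂ) V g
    rw [hin, Complex.norm_real] at h5
    exact (Real.le_norm_self _).trans h5
  have hV2 : ‖V‖ ^ 2 ≤ 38800 * B * (ε ^ 2 * Y) := by
    refine hV.trans ?_
    have h6 : 400 * B * ∑ s ∈ S, a s ≤ 400 * B * (ε ^ 2 * Y) := by gcongr
    have h7 : 80 * B * ε ^ 2 * ∑ s ∈ S, 2 ^ s.k * tailWt (top s) s.k s.m ^ 2 ≤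
        80 * B * ε ^ 2 * (480 * Y) := by gcongr
    linarith
  have hsq : (ε ^ 2 / 4 * Y) ^ 2 ≤ 38800 * B * (ε ^ 2 * Y) * ‖g‖ ^ 2 := by
    calc (ε ^ 2 / 4 * Y) ^ 2 ≤ (‖V‖ * ‖g‖) ^ 2 := by
          have := hlow.trans hcs
          gcongr
      _ = ‖V‖ ^ 2 * ‖g‖ ^ 2 := by ring
      _ ≤ _ := by gcongr
  rcases hY0.eq_or_lt with h0 | h0
  · rw [← h0]; positivity
  · have h8 : ε ^ 2 * Y * (ε ^ 2 * Y) ≤ ε ^ 2 * Y * (16 * 38800 * B * ‖g‖ ^ 2) := by nlinarith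
    have h9 := le_of_mul_le_mul_left h8 (by positivity)
    have h10 : Y * ε ^ 2 ≤ 1000000 * B * ‖g‖ ^ 2 := by
      have : 0 ≤ B * ‖g‖ ^ 2 := by positivity
      nlinarith
    rw [div_mul_eq_mul_div, le_div_iff₀ (by positivity)]
    exact h10

/-! ### The tree lemma: preliminaries and the far part -/

/-- The frequency `η` belongs to the frequency interval of `s`. -/
def Tile.Has (s : Tile) (η : ℝ) : Prop := ⌊η * 2 ^ s.k⌋ = s.l

lemma Tile.has_iff {s : Tile} {η : ℝ} : s.Has η ↔ (s.l : ℝ) ≤ η * 2 ^ s.k ∧ η * 2 ^ s.k < s.l + 1 :=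
  Int.floor_eq_iff

lemma Tile.Good.gridIdx_eq {τ : ℝ} {s : Tile} (hs : s.Good τ) {η : ℝ} (h : s.Has η) :
    gridIdx τ s.k η = gridIdx τ s.k s.c := by
  obtain ⟨h1, h2⟩ := Tile.has_iff.1 h
  exact hs η (by linarith) (by linarith)

lemma Tile.below_self (τ : ℝ) (s : Tile) : s.toTop.Below τ s.toTop := by
  refine ⟨le_rfl, ?_, rfl⟩
  simp [Tile.toTop]

lemma dyWt_ge_of_lt {k j : ℕ} {m x : ℤ} (h : 2 ^ j * 2 ^ k ≤ |x - m * 2 ^ k|) :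
    (2 : ℝ) ^ j ≤ dyWt k m x := by
  have h1 : (2 : ℝ) ^ j * 2 ^ k ≤ |(x : ℝ) - m * 2 ^ k| := by exact_mod_cast h
  unfold dyWt
  have : (2 : ℝ) ^ j ≤ |(x : ℝ) - m * 2 ^ k| / 2 ^ k := by
    rw [le_div_iff₀ (by positivity)]; exact h1
  linarith

lemma dyWt_cube_inv_le {k : ℕ} {m x : ℤ} {J : ℕ} (h : |x - m * 2 ^ k| ≤ 2 ^ J * 2 ^ k) :
    (dyWt k m x ^ 3)⁻¹ ≤
      ∑ j ∈ Finset.range (J + 1), if |x - m * 2 ^ k| ≤ 2 ^ j * 2 ^ k then 8 / (2 : ℝ) ^ (3 * j) else 0 := by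
  classical
  have hex : ∃ j, |x - m * 2 ^ k| ≤ 2 ^ j * 2 ^ k := ⟨J, h⟩
  set j := Nat.find hex with hj
  have hjs : |x - m * 2 ^ k| ≤ 2 ^ j * 2 ^ k := Nat.find_spec hex
  have hjJ : j ≤ J := Nat.find_min' hex h
  have h1 : (dyWt k m x ^ 3)⁻¹ ≤ 8 / (2 : ℝ) ^ (3 * j) := by
    have h0 := one_le_dyWt k m x
    rcases Nat.eq_zero_or_pos j with h0' | h0'
    · rw [h0']
      have : 1 ≤ dyWt k m x ^ 3 := one_le_pow₀ h0
      have := inv_le_one_of_one_le₀ this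
      norm_num; linarith
    · obtain ⟨i, hi⟩ : ∃ i, j = i + 1 := ⟨j - 1, by omega⟩
      have hlt := Nat.find_min hex (m := i) (by omega)
      have h2 : (2 : ℝ) ^ i ≤ dyWt k m x := dyWt_ge_of_lt (le_of_lt (not_le.1 hlt))
      have h3 : ((2 : ℝ) ^ i) ^ 3 ≤ dyWt k m x ^ 3 := by gcongr
      have h4 : (2 : ℝ) ^ (3 * j) = 8 * ((2 : ℝ) ^ i) ^ 3 := by rw [hi, ← pow_mul]; ring
      rw [h4, div_mul_cancel_left₀ (by norm_num)]
      gcongr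
  refine h1.trans ?_
  have h5 : (8 / (2 : ℝ) ^ (3 * j)) =
      if |x - m * 2 ^ k| ≤ 2 ^ j * 2 ^ k then 8 / (2 : ℝ) ^ (3 * j) else 0 := (if_pos hjs).symm
  rw [h5]
  refine Finset.single_le_sum (f := fun j => if |x - m * 2 ^ k| ≤ 2 ^ j * 2 ^ k then
    8 / (2 : ℝ) ^ (3 * j) else 0) (fun i _ => ?_) (Finset.mem_range.2 (Nat.lt_succ_of_le hjJ))
  split_ifs <;> positivity

open Classical in
lemma weighted_mass {τ : ℝ} {η : ℤ → ℝ} {E : Finset ℤ} {P : Finset Tile} {μ : ℝ} (hμ : 0 ≤ μ)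
    (hP : MassLE τ η E P μ) {s : Tile} (hs : s ∈ P) (hg : s.Good τ) :
    ∑ x ∈ E.filter (fun x => s.Has (η x)), (dyWt s.k s.m x ^ 3)⁻¹ ≤ 16 * μ * 2 ^ s.k := by
  set F := E.filter fun x => s.Has (η x) with hF
  obtain ⟨J, hJ⟩ : ∃ J : ℕ, ∀ x ∈ F, |x - s.m * 2 ^ s.k| ≤ 2 ^ J * 2 ^ s.k := by
    refine ⟨F.sup fun x => (|x - s.m * 2 ^ s.k|).toNat, fun x hx => ?_⟩
    have h1 := Finset.le_sup (f := fun x => (|x - s.m * 2 ^ s.k|).toNat) hx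
    set J := F.sup fun x => (|x - s.m * 2 ^ s.k|).toNat
    have h2 : J < 2 ^ J := Nat.lt_two_pow_self
    have h3 : (J : ℤ) < 2 ^ J := by exact_mod_cast h2
    have h4 : (1 : ℤ) ≤ 2 ^ s.k := one_le_pow₀ (by norm_num)
    have h5 : |x - s.m * 2 ^ s.k| ≤ J := by omega
    nlinarith
  refine (Finset.sum_le_sum fun x hx => dyWt_cube_inv_le (hJ x hx)).trans ?_
  rw [Finset.sum_comm]
  have h1 : ∀ j ∈ Finset.range (J + 1), ∑ x ∈ F, (if |x - s.m * 2 ^ s.k| ≤ 2 ^ j * 2 ^ s.k then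
      8 / (2 : ℝ) ^ (3 * j) else 0) ≤ 8 * μ * 2 ^ s.k * (1 / 2) ^ j := by
    intro j _
    rw [← Finset.sum_filter, Finset.sum_const, nsmul_eq_mul]
    have h2 : ((F.filter fun x => |x - s.m * 2 ^ s.k| ≤ 2 ^ j * 2 ^ s.k).card : ℝ) ≤
        μ * 2 ^ (2 * j) * 2 ^ s.k := by
      refine le_trans ?_ (hP s hs s.toTop (s.below_self τ) j)
      norm_cast
      refine Finset.card_le_card fun x hx => ?_
      simp only [hF, Finset.mem_filter] at hx
      simp only [massSet, Finset.mem_filter]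
      exact ⟨hx.1.1, hg.gridIdx_eq hx.1.2, hx.2⟩
    have h3 : (2 : ℝ) ^ (3 * j) = 2 ^ (2 * j) * 2 ^ j := by rw [← pow_add]; congr 1; ring
    calc _ ≤ μ * 2 ^ (2 * j) * 2 ^ s.k * (8 / (2 : ℝ) ^ (3 * j)) := by gcongr
      _ = 8 * μ * 2 ^ s.k * (1 / 2) ^ j := by
        rw [h3, one_div, inv_pow]; field_simp
  refine (Finset.sum_le_sum h1).trans ?_
  rw [← Finset.mul_sum]
  have h2 : ∑ j ∈ Finset.range (J + 1), (1 / 2 : ℝ) ^ j ≤ 2 := sum_geometric_two_le _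
  have h3 : 0 ≤ 8 * μ * 2 ^ s.k := by positivity
  nlinarith

/-- The characters used throughout: `eChar y = exp (2 π i y)`. -/
noncomputable def eChar (y : ℝ) : ℂ := Complex.exp ((2 * Real.pi * y : ℝ) * Complex.I)

@[simp] lemma norm_eChar (y : ℝ) : ‖eChar y‖ = 1 := Complex.norm_exp_ofReal_mul_I _

/-- The frequency `ξ` is in lacunary position with respect to the tile `s`. -/
def Tile.LacFreq (s : Tile) (ξ : ℝ) : Prop :=
  (s.l : ℝ) - 1 / 2 ≤ ξ * 2 ^ s.k ∧ ξ * 2 ^ s.k < s.l + 3 / 2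

/-- Bounds for the dual wave packets. -/
structure WaveBound (w : Tile → ℤ → ℂ) (B : ℝ) : Prop where
  /-- decay -/
  decay : ∀ s x, ‖w s x‖ ≤ B * (dyWt s.k s.m x ^ 6)⁻¹
  /-- smoothness after demodulation -/
  smooth : ∀ s ξ, s.LacFreq ξ → ∀ x y : ℤ, |(x : ℝ) - y| ≤ 2 ^ s.k →
    ‖eChar (-(ξ * x / 8)) * w s x - eChar (-(ξ * y / 8)) * w s y‖ ≤
      B * (|(x : ℝ) - y| / 2 ^ s.k) * (dyWt s.k s.m x ^ 2)⁻¹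
  /-- cancellation -/
  cancel : ∀ s ξ, 1 ≤ s.k → s.LacFreq ξ → ∀ a b : ℤ, a ≤ b →
    ‖∑ y ∈ Finset.Ico a b, eChar (-(ξ * y / 8)) * w s y‖ ≤
      B * 2 ^ s.k * ((dyWt s.k s.m a ^ 2)⁻¹ + (dyWt s.k s.m b ^ 2)⁻¹)
  /-- almost orthogonality in lacunary trees -/
  bessel : ∀ (T : Finset Tile) (ξ : ℝ), (∀ s ∈ T, 1 ≤ s.k ∧ s.LacFreq ξ) →
    (∀ s ∈ T, ∀ s' ∈ T, s'.k < s.k → s'.k + 8 ≤ s.k) → ∀ (α : Tile → ℂ) (X : Finset ℤ),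
    ∑ x ∈ X, ‖∑ s ∈ T, α s * w s x‖ ^ 2 ≤ B * ∑ s ∈ T, 2 ^ s.k * ‖α s‖ ^ 2

lemma WaveBound.nonneg {w : Tile → ℤ → ℂ} {B : ℝ} (hw : WaveBound w B) : 0 ≤ B := by
  have h := (norm_nonneg _).trans (hw.decay ⟨0, 0, 0⟩ 0)
  have h1 : 0 < (dyWt 0 0 0 ^ 6)⁻¹ := by have := dyWt_pos 0 0 0; positivity
  exact nonneg_of_mul_nonneg_left h h1

lemma card_tree_fiber_le {τ : ℝ} {t : TreeTop} {T : Finset Tile} (hT : ∀ s ∈ T, s.toTop.Below τ t)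
    (q : ℕ × ℤ) : (T.filter fun s => (s.k, s.m) = q).card ≤ 33 := by
  obtain ⟨k, m⟩ := q
  refine card_tiles_le _ k m (fun s hs => ?_) (fun s hs => ?_)
    (32 * gridIdx τ k t.ξ + τ * 2 ^ k) 32 (fun s hs => ?_)
  · have := (Finset.mem_filter.1 hs).2; simp only [Prod.mk.injEq] at this; exact this.1
  · have := (Finset.mem_filter.1 hs).2; simp only [Prod.mk.injEq] at this; exact this.2
  · obtain ⟨h3, h4⟩ := Finset.mem_filter.1 hs
    simp only [Prod.mk.injEq] at h4
    have h5 := (hT s h3).2.2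
    simp only [Tile.toTop] at h5
    rw [h4.1] at h5
    rw [← h5]
    have h6 : ((s.c - τ) * 2 ^ k / 32) = (s.l - τ * 2 ^ k) / 32 := by
      rw [sub_mul, Tile.c, h4.1]; field_simp
    have h7 := Int.floor_le ((s.c - τ) * 2 ^ k / 32)
    have h8 := Int.lt_floor_add_one ((s.c - τ) * 2 ^ k / 32)
    rw [h6] at h7 h8
    unfold gridIdx
    rw [h6]
    push_cast
    constructor <;> linarith

open Classical in
/-- Contribution of the points far from the top interval. -/
lemma tree_far {τ : ℝ} {η : ℤ → ℝ} {E : Finset ℤ} {t : TreeTop} {T : Finset Tile} {μ ε : ℝ}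
    (hμ : 0 ≤ μ) (hε : 0 ≤ ε) (hT : ∀ s ∈ T, s.toTop.Below τ t) (hg : ∀ s ∈ T, s.Good τ)
    (hm : MassLE τ η E T μ) {w : Tile → ℤ → ℂ} {B : ℝ} (hw : WaveBound w B) {α : Tile → ℂ}
    (hα : ∀ s ∈ T, ‖α s‖ ≤ ε) (E' : Finset ℤ) (hE : E' ⊆ E)
    (hE' : ∀ x ∈ E', 2 ≤ |x / 2 ^ t.K - t.M|) :
    ∑ x ∈ E', ‖∑ s ∈ T.filter (fun s => s.Has (η x)), α s * w s x‖ ≤ 1056 * B * ε * μ * 2 ^ t.K := by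
  have hB := hw.nonneg
  have h1 : ∑ x ∈ E', ‖∑ s ∈ T.filter (fun s => s.Has (η x)), α s * w s x‖ ≤
      ∑ s ∈ T, ∑ x ∈ E'.filter (fun x => s.Has (η x)), ε * (B * (dyWt s.k s.m x ^ 6)⁻¹) := by
    rw [← Finset.sum_comm' (s := E') (t := fun x => T.filter fun s => s.Has (η x))
      (by intro x s; simp only [Finset.mem_filter]; tauto)]
    refine Finset.sum_le_sum fun x _ => (norm_sum_le _ _).trans (Finset.sum_le_sum fun s hs => ?_)
    rw [norm_mul]
    exact mul_le_mul (hα s (Finset.mem_filter.1 hs).1) (hw.decay s x) (norm_nonneg _) hε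
  refine h1.trans ?_
  have h2 : ∀ s ∈ T, ∑ x ∈ E'.filter (fun x => s.Has (η x)), ε * (B * (dyWt s.k s.m x ^ 6)⁻¹) ≤
      16 * B * ε * μ * (2 ^ s.k / 2 ^ (2 * (t.K - s.k))) := by
    intro s hs
    obtain ⟨hk, hM, _⟩ := hT s hs
    simp only [Tile.toTop] at hk hM
    obtain ⟨hM1, hM2⟩ := two_pow_le_div hk hM
    have h3 : ∀ x ∈ E'.filter (fun x => s.Has (η x)), ε * (B * (dyWt s.k s.m x ^ 6)⁻¹) ≤
        B * ε / 2 ^ (2 * (t.K - s.k)) * (dyWt s.k s.m x ^ 3)⁻¹ := by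
      intro x hx
      have hx1 := hE' x (Finset.mem_filter.1 hx).1
      have hd : (2 : ℝ) ^ (t.K - s.k) ≤ dyWt s.k s.m x := by
        apply dyWt_ge_of_lt
        have hp : (2 : ℤ) ^ (t.K - s.k) * 2 ^ s.k = 2 ^ t.K := by rw [← pow_add]; congr 1; omega
        rw [hp]
        have hp0 : (0 : ℤ) < 2 ^ t.K := by positivity
        have hp1 : (0 : ℤ) < 2 ^ s.k := by positivity
        have e1 := Int.ediv_mul_le x hp0.ne'
        have e2 := Int.lt_ediv_add_one_mul_self x hp0
        rcases le_abs.1 hx1 with h | h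
        · refine le_abs.2 (Or.inl ?_); nlinarith
        · refine le_abs.2 (Or.inr ?_); nlinarith
      have h0 := one_le_dyWt s.k s.m x
      have e1 : (2 : ℝ) ^ (2 * (t.K - s.k)) * dyWt s.k s.m x ^ 3 ≤ dyWt s.k s.m x ^ 6 := by
        calc (2 : ℝ) ^ (2 * (t.K - s.k)) * dyWt s.k s.m x ^ 3
            = (2 ^ (t.K - s.k)) ^ 2 * dyWt s.k s.m x ^ 3 := by rw [← pow_mul]; ring_nf
          _ ≤ dyWt s.k s.m x ^ 2 * dyWt s.k s.m x ^ 3 := by gcongr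
          _ = dyWt s.k s.m x ^ 5 := by ring
          _ ≤ _ := pow_le_pow_right₀ h0 (by norm_num)
      have hd0 : 0 < dyWt s.k s.m x := by linarith
      calc ε * (B * (dyWt s.k s.m x ^ 6)⁻¹) = B * ε * (dyWt s.k s.m x ^ 6)⁻¹ := by ring
        _ ≤ B * ε * ((2 : ℝ) ^ (2 * (t.K - s.k)) * dyWt s.k s.m x ^ 3)⁻¹ := by gcongr
        _ = _ := by rw [mul_inv]; ring
    refine (Finset.sum_le_sum h3).trans ?_
    rw [← Finset.mul_sum]
    have h4 : ∑ x ∈ E'.filter (fun x => s.Has (η x)), (dyWt s.k s.m x ^ 3)⁻¹ ≤ 16 * μ * 2 ^ s.k := by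
      refine le_trans ?_ (weighted_mass hμ hm hs (hg s hs))
      refine Finset.sum_le_sum_of_subset_of_nonneg (Finset.filter_subset_filter _ hE) fun x _ _ => ?_
      have := dyWt_pos s.k s.m x
      positivity
    calc _ ≤ B * ε / 2 ^ (2 * (t.K - s.k)) * (16 * μ * 2 ^ s.k) := by gcongr
      _ = _ := by ring
  refine (Finset.sum_le_sum h2).trans ?_
  rw [← Finset.mul_sum]
  have h5 := sum_comp_le_of_fiber T (fun s => (s.k, s.m))
    (fun q => (2 : ℝ) ^ q.1 / 2 ^ (2 * (t.K - q.1))) (fun q => by positivity) 33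
    (card_tree_fiber_le hT)
  have h6 : ∑ q ∈ T.image (fun s => (s.k, s.m)), (2 : ℝ) ^ q.1 / 2 ^ (2 * (t.K - q.1)) ≤
      ∑ k ∈ Finset.range (t.K + 1), ∑ m ∈ dyInt (t.K - k) t.M, (2 : ℝ) ^ k / 2 ^ (2 * (t.K - k)) := by
    rw [Finset.sum_sigma']
    have hinj : Set.InjOn (fun q : ℕ × ℤ => (⟨q.1, q.2⟩ : (_ : ℕ) × ℤ))
        (T.image (fun s => (s.k, s.m)) : Finset (ℕ × ℤ)) := by
      intro a _ b _ h
      simp only [Sigma.mk.injEq, heq_eq_eq] at h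
      exact Prod.ext h.1 h.2
    refine le_trans (le_of_eq (Finset.sum_image (f := fun q : (_ : ℕ) × ℤ =>
      (2 : ℝ) ^ q.1 / 2 ^ (2 * (t.K - q.1))) hinj).symm)
      (Finset.sum_le_sum_of_subset_of_nonneg ?_ fun q _ _ => by positivity)
    intro q hq
    simp only [Finset.mem_image] at hq
    obtain ⟨_, ⟨s, hs, rfl⟩, rfl⟩ := hq
    obtain ⟨hk, hM, _⟩ := hT s hs
    rw [Finset.mem_sigma, Finset.mem_range, mem_dyInt]
    exact ⟨Nat.lt_succ_of_le hk, hM⟩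
  have h7 : ∀ k ∈ Finset.range (t.K + 1), ∑ m ∈ dyInt (t.K - k) t.M,
      (2 : ℝ) ^ k / 2 ^ (2 * (t.K - k)) ≤ 2 ^ k := by
    intro k _
    rw [Finset.sum_const, card_dyInt, nsmul_eq_mul, mul_div_assoc', div_le_iff₀ (by positivity)]
    push_cast
    rw [mul_comm]
    gcongr
    · norm_num
    · omega
  have h8 := h6.trans (Finset.sum_le_sum h7)
  have h9 := sum_geom_two (t.K + 1)
  rw [pow_succ] at h9
  have h10 : ∑ s ∈ T, (2 : ℝ) ^ s.k / 2 ^ (2 * (t.K - s.k)) ≤ 66 * 2 ^ t.K := by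
    push_cast at h5
    linarith
  have h11 : 0 ≤ 16 * B * ε * μ := by positivity
  calc _ ≤ 16 * B * ε * μ * (66 * 2 ^ t.K) := by gcongr
    _ = _ := by ring

/-! ### The tree lemma: the near part -/

lemma sum_tiles_dyWt_le (U : Finset Tile) (n : ℕ)
    (hn : ∀ q, (U.filter fun s => (s.k, s.m) = q).card ≤ n) (A : Finset ℕ) (hA : ∀ s ∈ U, s.k ∈ A)
    (c : ℕ → ℝ) (hc : ∀ k, 0 ≤ c k) (x : ℤ) :
    ∑ s ∈ U, c s.k * (dyWt s.k s.m x ^ 2)⁻¹ ≤ n * (20 * ∑ k ∈ A, c k) := by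
  have hpos := fun k m => (dyWt_sq_inv_pos k m x).le
  refine (sum_comp_le_of_fiber U (fun s => (s.k, s.m)) (fun q => c q.1 * (dyWt q.1 q.2 x ^ 2)⁻¹)
    (fun q => mul_nonneg (hc _) (hpos _ _)) n hn).trans ?_
  refine mul_le_mul_of_nonneg_left ?_ (by positivity)
  calc _ ≤ ∑ q ∈ A ×ˢ U.image (fun s => s.m), c q.1 * (dyWt q.1 q.2 x ^ 2)⁻¹ := by
        refine Finset.sum_le_sum_of_subset_of_nonneg (fun q hq => ?_)
          fun q _ _ => mul_nonneg (hc _) (hpos _ _)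
        obtain ⟨s, hs, rfl⟩ := Finset.mem_image.1 hq
        exact Finset.mem_product.2 ⟨hA s hs, Finset.mem_image_of_mem _ hs⟩
    _ ≤ ∑ k ∈ A, c k * 20 := by
        rw [Finset.sum_product]
        refine Finset.sum_le_sum fun k _ => ?_
        simp only
        rw [← Finset.mul_sum]
        exact mul_le_mul_of_nonneg_left (sum_dyWt_mesh k x _) (hc k)
    _ = _ := by rw [← Finset.sum_mul, mul_comm]

/-- The dyadic interval of scale `κ` and index `n` is adjacent to a tile interval of scale at most
`κ`. -/
def Touched (T : Finset Tile) (κ : ℕ) (n : ℤ) : Prop :=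
  ∃ s ∈ T, s.k ≤ κ ∧ |s.m / 2 ^ (κ - s.k) - n| ≤ 1

lemma Touched.succ {T : Finset Tile} {κ : ℕ} {n : ℤ} (h : Touched T κ n) :
    Touched T (κ + 1) (n / 2) := by
  obtain ⟨s, hs, hk, hm⟩ := h
  refine ⟨s, hs, by omega, ?_⟩
  have : s.m / 2 ^ (κ + 1 - s.k) = s.m / 2 ^ (κ - s.k) / 2 := by
    rw [Int.ediv_ediv_of_nonneg (by positivity), ← pow_succ]; congr 2; omega
  rw [this]
  rw [abs_le] at hm ⊢
  omega

lemma Touched.of_le {T : Finset Tile} {κ κ' : ℕ} {x : ℤ} (h : Touched T κ (x / 2 ^ κ))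
    (hle : κ ≤ κ') : Touched T κ' (x / 2 ^ κ') := by
  induction κ', hle using Nat.le_induction with
  | base => exact h
  | succ i _ ih =>
    have := ih.succ
    rwa [Int.ediv_ediv_of_nonneg (by positivity), ← pow_succ] at this

/-- The largest scale at which the dyadic interval containing `x` is not touched. -/
noncomputable def stopScale (T : Finset Tile) (x : ℤ) : ℕ :=
  sInf {κ | Touched T (κ + 1) (x / 2 ^ (κ + 1))}

lemma not_touched_of_le {T : Finset Tile} (hT : ∀ s ∈ T, 1 ≤ s.k) {x : ℤ} {κ : ℕ}
    (h : κ ≤ stopScale T x) : ¬ Touched T κ (x / 2 ^ κ) := by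
  rcases Nat.eq_zero_or_pos κ with rfl | h0
  · rintro ⟨s, hs, hk, _⟩
    have := hT s hs
    omega
  · obtain ⟨i, rfl⟩ : ∃ i, κ = i + 1 := ⟨κ - 1, by omega⟩
    exact Nat.notMem_of_lt_sInf (s := {κ | Touched T (κ + 1) (x / 2 ^ (κ + 1))}) h

lemma touched_stopScale {T : Finset Tile} {x : ℤ} {κ : ℕ} (hκ : 1 ≤ κ)
    (h : Touched T κ (x / 2 ^ κ)) :
    stopScale T x < κ ∧ Touched T (stopScale T x + 1) (x / 2 ^ (stopScale T x + 1)) := by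
  obtain ⟨i, rfl⟩ : ∃ i, κ = i + 1 := ⟨κ - 1, by omega⟩
  have h1 : i ∈ {κ | Touched T (κ + 1) (x / 2 ^ (κ + 1))} := h
  exact ⟨Nat.lt_succ_of_le (Nat.sInf_le h1), Nat.sInf_mem ⟨i, h1⟩⟩

lemma div_eq_of_le {r κ : ℕ} {x y : ℤ} (h : y / 2 ^ r = x / 2 ^ r) (hk : r ≤ κ) :
    y / 2 ^ κ = x / 2 ^ κ := by
  rw [← div_two_pow_of_le hk, h, div_two_pow_of_le hk]

lemma stopScale_eq {T : Finset Tile} (hT : ∀ s ∈ T, 1 ≤ s.k) {x y : ℤ} {κ : ℕ} (hκ : 1 ≤ κ)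
    (h : Touched T κ (x / 2 ^ κ)) (hy : y / 2 ^ stopScale T x = x / 2 ^ stopScale T x) :
    stopScale T y = stopScale T x := by
  obtain ⟨_, h2⟩ := touched_stopScale hκ h
  rw [← div_eq_of_le hy (Nat.le_succ _)] at h2
  have h3 := (touched_stopScale (by omega) h2).1
  have h4 := not_touched_of_le hT (le_refl (stopScale T x))
  rw [← hy] at h4
  by_contra hne
  exact h4 ((touched_stopScale (by omega) h2).2.of_le (by omega))

/-- Summation over the cells of a partition into dyadic intervals. -/
lemma sum_le_sum_of_cells {N : Finset ℤ} {r : ℤ → ℕ}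
    (hr : ∀ x ∈ N, ∀ y, y / 2 ^ r x = x / 2 ^ r x → y ∈ N ∧ r y = r x) {f h : ℤ → ℝ}
    (hfh : ∀ x ∈ N, ∑ y ∈ dyInt (r x) (x / 2 ^ r x), f y ≤ ∑ y ∈ dyInt (r x) (x / 2 ^ r x), h y) :
    ∑ x ∈ N, f x ≤ ∑ x ∈ N, h x := by
  classical
  rw [← Finset.sum_fiberwise_of_maps_to (t := N.image fun x => (r x, x / 2 ^ r x))
    (g := fun x => (r x, x / 2 ^ r x)) (fun x hx => Finset.mem_image_of_mem _ hx) f,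
    ← Finset.sum_fiberwise_of_maps_to (t := N.image fun x => (r x, x / 2 ^ r x))
    (g := fun x => (r x, x / 2 ^ r x)) (fun x hx => Finset.mem_image_of_mem _ hx) h]
  refine Finset.sum_le_sum fun q hq => ?_
  obtain ⟨x, hx, rfl⟩ := Finset.mem_image.1 hq
  have : (N.filter fun y => (r y, y / 2 ^ r y) = (r x, x / 2 ^ r x)) =
      dyInt (r x) (x / 2 ^ r x) := by
    ext y
    rw [Finset.mem_filter, mem_dyInt, Prod.mk.injEq]
    constructor
    · rintro ⟨_, h1, h2⟩; rwa [h1] at h2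
    · intro hy
      obtain ⟨h1, h2⟩ := hr x hx y hy
      exact ⟨h1, h2, by rw [h2]; exact hy⟩
  rw [this]
  exact hfh x hx

lemma comparable_of_not_touched {T : Finset Tile} {r : ℕ} {x y : ℤ} (h : ¬ Touched T r (x / 2 ^ r))
    (hy : y / 2 ^ r = x / 2 ^ r) {s : Tile} (hs : s ∈ T) (hk : s.k ≤ r) :
    dyWt s.k s.m x ≤ 2 * dyWt s.k s.m y := by
  have h1 : 2 ≤ |s.m / 2 ^ (r - s.k) - x / 2 ^ r| := by
    by_contra hcon
    exact h ⟨s, hs, hk, by omega⟩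
  obtain ⟨hM1, hM2⟩ := two_pow_le_div hk (rfl : s.m / 2 ^ (r - s.k) = _)
  set M := s.m / 2 ^ (r - s.k)
  have hp0 : (0 : ℤ) < 2 ^ r := by positivity
  have hp1 : (0 : ℤ) < 2 ^ s.k := by positivity
  have e1 := Int.ediv_mul_le x hp0.ne'
  have e2 := Int.lt_ediv_add_one_mul_self x hp0
  have e3 := Int.ediv_mul_le y hp0.ne'
  have e4 := Int.lt_ediv_add_one_mul_self y hp0
  rw [hy] at e3 e4
  have h2 : |x - y| ≤ 2 ^ r := by rw [abs_le]; constructor <;> nlinarith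
  have h3 : 2 ^ r ≤ |y - s.m * 2 ^ s.k| := by
    rcases le_abs.1 h1 with h | h
    · refine le_abs.2 (Or.inr ?_); nlinarith
    · refine le_abs.2 (Or.inl ?_); nlinarith
  have h4 : |x - s.m * 2 ^ s.k| ≤ 2 * |y - s.m * 2 ^ s.k| := by
    have := abs_sub_le x y (s.m * 2 ^ s.k)
    linarith
  have h5 : |(x : ℝ) - s.m * 2 ^ s.k| ≤ 2 * |(y : ℝ) - s.m * 2 ^ s.k| := by exact_mod_cast h4
  unfold dyWt
  have : |(x : ℝ) - s.m * 2 ^ s.k| / 2 ^ s.k ≤ 2 * |(y : ℝ) - s.m * 2 ^ s.k| / 2 ^ s.k := by gcongr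
  rw [mul_div_assoc] at this
  linarith

open Classical in
/-- Contribution to a cell of the tiles of small scale. -/
lemma cell_small_le {τ : ℝ} {η : ℤ → ℝ} {E : Finset ℤ} {t : TreeTop} {T : Finset Tile} {μ ε : ℝ}
    (hμ : 0 ≤ μ) (hε : 0 ≤ ε) (hT : ∀ s ∈ T, s.toTop.Below τ t) (hg : ∀ s ∈ T, s.Good τ)
    (hm : MassLE τ η E T μ) {w : Tile → ℤ → ℂ} {B : ℝ} (hw : WaveBound w B) {α : Tile → ℂ}
    (hα : ∀ s ∈ T, ‖α s‖ ≤ ε) {r : ℕ} {x : ℤ} (hr : ¬ Touched T r (x / 2 ^ r)) :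
    ∑ y ∈ (dyInt r (x / 2 ^ r)).filter (· ∈ E),
      ‖∑ s ∈ T.filter (fun s => s.Has (η y) ∧ s.k ≤ r), α s * w s y‖ ≤ 84480 * B * ε * μ * 2 ^ r := by
  have hB := hw.nonneg
  set J := (dyInt r (x / 2 ^ r)).filter (· ∈ E) with hJ
  have h1 : ∑ y ∈ J, ‖∑ s ∈ T.filter (fun s => s.Has (η y) ∧ s.k ≤ r), α s * w s y‖ ≤
      ∑ s ∈ T.filter (fun s => s.k ≤ r), ∑ y ∈ J.filter (fun y => s.Has (η y)),
        ε * (B * (dyWt s.k s.m y ^ 6)⁻¹) := by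
    rw [← Finset.sum_comm' (s := J) (t := fun y => T.filter fun s => s.Has (η y) ∧ s.k ≤ r)
      (by intro x s; simp only [Finset.mem_filter]; tauto)]
    refine Finset.sum_le_sum fun y _ => (norm_sum_le _ _).trans (Finset.sum_le_sum fun s hs => ?_)
    rw [norm_mul]
    exact mul_le_mul (hα s (Finset.mem_filter.1 hs).1) (hw.decay s y) (norm_nonneg _) hε
  refine h1.trans ?_
  have h2 : ∀ s ∈ T.filter (fun s => s.k ≤ r), ∑ y ∈ J.filter (fun y => s.Has (η y)),
      ε * (B * (dyWt s.k s.m y ^ 6)⁻¹) ≤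
        (64 * B * ε * μ) * (2 ^ s.k * (dyWt s.k s.m x ^ 2)⁻¹) := by
    intro s hs
    obtain ⟨hs, hk⟩ := Finset.mem_filter.1 hs
    have h3 : ∀ y ∈ J.filter (fun y => s.Has (η y)), ε * (B * (dyWt s.k s.m y ^ 6)⁻¹) ≤
        4 * (B * ε) * (dyWt s.k s.m x ^ 2)⁻¹ * (dyWt s.k s.m y ^ 3)⁻¹ := by
      intro y hy
      have hy1 := mem_dyInt.1 (Finset.mem_filter.1 (Finset.mem_filter.1 hy).1).1
      have hc := comparable_of_not_touched hr hy1 hs hk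
      have h0 := one_le_dyWt s.k s.m y
      have h0' := dyWt_pos s.k s.m x
      have e1 : dyWt s.k s.m x ^ 2 / 4 * dyWt s.k s.m y ^ 3 ≤ dyWt s.k s.m y ^ 6 := by
        calc dyWt s.k s.m x ^ 2 / 4 * dyWt s.k s.m y ^ 3
            ≤ (2 * dyWt s.k s.m y) ^ 2 / 4 * dyWt s.k s.m y ^ 3 := by gcongr
          _ = dyWt s.k s.m y ^ 5 := by ring
          _ ≤ _ := pow_le_pow_right₀ h0 (by norm_num)
      calc ε * (B * (dyWt s.k s.m y ^ 6)⁻¹) = B * ε * (dyWt s.k s.m y ^ 6)⁻¹ := by ring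
        _ ≤ B * ε * (dyWt s.k s.m x ^ 2 / 4 * dyWt s.k s.m y ^ 3)⁻¹ := by gcongr
        _ = _ := by rw [mul_inv, inv_div]; ring
    refine (Finset.sum_le_sum h3).trans ?_
    rw [← Finset.mul_sum]
    have h4 : ∑ y ∈ J.filter (fun y => s.Has (η y)), (dyWt s.k s.m y ^ 3)⁻¹ ≤ 16 * μ * 2 ^ s.k := by
      refine le_trans ?_ (weighted_mass hμ hm hs (hg s hs))
      refine Finset.sum_le_sum_of_subset_of_nonneg (fun y hy => ?_) fun x _ _ => ?_
      · simp only [hJ, Finset.mem_filter] at hy ⊢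
        exact ⟨hy.1.2, hy.2⟩
      · have := dyWt_pos s.k s.m x
        positivity
    have := dyWt_sq_inv_pos s.k s.m x
    calc _ ≤ 4 * (B * ε) * (dyWt s.k s.m x ^ 2)⁻¹ * (16 * μ * 2 ^ s.k) := by gcongr
      _ = _ := by ring
  refine (Finset.sum_le_sum h2).trans ?_
  rw [← Finset.mul_sum]
  have h5 := sum_tiles_dyWt_le (T.filter (fun s => s.k ≤ r)) 33
    (card_tree_fiber_le (t := t) (τ := τ) fun s hs => hT s (Finset.mem_filter.1 hs).1)
    (Finset.range (r + 1))
    (fun s hs => Finset.mem_range.2 (Nat.lt_succ_of_le (Finset.mem_filter.1 hs).2))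
    (fun k => 2 ^ k) (fun k => by positivity) x
  have h6 := sum_geom_two (r + 1)
  rw [pow_succ] at h6
  have h7 : ∑ s ∈ T.filter (fun s => s.k ≤ r), 2 ^ s.k * (dyWt s.k s.m x ^ 2)⁻¹ ≤ 1320 * 2 ^ r := by
    push_cast at h5
    linarith
  have h8 : 0 ≤ 64 * B * ε * μ := by positivity
  calc _ ≤ 64 * B * ε * μ * (1320 * 2 ^ r) := by gcongr
    _ = _ := by ring

open Classical in
/-- Counting the points of a cell which see the tiles of large scale. -/
lemma cell_card_le {τ : ℝ} {η : ℤ → ℝ} {E : Finset ℤ} {t : TreeTop} {T : Finset Tile} {μ : ℝ}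
    (hT : ∀ s ∈ T, s.toTop.Below τ t) (hg : ∀ s ∈ T, s.Good τ) (hm : MassLE τ η E T μ) {r : ℕ}
    {x : ℤ} (hr : Touched T (r + 1) (x / 2 ^ (r + 1))) :
    ((((dyInt r (x / 2 ^ r)).filter (· ∈ E)).filter
      fun y => ∃ s ∈ T, s.Has (η y) ∧ r < s.k).card : ℝ) ≤ 8 * μ * 2 ^ r := by
  obtain ⟨s0, hs0, hk0, hm0⟩ := hr
  have h1 := hm s0 hs0 ⟨r + 1, s0.m / 2 ^ (r + 1 - s0.k), t.ξ⟩ ⟨hk0, rfl, (hT s0 hs0).2.2⟩ 1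
  have h2 : μ * 2 ^ (2 * 1) * 2 ^ (r + 1) = 8 * μ * 2 ^ r := by rw [pow_succ 2 r]; ring
  rw [h2] at h1
  refine le_trans ?_ h1
  refine Nat.cast_le.2 (Finset.card_le_card fun y hy => ?_)
  simp only [Finset.mem_filter, mem_dyInt] at hy
  obtain ⟨⟨hy1, hyE⟩, s, hs, hsη, hk⟩ := hy
  simp only [massSet, Finset.mem_filter]
  refine ⟨hyE, gridIdx_eq_of_le (k := r + 1) (K := s.k) hk ?_, ?_⟩
  · rw [(hg s hs).gridIdx_eq hsη]; exact (hT s hs).2.2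
  · have hy2 := div_eq_of_le hy1 (Nat.le_succ r)
    have hp0 : (0 : ℤ) < 2 ^ (r + 1) := by positivity
    have e3 := Int.ediv_mul_le y hp0.ne'
    have e4 := Int.lt_ediv_add_one_mul_self y hp0
    simp only [Nat.succ_eq_add_one] at hy2
    rw [hy2] at e3 e4
    rw [abs_le] at hm0 ⊢
    constructor <;> nlinarith

/-! ### The tree lemma: large tiles -/

lemma sum_inv_two_pow_le (κ K : ℕ) :
    ∑ k ∈ Finset.Icc κ K, (2 : ℝ) ^ κ / 2 ^ k ≤ 2 := by
  have h1 : ∑ k ∈ Finset.Icc κ K, (2 : ℝ) ^ κ / 2 ^ k ≤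
      ∑ k ∈ Finset.Ico κ (κ + (K + 1)), (2 : ℝ) ^ κ / 2 ^ k := by
    refine Finset.sum_le_sum_of_subset_of_nonneg (fun k hk => ?_) fun _ _ _ => by positivity
    rw [Finset.mem_Icc] at hk
    rw [Finset.mem_Ico]
    omega
  refine h1.trans ?_
  rw [Finset.sum_Ico_eq_sum_range, Nat.add_sub_cancel_left]
  refine le_trans (le_of_eq (Finset.sum_congr rfl fun i _ => ?_)) (sum_geometric_two_le (K + 1))
  rw [pow_add, one_div, inv_pow]
  field_simp

open Classical in
/-- Truncations of lacunary sums are dominated by averages. -/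
lemma lac_truncation_le {w : Tile → ℤ → ℂ} {B : ℝ} (hw : WaveBound w B) {α : Tile → ℂ} {ε : ℝ}
    (hε : 0 ≤ ε) {U : Finset Tile} {ξ : ℝ} {K : ℕ} (hα : ∀ s ∈ U, ‖α s‖ ≤ ε)
    (hk : ∀ s ∈ U, 1 ≤ s.k ∧ s.k ≤ K) (hξ : ∀ s ∈ U, s.LacFreq ξ)
    (hU : ∀ q, (U.filter fun s => (s.k, s.m) = q).card ≤ 1) {κ : ℕ} {x x' : ℤ}
    (hx : x' / 2 ^ κ = x / 2 ^ κ) :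
    ‖∑ s ∈ U.filter (fun s => κ ≤ s.k), α s * w s x‖ ≤
      80 * ε * B + dyMax (fun y => ‖∑ s ∈ U, α s * w s y‖) K x' := by
  have hB := hw.nonneg
  have hmax : 0 ≤ dyMax (fun y => ‖∑ s ∈ U, α s * w s y‖) K x' :=
    dyMax_nonneg (fun _ => norm_nonneg _) _ _
  rcases lt_or_ge K κ with hκ | hκ
  · rw [Finset.filter_false_of_mem (fun s hs => by have := hk s hs; omega), Finset.sum_empty, norm_zero]
    positivity
  set G : ℤ → ℂ := fun y => ∑ s ∈ U.filter (fun s => κ ≤ s.k), α s * w s y with hG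
  set D : ℤ → ℂ := fun y => eChar (-(ξ * y / 8)) with hD
  set I := dyInt κ (x / 2 ^ κ) with hI
  have hfib : ∀ V ⊆ U, ∀ q : ℕ × ℤ, (V.filter fun s => (s.k, s.m) = q).card ≤ 1 := fun V hV q =>
    (Finset.card_le_card (Finset.filter_subset_filter _ hV)).trans (hU q)
  have h1 : ∀ y ∈ I, ‖D x * G x - D y * G y‖ ≤ 40 * ε * B := by
    intro y hy
    have hy1 := mem_dyInt.1 hy
    have hxy : |(x : ℝ) - y| ≤ 2 ^ κ := by
      have hp0 : (0 : ℤ) < 2 ^ κ := by positivity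
      have e1 := Int.ediv_mul_le x hp0.ne'
      have e2 := Int.lt_ediv_add_one_mul_self x hp0
      have e3 := Int.ediv_mul_le y hp0.ne'
      have e4 := Int.lt_ediv_add_one_mul_self y hp0
      rw [hy1] at e3 e4
      have : |x - y| ≤ 2 ^ κ := by rw [abs_le]; constructor <;> nlinarith
      exact_mod_cast this
    have e0 : D x * G x - D y * G y =
        ∑ s ∈ U.filter (fun s => κ ≤ s.k), α s * (D x * w s x - D y * w s y) := by
      simp only [hG, Finset.mul_sum]
      rw [← Finset.sum_sub_distrib]
      exact Finset.sum_congr rfl fun s _ => by ring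
    rw [e0]
    have h2 := sum_tiles_dyWt_le (U.filter (fun s => κ ≤ s.k)) 1 (hfib _ (Finset.filter_subset _ _)) (Finset.Icc κ K)
      (fun s hs => Finset.mem_Icc.2 ⟨(Finset.mem_filter.1 hs).2,
        (hk s (Finset.mem_filter.1 hs).1).2⟩) (fun k => 2 ^ κ / 2 ^ k) (fun k => by positivity) x
    have h3 := sum_inv_two_pow_le κ K
    calc _ ≤ ∑ s ∈ U.filter (fun s => κ ≤ s.k),
          ε * B * (2 ^ κ / 2 ^ s.k * (dyWt s.k s.m x ^ 2)⁻¹) := by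
          refine (norm_sum_le _ _).trans (Finset.sum_le_sum fun s hs => ?_)
          obtain ⟨hsU, hsk⟩ := Finset.mem_filter.1 hs
          have hp := dyWt_sq_inv_pos s.k s.m x
          rw [norm_mul]
          have h4 := hw.smooth s ξ (hξ s hsU) x y
            (hxy.trans (pow_le_pow_right₀ (by norm_num) hsk))
          calc _ ≤ ε * (B * (|(x : ℝ) - y| / 2 ^ s.k) * (dyWt s.k s.m x ^ 2)⁻¹) :=
                mul_le_mul (hα s hsU) h4 (norm_nonneg _) hε
            _ ≤ ε * (B * (2 ^ κ / 2 ^ s.k) * (dyWt s.k s.m x ^ 2)⁻¹) := by gcongr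
            _ = _ := by ring
      _ ≤ ε * B * (40 : ℝ) := by
          rw [← Finset.mul_sum]
          push_cast at h2
          gcongr
          linarith
      _ = _ := by ring
  have h2 : ‖∑ y ∈ I, D y * ∑ s ∈ U.filter (fun s => ¬ κ ≤ s.k), α s * w s y‖ ≤
      40 * ε * B * 2 ^ κ := by
    have e0 : ∑ y ∈ I, D y * ∑ s ∈ U.filter (fun s => ¬ κ ≤ s.k), α s * w s y =
        ∑ s ∈ U.filter (fun s => ¬ κ ≤ s.k), α s * ∑ y ∈ I, D y * w s y := by
      simp only [Finset.mul_sum]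
      rw [Finset.sum_comm]
      exact Finset.sum_congr rfl fun s _ => Finset.sum_congr rfl fun y _ => by ring
    rw [e0]
    set a := x / 2 ^ κ * 2 ^ κ
    set b := (x / 2 ^ κ + 1) * 2 ^ κ
    have hab : a ≤ b := by
      have : (0 : ℤ) < 2 ^ κ := by positivity
      simp only [a, b]; nlinarith
    have h3 : ∀ z, ∑ s ∈ U.filter (fun s => ¬ κ ≤ s.k), 2 ^ s.k * (dyWt s.k s.m z ^ 2)⁻¹ ≤
        20 * 2 ^ κ := by
      intro z
      have h4 := sum_tiles_dyWt_le (U.filter (fun s => ¬ κ ≤ s.k)) 1 (hfib _ (Finset.filter_subset _ _)) (Finset.range κ)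
        (fun s hs => Finset.mem_range.2 (not_le.1 (Finset.mem_filter.1 hs).2)) (fun k => 2 ^ k)
        (fun k => by positivity) z
      have h5 := sum_geom_two κ
      push_cast at h4
      linarith
    calc _ ≤ ∑ s ∈ U.filter (fun s => ¬ κ ≤ s.k), ε * B *
          (2 ^ s.k * (dyWt s.k s.m a ^ 2)⁻¹ + 2 ^ s.k * (dyWt s.k s.m b ^ 2)⁻¹) := by
          refine (norm_sum_le _ _).trans (Finset.sum_le_sum fun s hs => ?_)
          obtain ⟨hsU, hsk⟩ := Finset.mem_filter.1 hs
          rw [norm_mul]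
          calc _ ≤ ε * (B * 2 ^ s.k * ((dyWt s.k s.m a ^ 2)⁻¹ + (dyWt s.k s.m b ^ 2)⁻¹)) :=
                mul_le_mul (hα s hsU) (hw.cancel s ξ (hk s hsU).1 (hξ s hsU) a b hab)
                  (norm_nonneg _) hε
            _ = _ := by ring
      _ ≤ ε * B * (20 * 2 ^ κ + 20 * 2 ^ κ) := by
          rw [← Finset.mul_sum, Finset.sum_add_distrib]
          have := h3 a
          have := h3 b
          gcongr
      _ = _ := by ring
  have hcard : (I.card : ℝ) = 2 ^ κ := by rw [hI, card_dyInt]; push_cast; rfl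
  have key : (2 : ℂ) ^ κ * (D x * G x) = ∑ y ∈ I, D y * (∑ s ∈ U, α s * w s y) +
      ∑ y ∈ I, (D x * G x - D y * G y) -
      ∑ y ∈ I, D y * ∑ s ∈ U.filter (fun s => ¬ κ ≤ s.k), α s * w s y := by
    have e1 : ∀ y, ∑ s ∈ U, α s * w s y =
        G y + ∑ s ∈ U.filter (fun s => ¬ κ ≤ s.k), α s * w s y := fun y =>
      (Finset.sum_filter_add_sum_filter_not U (fun s => κ ≤ s.k) _).symm
    simp only [e1, mul_add, Finset.sum_add_distrib, Finset.sum_sub_distrib, Finset.sum_const,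
      nsmul_eq_mul]
    have : (I.card : ℂ) = 2 ^ κ := by exact_mod_cast hcard
    rw [this]
    ring
  have hnorm : ‖(2 : ℂ) ^ κ * (D x * G x)‖ = 2 ^ κ * ‖G x‖ := by
    rw [norm_mul, norm_mul, norm_eChar, one_mul, norm_pow]
    simp
  have hp : (0 : ℝ) < 2 ^ κ := by positivity
  have h4 : 2 ^ κ * ‖G x‖ ≤ 2 ^ κ * (80 * ε * B) + ∑ y ∈ I, ‖∑ s ∈ U, α s * w s y‖ := by
    rw [← hnorm, key]
    refine (norm_sub_le _ _).trans ?_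
    have h5 : ‖∑ y ∈ I, (D x * G x - D y * G y)‖ ≤ 40 * ε * B * 2 ^ κ := by
      refine (norm_sum_le_of_le _ h1).trans ?_
      rw [Finset.sum_const, nsmul_eq_mul, hcard, mul_comm]
    have h6 : ‖∑ y ∈ I, D y * (∑ s ∈ U, α s * w s y)‖ ≤ ∑ y ∈ I, ‖∑ s ∈ U, α s * w s y‖ := by
      refine norm_sum_le_of_le _ fun y _ => ?_
      rw [norm_mul, norm_eChar, one_mul]
    have h7 := norm_add_le (∑ y ∈ I, D y * (∑ s ∈ U, α s * w s y)) (∑ y ∈ I, (D x * G x - D y * G y))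
    linarith
  have h8 := dyAvg_le_dyMax (fun y => ‖∑ s ∈ U, α s * w s y‖) hκ x'
  rw [hx] at h8
  unfold dyAvg at h8
  have h9 : ‖G x‖ ≤ 80 * ε * B + (∑ y ∈ I, ‖∑ s ∈ U, α s * w s y‖) / 2 ^ κ := by
    rw [← sub_le_iff_le_add', le_div_iff₀ hp]
    nlinarith
  exact h9.trans (add_le_add_right h8 _)

/-- The scales at which two frequencies have a given index difference form an interval. -/
lemma floor_diff_convex {η ξ : ℝ} {j : ℤ} (hj : -1 ≤ j ∧ j ≤ 1) {a b c : ℕ} (hab : a ≤ b)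
    (hbc : b ≤ c) (ha : ⌊η * 2 ^ a⌋ - ⌊ξ * 2 ^ a⌋ = j) (hc : ⌊η * 2 ^ c⌋ - ⌊ξ * 2 ^ c⌋ = j) :
    ⌊η * 2 ^ b⌋ - ⌊ξ * 2 ^ b⌋ = j := by
  have step : ∀ (z : ℝ) (k : ℕ), ⌊z * 2 ^ k⌋ = ⌊z * 2 ^ (k + 1)⌋ / 2 := by
    intro z k
    have : z * 2 ^ k = z * 2 ^ (k + 1) / ((2 : ℕ) : ℝ) := by rw [pow_succ]; push_cast; ring
    rw [this, Int.floor_div_natCast]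
    rfl
  have up : ∀ (i : ℤ), 1 ≤ i → ∀ k k' : ℕ, k ≤ k' → i ≤ ⌊η * 2 ^ k⌋ - ⌊ξ * 2 ^ k⌋ →
      i ≤ ⌊η * 2 ^ k'⌋ - ⌊ξ * 2 ^ k'⌋ := by
    intro i hi k k' hk h
    induction k', hk using Nat.le_induction with
    | base => exact h
    | succ n _ ih =>
      have h1 := step η n
      have h2 := step ξ n
      omega
  have down : ∀ (i : ℤ), i ≤ -1 → ∀ k k' : ℕ, k ≤ k' → ⌊η * 2 ^ k⌋ - ⌊ξ * 2 ^ k⌋ ≤ i →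
      ⌊η * 2 ^ k'⌋ - ⌊ξ * 2 ^ k'⌋ ≤ i := by
    intro i hi k k' hk h
    induction k', hk using Nat.le_induction with
    | base => exact h
    | succ n _ ih =>
      have h1 := step η n
      have h2 := step ξ n
      omega
  have u1 := up 1 le_rfl a b hab
  have u2 := up 2 (by norm_num) b c hbc
  have u3 := up 1 le_rfl b c hbc
  have d1 := down (-1) le_rfl a b hab
  have d2 := down (-2) (by norm_num) b c hbc
  have d3 := down (-1) le_rfl b c hbc
  omega

open Classical in
/-- Sums over a lacunary family of the tiles containing a given frequency. -/
lemma lac_sum_le {w : Tile → ℤ → ℂ} {B : ℝ} (hw : WaveBound w B) {α : Tile → ℂ} {ε : ℝ}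
    (hε : 0 ≤ ε) {U : Finset Tile} {ξ : ℝ} {K : ℕ} (hα : ∀ s ∈ U, ‖α s‖ ≤ ε)
    (hk : ∀ s ∈ U, 1 ≤ s.k ∧ s.k ≤ K) (hξ : ∀ s ∈ U, s.LacFreq ξ) {j : ℤ} (hj : -1 ≤ j ∧ j ≤ 1)
    (hU : ∀ s ∈ U, s.l = ⌊ξ * 2 ^ s.k⌋ + j) {r : ℕ} {x x' : ℤ} (hx : x' / 2 ^ r = x / 2 ^ r)
    (η : ℝ) :
    ‖∑ s ∈ U.filter (fun s => s.Has η ∧ r < s.k), α s * w s x‖ ≤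
      160 * ε * B + 2 * dyMax (fun y => ‖∑ s ∈ U, α s * w s y‖) K x' := by
  have hB := hw.nonneg
  have hmax : 0 ≤ dyMax (fun y => ‖∑ s ∈ U, α s * w s y‖) K x' :=
    dyMax_nonneg (fun _ => norm_nonneg _) _ _
  have hfib : ∀ q, (U.filter fun s => (s.k, s.m) = q).card ≤ 1 := by
    intro q
    refine Finset.card_le_one.2 fun s hs s' hs' => ?_
    obtain ⟨h1, h2⟩ := Finset.mem_filter.1 hs
    obtain ⟨h3, h4⟩ := Finset.mem_filter.1 hs'
    have h5 := h2.trans h4.symm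
    simp only [Prod.mk.injEq] at h5
    have h6 := hU s h1
    have h7 := hU s' h3
    rw [h5.1] at h6
    exact Tile.ext h5.1 h5.2 (h6.trans h7.symm)
  have hhas : ∀ s ∈ U, s.Has η ↔ ⌊η * 2 ^ s.k⌋ - ⌊ξ * 2 ^ s.k⌋ = j := by
    intro s hs
    rw [Tile.Has, hU s hs]
    omega
  set A := (U.filter (fun s => s.Has η ∧ r < s.k)).image fun s => s.k with hA
  rcases A.eq_empty_or_nonempty with h0 | h0
  · rw [Finset.image_eq_empty.1 (hA.symm.trans h0), Finset.sum_empty, norm_zero]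
    positivity
  have hmem : ∀ k ∈ A, r < k ∧ ⌊η * 2 ^ k⌋ - ⌊ξ * 2 ^ k⌋ = j := by
    intro k hkA
    obtain ⟨s, hs, rfl⟩ := Finset.mem_image.1 hkA
    obtain ⟨h1, h2, h3⟩ := Finset.mem_filter.1 hs
    exact ⟨h3, (hhas s h1).1 h2⟩
  set a := A.min' h0
  set b := A.max' h0
  obtain ⟨ha1, ha2⟩ := hmem a (A.min'_mem h0)
  obtain ⟨hb1, hb2⟩ := hmem b (A.max'_mem h0)
  have hab : a ≤ b := A.min'_le b (A.max'_mem h0)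
  have h1 : U.filter (fun s => s.Has η ∧ r < s.k) =
      U.filter (fun s => a ≤ s.k) \ U.filter (fun s => b + 1 ≤ s.k) := by
    ext s
    simp only [Finset.mem_sdiff, Finset.mem_filter]
    constructor
    · rintro ⟨hs, h1, h2⟩
      have hsA : s.k ∈ A := Finset.mem_image.2 ⟨s, Finset.mem_filter.2 ⟨hs, h1, h2⟩, rfl⟩
      have h3 := A.min'_le _ hsA
      have h4 := A.le_max' _ hsA
      exact ⟨⟨hs, h3⟩, fun h => by have := h.2; omega⟩
    · rintro ⟨⟨hs, h1⟩, h2⟩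
      have h3 : s.k ≤ b := by
        by_contra hcon
        exact h2 ⟨hs, by omega⟩
      exact ⟨hs, (hhas s hs).2 (floor_diff_convex hj h1 h3 ha2 hb2), by omega⟩
  have h2 : ∑ s ∈ U.filter (fun s => s.Has η ∧ r < s.k), α s * w s x =
      ∑ s ∈ U.filter (fun s => a ≤ s.k), α s * w s x -
        ∑ s ∈ U.filter (fun s => b + 1 ≤ s.k), α s * w s x := by
    rw [h1, eq_sub_iff_add_eq]
    refine Finset.sum_sdiff fun s hs => ?_
    obtain ⟨h3, h4⟩ := Finset.mem_filter.1 hs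
    exact Finset.mem_filter.2 ⟨h3, by omega⟩
  rw [h2]
  have h3 := lac_truncation_le hw hε hα hk hξ hfib (div_eq_of_le hx (show r ≤ a by omega))
  have h4 := lac_truncation_le hw hε hα hk hξ hfib (div_eq_of_le hx (show r ≤ b + 1 by omega))
  refine (norm_sub_le _ _).trans ?_
  linarith

/-! ### The tree lemma -/

open Classical in
/-- The tiles of `T` in lacunary position with respect to `ξ` with a given frequency offset. -/
noncomputable def lacPart (T : Finset Tile) (ξ : ℝ) (j : ℤ) : Finset Tile :=
  T.filter fun s => s.LacFreq ξ ∧ s.l = ⌊ξ * 2 ^ s.k⌋ + j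

open Classical in
/-- The tiles of a tree which are not in lacunary position and see a given frequency have the same
scale. -/
lemma overlap_scale_eq {τ : ℝ} {t : TreeTop} {T : Finset Tile} (hT : ∀ s ∈ T, s.toTop.Below τ t)
    (hg : ∀ s ∈ T, s.Good τ) {s s' : Tile} (hs : s ∈ T) {η : ℝ} (h : s.Has η)
    (h' : s'.Has η) (hl' : ¬ s'.LacFreq t.ξ) : ¬ s'.k + 8 ≤ s.k := by
  intro hk
  have h1 : gridIdx τ s.k η = gridIdx τ s.k t.ξ := ((hg s hs).gridIdx_eq h).trans (hT s hs).2.2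
  unfold gridIdx at h1
  have h2 := Int.abs_sub_lt_one_of_floor_eq_floor h1
  rw [← sub_div, ← sub_mul, abs_div, abs_of_pos (show (0 : ℝ) < 32 by norm_num),
    div_lt_one (by norm_num), show η - τ - (t.ξ - τ) = η - t.ξ by ring, two_pow_mul_sub (show s'.k ≤ s.k by omega),
    ← mul_assoc, abs_mul, abs_of_pos (show (0 : ℝ) < 2 ^ (s.k - s'.k) by positivity)] at h2
  have hN : (256 : ℝ) ≤ 2 ^ (s.k - s'.k) := by
    calc (256 : ℝ) = 2 ^ 8 := by norm_num
      _ ≤ 2 ^ (s.k - s'.k) := pow_le_pow_right₀ (by norm_num) (by omega)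
  obtain ⟨e1, e2⟩ := Tile.has_iff.1 h'
  have h3 : 1 / 2 ≤ |(η - t.ξ) * 2 ^ s'.k| := by
    by_contra hcon
    rw [not_le, abs_lt] at hcon
    refine hl' ⟨?_, ?_⟩ <;> nlinarith
  nlinarith [abs_nonneg ((η - t.ξ) * 2 ^ s'.k)]

open Classical in
lemma pointwise_large_le {τ : ℝ} {t : TreeTop} {T : Finset Tile} {ε : ℝ} (hε : 0 ≤ ε)
    (hT : ∀ s ∈ T, s.toTop.Below τ t) (hg : ∀ s ∈ T, s.Good τ) (hk : ∀ s ∈ T, 1 ≤ s.k)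
    (hsep : ∀ s ∈ T, ∀ s' ∈ T, s'.k < s.k → s'.k + 8 ≤ s.k) {w : Tile → ℤ → ℂ} {B : ℝ}
    (hw : WaveBound w B) {α : Tile → ℂ} (hα : ∀ s ∈ T, ‖α s‖ ≤ ε) {r : ℕ} {x x' : ℤ}
    (hx : x' / 2 ^ r = x / 2 ^ r) (η : ℝ) :
    ‖∑ s ∈ T.filter (fun s => s.Has η ∧ r < s.k), α s * w s x‖ ≤ 500 * ε * B +
      2 * ∑ j ∈ Finset.Icc (-1 : ℤ) 1,
        dyMax (fun y => ‖∑ s ∈ lacPart T t.ξ j, α s * w s y‖) t.K x' := by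
  have hB := hw.nonneg
  set S := T.filter (fun s => s.Has η ∧ r < s.k) with hS
  have hST : ∀ s ∈ S, s ∈ T ∧ s.Has η ∧ r < s.k := fun s hs => Finset.mem_filter.1 hs
  rw [← Finset.sum_filter_add_sum_filter_not S (fun s => s.LacFreq t.ξ)]
  have h1 : ‖∑ s ∈ S.filter (fun s => ¬ s.LacFreq t.ξ), α s * w s x‖ ≤ 20 * ε * B := by
    set O := S.filter (fun s => ¬ s.LacFreq t.ξ) with hO
    have hOS : ∀ s ∈ O, (s ∈ T ∧ s.Has η ∧ r < s.k) ∧ ¬ s.LacFreq t.ξ := fun s hs =>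
      ⟨hST s (Finset.mem_filter.1 hs).1, (Finset.mem_filter.1 hs).2⟩
    rcases O.eq_empty_or_nonempty with h0 | ⟨s0, hs0⟩
    · rw [h0, Finset.sum_empty, norm_zero]; positivity
    have hO0 : ∀ s ∈ O, s.k ∈ ({s0.k} : Finset ℕ) := by
      intro s hs
      rw [Finset.mem_singleton]
      have a := hOS s hs
      have b := hOS s0 hs0
      have c1 := overlap_scale_eq hT hg a.1.1 a.1.2.1 b.1.2.1 b.2
      have c2 := overlap_scale_eq hT hg b.1.1 b.1.2.1 a.1.2.1 a.2
      have c3 := hsep s a.1.1 s0 b.1.1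
      have c4 := hsep s0 b.1.1 s a.1.1
      omega
    have h2 := sum_tiles_dyWt_le O 1 (fun q => Finset.card_le_one.2 fun s hs s' hs' => by
      obtain ⟨h1, h2⟩ := Finset.mem_filter.1 hs
      obtain ⟨h3, h4⟩ := Finset.mem_filter.1 hs'
      have h5 := h2.trans h4.symm
      simp only [Prod.mk.injEq] at h5
      have h6 := (hOS s h1).1.2.1
      have h7 := (hOS s' h3).1.2.1
      unfold Tile.Has at h6 h7
      rw [h5.1] at h6
      exact Tile.ext h5.1 h5.2 (h6.symm.trans h7)) _ hO0 (fun _ => 1) (fun _ => zero_le_one) x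
    simp only [Finset.sum_const, Finset.card_singleton, one_smul, one_mul, Nat.cast_one,
      mul_one] at h2
    calc _ ≤ ∑ s ∈ O, ε * B * (dyWt s.k s.m x ^ 2)⁻¹ := by
          refine norm_sum_le_of_le _ fun s hs => ?_
          rw [norm_mul]
          have h3 : (dyWt s.k s.m x ^ 6)⁻¹ ≤ (dyWt s.k s.m x ^ 2)⁻¹ := by
            have := one_le_dyWt s.k s.m x
            have h4 : dyWt s.k s.m x ^ 2 ≤ dyWt s.k s.m x ^ 6 := pow_le_pow_right₀ this (by norm_num)
            gcongr
          calc _ ≤ ε * (B * (dyWt s.k s.m x ^ 6)⁻¹) :=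
                mul_le_mul (hα s (hOS s hs).1.1) (hw.decay s x) (norm_nonneg _) hε
            _ ≤ ε * (B * (dyWt s.k s.m x ^ 2)⁻¹) := by gcongr
            _ = _ := by ring
      _ ≤ ε * B * 20 := by rw [← Finset.mul_sum]; gcongr
      _ = _ := by ring
  have h2 : ‖∑ s ∈ S.filter (fun s => s.LacFreq t.ξ), α s * w s x‖ ≤ 480 * ε * B +
      2 * ∑ j ∈ Finset.Icc (-1 : ℤ) 1,
        dyMax (fun y => ‖∑ s ∈ lacPart T t.ξ j, α s * w s y‖) t.K x' := by
    rw [← Finset.sum_fiberwise_of_maps_to (t := Finset.Icc (-1 : ℤ) 1)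
      (g := fun s => s.l - ⌊t.ξ * 2 ^ s.k⌋) (fun s hs => by
        obtain ⟨_, h3, h4⟩ := Finset.mem_filter.1 hs
        have h5 := Int.floor_le (t.ξ * 2 ^ s.k)
        have h6 := Int.lt_floor_add_one (t.ξ * 2 ^ s.k)
        rw [Finset.mem_Icc]
        have h7 : ((⌊t.ξ * 2 ^ s.k⌋ : ℤ) : ℝ) < ((s.l + 2 : ℤ) : ℝ) := by push_cast; linarith
        have h8 : ((s.l : ℤ) : ℝ) < ((⌊t.ξ * 2 ^ s.k⌋ + 2 : ℤ) : ℝ) := by push_cast; linarith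
        have h9 := Int.cast_lt.1 h7
        have h10 := Int.cast_lt.1 h8
        omega)]
    have h3 : ∀ j ∈ Finset.Icc (-1 : ℤ) 1, ‖∑ s ∈ (S.filter (fun s => s.LacFreq t.ξ)).filter
        (fun s => s.l - ⌊t.ξ * 2 ^ s.k⌋ = j), α s * w s x‖ ≤ 160 * ε * B +
        2 * dyMax (fun y => ‖∑ s ∈ lacPart T t.ξ j, α s * w s y‖) t.K x' := by
      intro j hj
      have hsub : ∀ s ∈ lacPart T t.ξ j, s ∈ T ∧ s.LacFreq t.ξ ∧ s.l = ⌊t.ξ * 2 ^ s.k⌋ + j :=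
        fun s hs => Finset.mem_filter.1 hs
      have h4 := lac_sum_le hw hε (U := lacPart T t.ξ j) (ξ := t.ξ) (K := t.K)
        (fun s hs => hα s (hsub s hs).1) (fun s hs => ⟨hk s (hsub s hs).1, (hT s (hsub s hs).1).1⟩)
        (fun s hs => (hsub s hs).2.1) (Finset.mem_Icc.1 hj) (fun s hs => (hsub s hs).2.2) hx η
      have h5 : (S.filter (fun s => s.LacFreq t.ξ)).filter (fun s => s.l - ⌊t.ξ * 2 ^ s.k⌋ = j) =
          (lacPart T t.ξ j).filter (fun s => s.Has η ∧ r < s.k) := by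
        ext s
        simp only [hS, lacPart, Finset.mem_filter, sub_eq_iff_eq_add']
        tauto
      rw [h5]
      exact h4
    refine (norm_sum_le_of_le _ h3).trans ?_
    rw [Finset.sum_add_distrib, ← Finset.mul_sum _ _ (2 : ℝ), Finset.sum_const]
    have : (Finset.Icc (-1 : ℤ) 1).card = 3 := rfl
    rw [this]
    simp only [nsmul_eq_mul]
    push_cast
    linarith
  refine (norm_add_le _ _).trans ?_
  linarith

/-- The dyadic intervals adjacent to a top. -/
noncomputable def nearSet (t : TreeTop) : Finset ℤ :=
  (Finset.Icc (t.M - 1) (t.M + 1)).biUnion (dyInt t.K)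

lemma mem_nearSet {t : TreeTop} {x : ℤ} : x ∈ nearSet t ↔ |x / 2 ^ t.K - t.M| ≤ 1 := by
  simp only [nearSet, Finset.mem_biUnion, Finset.mem_Icc, mem_dyInt, abs_le]
  constructor
  · rintro ⟨n, hn, rfl⟩; omega
  · intro h; exact ⟨_, by omega, rfl⟩

lemma sum_nearSet (t : TreeTop) (f : ℤ → ℝ) :
    ∑ x ∈ nearSet t, f x = ∑ n ∈ Finset.Icc (t.M - 1) (t.M + 1), ∑ x ∈ dyInt t.K n, f x :=
  Finset.sum_biUnion fun _ _ _ _ h => dyInt_disjoint _ h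

open Classical in
lemma sum_dyMax_lacPart_le {τ : ℝ} {t : TreeTop} {T : Finset Tile} {ε : ℝ} (hε : 0 ≤ ε)
    (hT : ∀ s ∈ T, s.toTop.Below τ t) (hk : ∀ s ∈ T, 1 ≤ s.k)
    (hsep : ∀ s ∈ T, ∀ s' ∈ T, s'.k < s.k → s'.k + 8 ≤ s.k) {w : Tile → ℤ → ℂ} {B : ℝ}
    (hB : 1 ≤ B) (hw : WaveBound w B) {α : Tile → ℂ}
    (hE : EnergyLE (fun s => 2 ^ s.k * ‖α s‖ ^ 2) T (ε ^ 2)) (j : ℤ) :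
    ∑ x ∈ nearSet t, dyMax (fun y => ‖∑ s ∈ lacPart T t.ξ j, α s * w s y‖) t.K x ≤
      6 * B * ε * 2 ^ t.K := by
  have hsub : ∀ s ∈ lacPart T t.ξ j, s ∈ T ∧ s.LacFreq t.ξ ∧ s.l = ⌊t.ξ * 2 ^ s.k⌋ + j :=
    fun s hs => Finset.mem_filter.1 hs
  have h1 : ∀ n, ∑ x ∈ dyInt t.K n, dyMax (fun y => ‖∑ s ∈ lacPart T t.ξ j, α s * w s y‖) t.K x ≤
      2 * B * ε * 2 ^ t.K := by
    intro n
    have h2 := sum_dyMax_sq_le (f := fun y => ‖∑ s ∈ lacPart T t.ξ j, α s * w s y‖)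
      (fun _ => norm_nonneg _) t.K n
    have h3 := hw.bessel (lacPart T t.ξ j) t.ξ (fun s hs => ⟨hk s (hsub s hs).1, (hsub s hs).2.1⟩)
      (fun s hs s' hs' => hsep s (hsub s hs).1 s' (hsub s' hs').1) α (dyInt t.K n)
    have h4 : ∑ s ∈ lacPart T t.ξ j, 2 ^ s.k * ‖α s‖ ^ 2 ≤ ε ^ 2 * 2 ^ t.K := by
      refine le_trans ?_ (hE t)
      refine Finset.sum_le_sum_of_subset_of_nonneg (fun s hs => ?_) fun _ _ _ => by positivity
      obtain ⟨h5, h6, _⟩ := hsub s hs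
      exact Finset.mem_filter.2 ⟨h5, (hT s h5).1, (hT s h5).2.1, h6.1, h6.2⟩
    have h6 := sq_sum_le_card_mul_sum_sq (s := dyInt t.K n)
      (f := fun x => dyMax (fun y => ‖∑ s ∈ lacPart T t.ξ j, α s * w s y‖) t.K x)
    rw [card_dyInt] at h6
    push_cast at h6
    refine abs_le_of_sq_le_sq' (h6.trans ?_) (by positivity) |>.2
    have h7 : (2 : ℝ) ^ t.K * ∑ x ∈ dyInt t.K n,
        dyMax (fun y => ‖∑ s ∈ lacPart T t.ξ j, α s * w s y‖) t.K x ^ 2 ≤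
        2 ^ t.K * (4 * (B * (ε ^ 2 * 2 ^ t.K))) := by
      gcongr
      refine h2.trans ?_
      gcongr
      refine h3.trans ?_
      gcongr
    refine h7.trans ?_
    have h8 : 0 ≤ (ε * 2 ^ t.K) ^ 2 := by positivity
    nlinarith
  rw [sum_nearSet]
  refine (Finset.sum_le_sum fun n _ => h1 n).trans ?_
  rw [Finset.sum_const, Int.card_Icc]
  have : (t.M + 1 + 1 - (t.M - 1)).toNat = 3 := by omega
  rw [this, nsmul_eq_mul]
  push_cast
  linarith

open Classical in
lemma tree_near {τ : ℝ} {η : ℤ → ℝ} {E : Finset ℤ} {t : TreeTop} {T : Finset Tile} {μ ε : ℝ}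
    (hμ : 0 ≤ μ) (hε : 0 ≤ ε) (hT : ∀ s ∈ T, s.toTop.Below τ t) (hg : ∀ s ∈ T, s.Good τ)
    (hk : ∀ s ∈ T, 1 ≤ s.k) (hsep : ∀ s ∈ T, ∀ s' ∈ T, s'.k < s.k → s'.k + 8 ≤ s.k)
    (hm : MassLE τ η E T μ) {w : Tile → ℤ → ℂ} {B : ℝ} (hB : 1 ≤ B) (hw : WaveBound w B)
    {α : Tile → ℂ} (hα : ∀ s ∈ T, ‖α s‖ ≤ ε)
    (hE : EnergyLE (fun s => 2 ^ s.k * ‖α s‖ ^ 2) T (ε ^ 2)) :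
    ∑ x ∈ (nearSet t).filter (· ∈ E), ‖∑ s ∈ T.filter (fun s => s.Has (η x)), α s * w s x‖ ≤
      266000 * B * ε * μ * 2 ^ t.K := by
  rcases T.eq_empty_or_nonempty with rfl | ⟨s0, hs0⟩
  · simp only [Finset.filter_empty, Finset.sum_empty, norm_zero, Finset.sum_const_zero]
    positivity
  set V : ℤ → ℝ := fun x => 500 * ε * B + 2 * ∑ j ∈ Finset.Icc (-1 : ℤ) 1,
    dyMax (fun y => ‖∑ s ∈ lacPart T t.ξ j, α s * w s y‖) t.K x with hV
  have hV0 : ∀ x, 0 ≤ V x := fun x => by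
    have : 0 ≤ ∑ j ∈ Finset.Icc (-1 : ℤ) 1,
      dyMax (fun y => ‖∑ s ∈ lacPart T t.ξ j, α s * w s y‖) t.K x :=
      Finset.sum_nonneg fun j _ => dyMax_nonneg (fun _ => norm_nonneg _) _ _
    simp only [hV]
    positivity
  set F : ℤ → ℝ := fun x => if x ∈ E then
    ‖∑ s ∈ T.filter (fun s => s.Has (η x)), α s * w s x‖ else 0 with hF
  have htouch : ∀ x ∈ nearSet t, Touched T t.K (x / 2 ^ t.K) := by
    intro x hx
    refine ⟨s0, hs0, (hT s0 hs0).1, ?_⟩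
    have h1 := (hT s0 hs0).2.1
    simp only [Tile.toTop] at h1
    rw [h1, abs_sub_comm]
    exact mem_nearSet.1 hx
  have hK : 1 ≤ t.K := (hk s0 hs0).trans (hT s0 hs0).1
  have hcell : ∀ x ∈ nearSet t, ∑ y ∈ dyInt (stopScale T x) (x / 2 ^ stopScale T x), F y ≤
      ∑ y ∈ dyInt (stopScale T x) (x / 2 ^ stopScale T x), (84480 * B * ε * μ + 8 * μ * V y) := by
    intro x hx
    obtain ⟨h1, h2⟩ := touched_stopScale hK (htouch x hx)
    set r := stopScale T x with hr
    have h3 := cell_small_le hμ hε hT hg hm hw hα (not_touched_of_le hk hr.le)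
    have h4 := cell_card_le hT hg hm h2
    set J := (dyInt r (x / 2 ^ r)).filter (· ∈ E) with hJ
    have h5 : ∑ y ∈ dyInt r (x / 2 ^ r), F y =
        ∑ y ∈ J, ‖∑ s ∈ T.filter (fun s => s.Has (η y)), α s * w s y‖ := by
      rw [hJ, Finset.sum_filter]
    have h6 : ∑ y ∈ J, ‖∑ s ∈ T.filter (fun s => s.Has (η y)), α s * w s y‖ ≤
        ∑ y ∈ J, ‖∑ s ∈ T.filter (fun s => s.Has (η y) ∧ s.k ≤ r), α s * w s y‖ +
        ∑ y ∈ J, ‖∑ s ∈ T.filter (fun s => s.Has (η y) ∧ r < s.k), α s * w s y‖ := by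
      rw [← Finset.sum_add_distrib]
      refine Finset.sum_le_sum fun y _ => ?_
      rw [← Finset.sum_filter_add_sum_filter_not (T.filter (fun s => s.Has (η y)))
        (fun s => s.k ≤ r), Finset.filter_filter,
        Finset.filter_filter]
      simp only [not_le]
      exact norm_add_le _ _
    have h7 : ∑ y ∈ J, ‖∑ s ∈ T.filter (fun s => s.Has (η y) ∧ r < s.k), α s * w s y‖ ≤
        8 * μ * ∑ y ∈ dyInt r (x / 2 ^ r), V y := by
      obtain ⟨x', hx', hmin⟩ := Finset.exists_min_image (dyInt r (x / 2 ^ r)) V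
        ⟨x, mem_dyInt.2 rfl⟩
      have h8 : ∑ y ∈ J, ‖∑ s ∈ T.filter (fun s => s.Has (η y) ∧ r < s.k), α s * w s y‖ ≤
          ∑ y ∈ J.filter (fun y => ∃ s ∈ T, s.Has (η y) ∧ r < s.k), V x' := by
        rw [Finset.sum_filter (s := J)]
        refine Finset.sum_le_sum (f := fun y =>
          ‖∑ s ∈ T.filter (fun s => s.Has (η y) ∧ r < s.k), α s * w s y‖) fun y hy => ?_
        split_ifs with h
        · refine pointwise_large_le hε hT hg hk hsep hw hα ?_ _
          rw [mem_dyInt.1 hx', mem_dyInt.1 (Finset.mem_filter.1 hy).1]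
        · rw [Finset.filter_false_of_mem (fun s hs hs' => h ⟨s, hs, hs'⟩), Finset.sum_empty, norm_zero]
      refine h8.trans ?_
      rw [Finset.sum_const, nsmul_eq_mul]
      have h9 := Finset.card_nsmul_le_sum (dyInt r (x / 2 ^ r)) V (V x') hmin
      rw [card_dyInt, nsmul_eq_mul] at h9
      push_cast at h9
      calc _ ≤ 8 * μ * 2 ^ r * V x' := mul_le_mul_of_nonneg_right h4 (hV0 x')
        _ = 8 * μ * (2 ^ r * V x') := by ring
        _ ≤ _ := by gcongr
    rw [Finset.sum_add_distrib, ← Finset.mul_sum _ _ (8 * μ), Finset.sum_const, card_dyInt, nsmul_eq_mul, h5]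
    push_cast
    linarith
  have hsum := sum_le_sum_of_cells (N := nearSet t) (r := stopScale T) (fun x hx y hy => by
    obtain ⟨h1, _⟩ := touched_stopScale hK (htouch x hx)
    refine ⟨?_, stopScale_eq hk hK (htouch x hx) hy⟩
    rw [mem_nearSet, div_eq_of_le hy h1.le]
    exact mem_nearSet.1 hx) hcell
  rw [Finset.sum_filter]
  refine hsum.trans ?_
  have hcard : ((nearSet t).card : ℝ) = 3 * 2 ^ t.K := by
    have h := sum_nearSet t fun _ => 1
    simp only [Finset.sum_const, card_dyInt, nsmul_eq_mul, mul_one] at h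
    rw [h, Int.card_Icc]
    have : (t.M + 1 + 1 - (t.M - 1)).toNat = 3 := by omega
    rw [this]
    push_cast
    ring
  have hVsum : ∑ x ∈ nearSet t, V x ≤ 1536 * B * ε * 2 ^ t.K := by
    simp only [hV]
    rw [Finset.sum_add_distrib, Finset.sum_const, nsmul_eq_mul, hcard, ← Finset.mul_sum,
      Finset.sum_comm]
    have h := Finset.sum_le_sum fun j (_ : j ∈ Finset.Icc (-1 : ℤ) 1) =>
      sum_dyMax_lacPart_le hε hT hk hsep hB hw hE j
    rw [Finset.sum_const, show (Finset.Icc (-1 : ℤ) 1).card = 3 from rfl, nsmul_eq_mul] at h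
    push_cast at h
    linarith
  rw [Finset.sum_add_distrib, Finset.sum_const, nsmul_eq_mul, hcard, ← Finset.mul_sum _ _ (8 * μ)]
  have h9 : 8 * μ * ∑ x ∈ nearSet t, V x ≤ 8 * μ * (1536 * B * ε * 2 ^ t.K) := by gcongr
  have h10 : 0 ≤ B * ε * μ * 2 ^ t.K := by positivity
  linarith

open Classical in
/-- The tree lemma. -/
lemma tree_lemma {τ : ℝ} {η : ℤ → ℝ} {E : Finset ℤ} {t : TreeTop} {T : Finset Tile} {μ ε : ℝ}
    (hμ : 0 ≤ μ) (hε : 0 ≤ ε) (hT : ∀ s ∈ T, s.toTop.Below τ t) (hg : ∀ s ∈ T, s.Good τ)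
    (hk : ∀ s ∈ T, 1 ≤ s.k) (hsep : ∀ s ∈ T, ∀ s' ∈ T, s'.k < s.k → s'.k + 8 ≤ s.k)
    (hm : MassLE τ η E T μ) {w : Tile → ℤ → ℂ} {B : ℝ} (hB : 1 ≤ B) (hw : WaveBound w B)
    {α : Tile → ℂ} (hE : EnergyLE (fun s => 2 ^ s.k * ‖α s‖ ^ 2) T (ε ^ 2)) :
    ∑ x ∈ E, ‖∑ s ∈ T.filter (fun s => s.Has (η x)), α s * w s x‖ ≤
      270000 * B * ε * μ * 2 ^ t.K := by
  have hα : ∀ s ∈ T, ‖α s‖ ≤ ε := by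
    intro s hs
    have h1 := hE.apply_le (fun s => by positivity) hs
    have h2 : (0 : ℝ) < 2 ^ s.k := by positivity
    rw [mul_comm (ε ^ 2)] at h1
    exact abs_le_of_sq_le_sq' (le_of_mul_le_mul_left h1 h2) hε |>.2
  rw [← Finset.sum_filter_add_sum_filter_not E (fun x => x ∈ nearSet t)]
  have h1 := tree_near hμ hε hT hg hk hsep hm hB hw hα hE
  have h2 := tree_far hμ hε hT hg hm hw hα (E.filter fun x => ¬ x ∈ nearSet t)
    (Finset.filter_subset _ _) (fun x hx => by
      have := (Finset.mem_filter.1 hx).2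
      rw [mem_nearSet] at this
      omega)
  have h3 : E.filter (fun x => x ∈ nearSet t) = (nearSet t).filter (· ∈ E) := by
    ext x; simp only [Finset.mem_filter]; tauto
  rw [h3]
  have h4 : 0 ≤ B * ε * μ * 2 ^ t.K := by positivity
  linarith

/-! ### Decomposition into trees -/

open Classical in
/-- The model sum. -/
noncomputable def modelSum (w : Tile → ℤ → ℂ) (α : Tile → ℂ) (η : ℤ → ℝ) (E : Finset ℤ)
    (P : Finset Tile) : ℝ :=
  ∑ x ∈ E, ‖∑ s ∈ P.filter (fun s => s.Has (η x)), α s * w s x‖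

lemma modelSum_le_add (w : Tile → ℤ → ℂ) (α : Tile → ℂ) (η : ℤ → ℝ) (E : Finset ℤ)
    {P P' : Finset Tile} (h : P' ⊆ P) :
    modelSum w α η E P ≤ modelSum w α η E P' + modelSum w α η E (P \ P') := by
  classical
  unfold modelSum
  rw [← Finset.sum_add_distrib]
  refine Finset.sum_le_sum fun x _ => ?_
  have : P.filter (fun s => s.Has (η x)) = P'.filter (fun s => s.Has (η x)) ∪
      (P \ P').filter (fun s => s.Has (η x)) := by
    rw [← Finset.filter_union, Finset.union_sdiff_of_subset h]
  rw [this, Finset.sum_union (Finset.disjoint_filter_filter Finset.disjoint_sdiff)]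
  exact norm_add_le _ _

lemma modelSum_fiber_le {ι : Type*} (w : Tile → ℤ → ℂ) (α : Tile → ℂ) (η : ℤ → ℝ) (E : Finset ℤ)
    (P : Finset Tile) [DecidableEq ι] (S : Finset ι) (f : Tile → ι) (hf : ∀ s ∈ P, f s ∈ S) :
    modelSum w α η E P ≤ ∑ t ∈ S, modelSum w α η E (P.filter fun s => f s = t) := by
  classical
  unfold modelSum
  rw [Finset.sum_comm]
  refine Finset.sum_le_sum fun x _ => ?_
  rw [← Finset.sum_fiberwise_of_maps_to (s := P.filter (fun s => s.Has (η x))) (t := S) (g := f)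
    (fun s hs => hf s (Finset.mem_filter.1 hs).1)]
  refine norm_sum_le_of_le _ fun t _ => le_of_eq ?_
  rw [Finset.filter_filter, Finset.filter_filter]
  simp only [and_comm]

section

variable {H : Type*} [NormedAddCommGroup H] [InnerProductSpace ℂ H]

/-- The contribution of a collection of tiles covered by trees. -/
lemma modelSum_cover_le {τ : ℝ} {η : ℤ → ℝ} {E : Finset ℤ} {P : Finset Tile} {μ ε : ℝ}
    (hμ : 0 ≤ μ) (hε : 0 ≤ ε) (hg : ∀ s ∈ P, s.Good τ)
    (hk : ∀ s ∈ P, 1 ≤ s.k) (hsep : ∀ s ∈ P, ∀ s' ∈ P, s'.k < s.k → s'.k + 8 ≤ s.k)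
    (hm : MassLE τ η E P μ) {w : Tile → ℤ → ℂ} {B : ℝ} (hB : 1 ≤ B) (hw : WaveBound w B)
    {α : Tile → ℂ} (hE : EnergyLE (fun s => 2 ^ s.k * ‖α s‖ ^ 2) P (ε ^ 2)) (S : Finset TreeTop)
    (hS : ∀ s ∈ P, ∃ t ∈ S, s.toTop.Below τ t) :
    modelSum w α η E P ≤ 270000 * B * ε * μ * ∑ t ∈ S, (2 : ℝ) ^ t.K := by
  classical
  have hex : ∀ s : Tile, ∃ t : TreeTop, s ∈ P → t ∈ S ∧ s.toTop.Below τ t := by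
    intro s
    by_cases h : s ∈ P
    · obtain ⟨t, h1, h2⟩ := hS s h
      exact ⟨t, fun _ => ⟨h1, h2⟩⟩
    · exact ⟨s.toTop, fun h' => absurd h' h⟩
  choose f hf using hex
  refine (modelSum_fiber_le w α η E P S f fun s hs => (hf s hs).1).trans ?_
  rw [Finset.mul_sum]
  refine Finset.sum_le_sum fun t _ => ?_
  have hsub : ∀ s ∈ P.filter (fun s => f s = t), s ∈ P ∧ f s = t := fun s hs => Finset.mem_filter.1 hs
  refine tree_lemma hμ hε (fun s hs => ?_) (fun s hs => hg s (hsub s hs).1)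
    (fun s hs => hk s (hsub s hs).1)
    (fun s hs s' hs' => hsep s (hsub s hs).1 s' (hsub s' hs').1)
    (hm.mono (Finset.filter_subset _ _)) hB hw
    (hE.mono (fun s => by positivity) (Finset.filter_subset _ _))
  rw [← (hsub s hs).2]
  exact (hf s (hsub s hs).1).2

/-- The constant in the model estimate. -/
noncomputable def modelConst (B : ℝ) : ℝ := 270000 * B * (64 + 1000000 * B)

variable {τ : ℝ} {η : ℤ → ℝ} {E : Finset ℤ} {v : Tile → H} {w : Tile → ℤ → ℂ} {B : ℝ} {g : H}

/-- Removing trees from a collection of tiles lowers its mass and its energy. -/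
lemma modelSum_halving (hE : E.Nonempty) (hg0 : g ≠ 0) (hB : 1 ≤ B) (hv : PacketBound v B)
    (hw : WaveBound w B) {P : Finset Tile} (hg : ∀ s ∈ P, s.Good τ) (hk : ∀ s ∈ P, 1 ≤ s.k)
    (hsep : ∀ s ∈ P, ∀ s' ∈ P, s'.k < s.k → s'.k + 8 ≤ s.k) {θ ν : ℝ} (hθ : 0 < θ) (hν : 0 ≤ ν)
    (hm : MassLE τ η E P ν)
    (he : EnergyLE (fun s => 2 ^ s.k * ‖inner ℂ (v s) g‖ ^ 2) P
      ((θ * (‖g‖ / √E.card)) ^ 2)) :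
    ∃ P' ⊆ P, MassLE τ η E P' ((θ / 2) ^ 2) ∧
      EnergyLE (fun s => 2 ^ s.k * ‖inner ℂ (v s) g‖ ^ 2) P' ((θ / 2 * (‖g‖ / √E.card)) ^ 2) ∧
      modelSum w (fun s => inner ℂ (v s) g) η E P ≤
        modelSum w (fun s => inner ℂ (v s) g) η E P' +
          modelConst B * (ν / θ) * (‖g‖ * √E.card) := by
  have ha0 : ∀ s : Tile, 0 ≤ 2 ^ s.k * ‖inner ℂ (v s) g‖ ^ 2 := fun s => by positivity
  have hN : (0 : ℝ) < E.card := by exact_mod_cast hE.card_pos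
  have hG : 0 < ‖g‖ := norm_pos_iff.2 hg0
  set ε := θ * (‖g‖ / √E.card) with hε
  have hε0 : 0 < ε := by positivity
  obtain ⟨P1, hP1, hm1, S1, hS1, hc1⟩ := mass_lemma τ η E P (show 0 < θ ^ 2 by positivity)
  obtain ⟨P2, hP2, he2, S2, hS2, hc2⟩ := energy_lemma (by linarith) hv g τ P1
    (fun s hs => hg s (hP1 hs)) (fun s hs s' hs' => hsep s (hP1 hs) s' (hP1 hs')) hε0
    (he.mono ha0 hP1)
  refine ⟨P2, hP2.trans hP1, ?_, ?_, ?_⟩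
  · rw [show (θ / 2) ^ 2 = θ ^ 2 / 4 by ring]; exact hm1.mono hP2
  · rw [show (θ / 2 * (‖g‖ / √E.card)) ^ 2 = ε ^ 2 / 4 by rw [hε]; ring]; exact he2
  have h1 := modelSum_le_add w (fun s => inner ℂ (v s) g) η E hP1
  have h2 := modelSum_le_add w (fun s => inner ℂ (v s) g) η E hP2
  have sub1 : ∀ s ∈ P \ P1, s ∈ P := fun s hs => (Finset.mem_sdiff.1 hs).1
  have sub2 : ∀ s ∈ P1 \ P2, s ∈ P := fun s hs => hP1 (Finset.mem_sdiff.1 hs).1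
  have h3 := modelSum_cover_le hν hε0.le (fun s hs => hg s (sub1 s hs)) (fun s hs => hk s (sub1 s hs))
    (fun s hs s' hs' => hsep s (sub1 s hs) s' (sub1 s' hs')) (hm.mono sub1) hB hw
    (he.mono ha0 sub1) S1 hS1
  have h4 := modelSum_cover_le hν hε0.le (fun s hs => hg s (sub2 s hs)) (fun s hs => hk s (sub2 s hs))
    (fun s hs s' hs' => hsep s (sub2 s hs) s' (sub2 s' hs')) (hm.mono sub2) hB hw
    (he.mono ha0 sub2) S2 hS2
  have hsq : √(E.card : ℝ) ^ 2 = E.card := Real.sq_sqrt hN.le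
  have hs0 : 0 < √(E.card : ℝ) := Real.sqrt_pos.2 hN
  have e1 : 1000000 * B / ε ^ 2 * ‖g‖ ^ 2 = 1000000 * B / θ ^ 2 * E.card := by
    rw [hε]; field_simp; rw [hsq]
  rw [e1] at hc2
  have h5 : 0 ≤ 270000 * B * ε * ν := by positivity
  have h6 := mul_le_mul_of_nonneg_left hc1 h5
  have h7 := mul_le_mul_of_nonneg_left hc2 h5
  have e2 : 270000 * B * ε * ν * (64 / θ ^ 2 * E.card) +
      270000 * B * ε * ν * (1000000 * B / θ ^ 2 * E.card) =
      modelConst B * (ν / θ) * (‖g‖ * √E.card) := by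
    rw [modelConst, hε]; field_simp; rw [hsq]; ring
  linarith

lemma modelSum_le_card {P : Finset Tile} {α : Tile → ℂ} {e : ℝ} (he0 : 0 ≤ e) (hw : WaveBound w B)
    (he : EnergyLE (fun s => 2 ^ s.k * ‖α s‖ ^ 2) P (e ^ 2)) :
    modelSum w α η E P ≤ E.card * (P.card * (e * B)) := by
  classical
  have hB := hw.nonneg
  unfold modelSum
  rw [← nsmul_eq_mul, ← Finset.sum_const]
  refine Finset.sum_le_sum fun x _ => ?_
  rw [← nsmul_eq_mul, ← Finset.sum_const]
  refine (norm_sum_le _ _).trans ((Finset.sum_le_sum_of_subset_of_nonneg (Finset.filter_subset _ _)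
    fun _ _ _ => norm_nonneg _).trans (Finset.sum_le_sum fun s hs => ?_))
  have h1 := he.apply_le (fun s => by positivity) hs
  have h2 : (0 : ℝ) < 2 ^ s.k := by positivity
  rw [mul_comm (e ^ 2)] at h1
  have h3 := abs_le_of_sq_le_sq' (le_of_mul_le_mul_left h1 h2) he0 |>.2
  rw [norm_mul]
  refine mul_le_mul h3 ((hw.decay s x).trans ?_) (norm_nonneg _) he0
  have h4 : (dyWt s.k s.m x ^ 6)⁻¹ ≤ 1 := inv_le_one_of_one_le₀ (one_le_pow₀ (one_le_dyWt _ _ _))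
  nlinarith

lemma modelSum_small (hE : E.Nonempty) (hg0 : g ≠ 0) (hB : 1 ≤ B) (hv : PacketBound v B)
    (hw : WaveBound w B) {P : Finset Tile} (hg : ∀ s ∈ P, s.Good τ) (hk : ∀ s ∈ P, 1 ≤ s.k)
    (hsep : ∀ s ∈ P, ∀ s' ∈ P, s'.k < s.k → s'.k + 8 ≤ s.k) {θ : ℝ} (hθ : 0 < θ)
    (hm : MassLE τ η E P (θ ^ 2))
    (he : EnergyLE (fun s => 2 ^ s.k * ‖inner ℂ (v s) g‖ ^ 2) P ((θ * (‖g‖ / √E.card)) ^ 2)) :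
    modelSum w (fun s => inner ℂ (v s) g) η E P ≤ modelConst B * (‖g‖ * √E.card) * (2 * θ) := by
  have hC : 0 ≤ modelConst B * (‖g‖ * √E.card) := by unfold modelConst; positivity
  have key : ∀ n : ℕ, ∀ P : Finset Tile, (∀ s ∈ P, s.Good τ) → (∀ s ∈ P, 1 ≤ s.k) →
      (∀ s ∈ P, ∀ s' ∈ P, s'.k < s.k → s'.k + 8 ≤ s.k) → ∀ θ : ℝ, 0 < θ → MassLE τ η E P (θ ^ 2) →
      EnergyLE (fun s => 2 ^ s.k * ‖inner ℂ (v s) g‖ ^ 2) P ((θ * (‖g‖ / √E.card)) ^ 2) →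
      modelSum w (fun s => inner ℂ (v s) g) η E P ≤ modelConst B * (‖g‖ * √E.card) * (2 * θ) +
        E.card * (P.card * (θ * (‖g‖ / √E.card) * B)) * (1 / 2) ^ n := by
    intro n
    induction n with
    | zero =>
      intro P hg hk hsep θ hθ hm he
      have := modelSum_le_card (E := E) (η := η) (α := fun s => inner ℂ (v s) g)
        (show 0 ≤ θ * (‖g‖ / √E.card) by positivity) hw he
      rw [pow_zero, mul_one]
      have h2 : 0 ≤ modelConst B * (‖g‖ * √E.card) * (2 * θ) := by positivity
      linarith
    | succ n ih =>
      intro P hg hk hsep θ hθ hm he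
      obtain ⟨P', hP', hm', he', h1⟩ := modelSum_halving hE hg0 hB hv hw hg hk hsep hθ (by positivity) hm he
      have h2 := ih P' (fun s hs => hg s (hP' hs)) (fun s hs => hk s (hP' hs))
        (fun s hs s' hs' => hsep s (hP' hs) s' (hP' hs')) (θ / 2) (by positivity) hm' he'
      have h3 : (P'.card : ℝ) ≤ P.card := by exact_mod_cast Finset.card_le_card hP'
      have h4 : E.card * (P'.card * (θ / 2 * (‖g‖ / √E.card) * B)) * (1 / 2) ^ n ≤
          E.card * (P.card * (θ * (‖g‖ / √E.card) * B)) * (1 / 2) ^ (n + 1) := by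
        calc _ ≤ E.card * (P.card * (θ / 2 * (‖g‖ / √E.card) * B)) * (1 / 2) ^ n := by gcongr
          _ = _ := by rw [pow_succ]; ring
      have h5 : θ ^ 2 / θ = θ := by field_simp
      rw [h5] at h1
      linarith
  refine le_of_forall_pos_le_add fun δ hδ => ?_
  set A := (E.card : ℝ) * (P.card * (θ * (‖g‖ / √E.card) * B))
  have hA : 0 ≤ A := by positivity
  obtain ⟨n, hn⟩ := exists_pow_lt_of_lt_one (show 0 < δ / (A + 1) by positivity)
    (show (1 / 2 : ℝ) < 1 by norm_num)
  refine (key n P hg hk hsep θ hθ hm he).trans ?_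
  have : A * (1 / 2) ^ n ≤ δ := by
    rw [lt_div_iff₀ (by positivity)] at hn
    have : (0 : ℝ) ≤ (1 / 2) ^ n := by positivity
    nlinarith
  linarith

/-- The estimate of the model sum for separated scales and one grid. -/
lemma modelSum_le (hB : 1 ≤ B) (hv : PacketBound v B)
    (hw : WaveBound w B) {P : Finset Tile} (hg : ∀ s ∈ P, s.Good τ) (hk : ∀ s ∈ P, 1 ≤ s.k)
    (hsep : ∀ s ∈ P, ∀ s' ∈ P, s'.k < s.k → s'.k + 8 ≤ s.k) :
    modelSum w (fun s => inner ℂ (v s) g) η E P ≤ 6 * modelConst B * (‖g‖ * √E.card) := by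
  have hC : 0 ≤ modelConst B * (‖g‖ * √E.card) := by unfold modelConst; positivity
  rcases E.eq_empty_or_nonempty with rfl | hE
  · simp [modelSum]
  by_cases hg0 : g = 0
  · simp [modelSum, hg0]
  have hN : (0 : ℝ) < E.card := by exact_mod_cast hE.card_pos
  have hs0 : 0 < √(E.card : ℝ) := Real.sqrt_pos.2 hN
  have hG : 0 < ‖g‖ := norm_pos_iff.2 hg0
  have key : ∀ n : ℕ, ∀ P : Finset Tile, (∀ s ∈ P, s.Good τ) → (∀ s ∈ P, 1 ≤ s.k) →
      (∀ s ∈ P, ∀ s' ∈ P, s'.k < s.k → s'.k + 8 ≤ s.k) → MassLE τ η E P ((2 ^ (n + 1)) ^ 2) →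
      EnergyLE (fun s => 2 ^ s.k * ‖inner ℂ (v s) g‖ ^ 2) P ((2 ^ (n + 1) * (‖g‖ / √E.card)) ^ 2) →
      modelSum w (fun s => inner ℂ (v s) g) η E P ≤
        modelConst B * (‖g‖ * √E.card) * (6 - 2 * (1 / 2) ^ n) := by
    intro n
    induction n with
    | zero =>
      intro P hg hk hsep hm he
      have := modelSum_small hE hg0 hB hv hw hg hk hsep (by positivity) hm he
      norm_num at this ⊢
      linarith
    | succ n ih =>
      intro P hg hk hsep hm he
      obtain ⟨P', hP', hm', he', h1⟩ := modelSum_halving hE hg0 hB hv hw hg hk hsep (by positivity)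
        (by norm_num) (massLE_four τ η E P) he
      have e : (2 : ℝ) ^ (n + 1 + 1) / 2 = 2 ^ (n + 1) := by rw [pow_succ _ (n + 1)]; ring
      rw [e] at hm' he'
      have h2 := ih P' (fun s hs => hg s (hP' hs)) (fun s hs => hk s (hP' hs))
        (fun s hs s' hs' => hsep s (hP' hs) s' (hP' hs')) hm' he'
      have h3 : modelConst B * (4 / 2 ^ (n + 1 + 1)) * (‖g‖ * √E.card) =
          modelConst B * (‖g‖ * √E.card) * ((1 / 2) ^ n) := by
        rw [pow_succ, pow_succ, one_div, inv_pow]; field_simp; norm_num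
      rw [h3] at h1
      rw [pow_succ]
      linarith
  obtain ⟨n, hn⟩ := pow_unbounded_of_one_lt
    ((∑ s ∈ P, 2 ^ s.k * ‖inner ℂ (v s) g‖ ^ 2) / (‖g‖ / √E.card) ^ 2) (show (1 : ℝ) < 2 by norm_num)
  have h1 : (2 : ℝ) ^ n ≤ (2 ^ (n + 1)) ^ 2 := by
    rw [← pow_mul]; exact pow_le_pow_right₀ (by norm_num) (by omega)
  have h0 := key n P hg hk hsep ?_ ?_
  · refine h0.trans ?_
    have : (0 : ℝ) ≤ (1 / 2) ^ n := by positivity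
    nlinarith
  · intro s hs t hst j
    refine (massLE_four τ η E P s hs t hst j).trans ?_
    have : (4 : ℝ) ≤ (2 ^ (n + 1)) ^ 2 := by
      rw [← pow_mul]
      calc (4 : ℝ) = 2 ^ 2 := by norm_num
        _ ≤ _ := pow_le_pow_right₀ (by norm_num) (by omega)
    gcongr
  · classical
    intro t
    have h2 : ∑ s ∈ P, 2 ^ s.k * ‖inner ℂ (v s) g‖ ^ 2 ≤ (2 ^ (n + 1) * (‖g‖ / √E.card)) ^ 2 := by
      rw [div_lt_iff₀ (by positivity)] at hn
      rw [mul_pow]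
      refine hn.le.trans ?_
      gcongr
    have h3 : (1 : ℝ) ≤ 2 ^ t.K := one_le_pow₀ (by norm_num)
    calc _ ≤ ∑ s ∈ P, 2 ^ s.k * ‖inner ℂ (v s) g‖ ^ 2 :=
          Finset.sum_le_sum_of_subset_of_nonneg (Finset.filter_subset _ _)
            fun _ _ _ => by positivity
      _ ≤ _ := h2
      _ ≤ _ := le_mul_of_one_le_right (by positivity) h3

end

/-! ### The two grids -/

lemma Tile.good_zero_or (s : Tile) : s.Good 0 ∨ s.Good (32 / 3) := by
  have hc : s.c * 2 ^ s.k = s.l := by unfold Tile.c; field_simp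
  have key : ∀ (τ : ℝ) (a : ℤ), (∀ y : ℝ, s.l - 8 ≤ y → y < s.l + 2 →
      a ≤ (y - τ * 2 ^ s.k) / 32 ∧ (y - τ * 2 ^ s.k) / 32 < a + 1) → s.Good τ := by
    intro τ a h ζ h1 h2
    have h3 : gridIdx τ s.k ζ = a := by
      unfold gridIdx; rw [Int.floor_eq_iff, sub_mul]; exact h _ h1 h2
    have h4 : gridIdx τ s.k s.c = a := by
      unfold gridIdx; rw [Int.floor_eq_iff, sub_mul, hc]; exact h _ (by linarith) (by linarith)
    rw [h3, h4]
  by_cases h : 8 ≤ s.l % 32 ∧ s.l % 32 ≤ 30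
  · refine Or.inl (key 0 (s.l / 32) fun y h1 h2 => ?_)
    have h3 : ((s.l : ℤ) : ℝ) = 32 * ((s.l / 32 : ℤ) : ℝ) + ((s.l % 32 : ℤ) : ℝ) := by
      exact_mod_cast (Int.mul_ediv_add_emod s.l 32).symm
    have h4 : (8 : ℝ) ≤ ((s.l % 32 : ℤ) : ℝ) := by exact_mod_cast h.1
    have h5 : ((s.l % 32 : ℤ) : ℝ) ≤ 30 := by exact_mod_cast h.2
    constructor <;> linarith
  · right
    obtain ⟨a, b, hab, hb1, hb2⟩ : ∃ a b : ℤ, s.l = 32 * a + b ∧ -1 ≤ b ∧ b ≤ 7 :=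
      ⟨(s.l + 1) / 32, s.l - 32 * ((s.l + 1) / 32), by omega, by omega, by omega⟩
    obtain ⟨q, r, hqr, hr1, hr2⟩ : ∃ q r : ℤ, (2 : ℤ) ^ s.k = 3 * q + r ∧ 1 ≤ r ∧ r ≤ 2 := by
      have h3 : ¬ (3 : ℤ) ∣ 2 ^ s.k := fun hd => by
        have := Int.prime_three.dvd_of_dvd_pow hd
        omega
      exact ⟨2 ^ s.k / 3, 2 ^ s.k % 3, by omega, by omega, by omega⟩
    refine key _ (a - q - 1) fun y h1 h2 => ?_
    have h3 : (s.l : ℝ) = 32 * a + b := by exact_mod_cast hab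
    have h4 : (2 : ℝ) ^ s.k = 3 * q + r := by exact_mod_cast hqr
    have h5 : (-1 : ℝ) ≤ b := by exact_mod_cast hb1
    have h6 : (b : ℝ) ≤ 7 := by exact_mod_cast hb2
    have h7 : (1 : ℝ) ≤ r := by exact_mod_cast hr1
    have h8 : (r : ℝ) ≤ 2 := by exact_mod_cast hr2
    push_cast
    constructor <;> linarith

/-- The estimate of the model sum. -/
lemma modelSum_le_norm {H : Type*} [NormedAddCommGroup H] [InnerProductSpace ℂ H]
    {η : ℤ → ℝ} {E : Finset ℤ} {v : Tile → H} {w : Tile → ℤ → ℂ} {B : ℝ} {g : H}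
    (hB : 1 ≤ B) (hv : PacketBound v B) (hw : WaveBound w B) {P : Finset Tile}
    (hk : ∀ s ∈ P, 1 ≤ s.k) :
    modelSum w (fun s => inner ℂ (v s) g) η E P ≤ 96 * modelConst B * (‖g‖ * √E.card) := by
  classical
  refine (modelSum_fiber_le w _ η E P (Finset.range 8 ×ˢ (Finset.univ : Finset Bool))
    (fun s => (s.k % 8, decide (s.Good 0))) (fun s _ => by
      simp only [Finset.mem_product, Finset.mem_range, Finset.mem_univ, and_true]
      exact Nat.mod_lt _ (by norm_num))).trans ?_
  refine (Finset.sum_le_card_nsmul _ _ (6 * modelConst B * (‖g‖ * √E.card)) ?_).trans (le_of_eq ?_)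
  · rintro ⟨i, b⟩ -
    have hmem : ∀ s ∈ P.filter (fun s => (s.k % 8, decide (s.Good 0)) = (i, b)),
        s ∈ P ∧ s.k % 8 = i ∧ decide (s.Good 0) = b := fun s hs => by
      simpa only [Finset.mem_filter, Prod.mk.injEq] using hs
    refine modelSum_le (τ := if b then 0 else 32 / 3) hB hv hw (fun s hs => ?_)
      (fun s hs => hk s (hmem s hs).1) (fun s hs s' hs' h => ?_)
    · obtain ⟨-, -, h⟩ := hmem s hs
      cases b
      · simpa using s.good_zero_or.resolve_left (by simpa using h)
      · simpa using h
    · have h1 := (hmem s hs).2.1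
      have h2 := (hmem s' hs').2.1
      omega
  · simp only [Finset.card_product, Finset.card_range, Finset.card_univ, Fintype.card_bool,
      nsmul_eq_mul]
    push_cast
    ring

open scoped SchwartzMap FourierTransform

/-! ### Characters -/

lemma eChar_add (a b : ℝ) : eChar (a + b) = eChar a * eChar b := by
  unfold eChar; rw [← Complex.exp_add]; congr 1; push_cast; ring

@[simp] lemma eChar_zero : eChar 0 = 1 := by simp [eChar]

lemma eChar_int (n : ℤ) : eChar n = 1 := by
  unfold eChar; rw [Complex.exp_eq_one_iff]; exact ⟨n, by push_cast; ring⟩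

lemma conj_eChar (a : ℝ) : (starRingEnd ℂ) (eChar a) = eChar (-a) := by
  unfold eChar; rw [← Complex.exp_conj]; congr 1
  rw [map_mul, Complex.conj_ofReal, Complex.conj_I]; push_cast; ring

lemma hasDerivAt_eChar_mul (a y : ℝ) :
    HasDerivAt (fun y : ℝ => eChar (a * y)) ((2 * Real.pi * a : ℝ) * Complex.I * eChar (a * y)) y := by
  have h1 : HasDerivAt (fun y : ℝ => ((2 * Real.pi * (a * y) : ℝ) : ℂ) * Complex.I)
      (((2 * Real.pi * (a * 1) : ℝ) : ℂ) * Complex.I) y :=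
    ((((hasDerivAt_id y).const_mul a).const_mul (2 * Real.pi)).ofReal_comp).mul_const _
  convert! h1.cexp using 1
  rw [mul_one]; unfold eChar; ring

@[fun_prop] lemma continuous_eChar : Continuous eChar := by
  unfold eChar; fun_prop

lemma norm_eChar_sub_one_ge {q : ℝ} (h : |q| ≤ 5 / 8) : 2 * |q| ≤ ‖eChar q - 1‖ := by
  have h1 : ‖eChar q - 1‖ = 2 * |Real.sin (Real.pi * q)| := by
    unfold eChar
    rw [mul_comm, Complex.norm_exp_I_mul_ofReal_sub_one]
    rw [show 2 * Real.pi * q / 2 = Real.pi * q by ring, norm_mul, Real.norm_eq_abs, Real.norm_eq_abs,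
      abs_of_pos (by norm_num : (0 : ℝ) < 2)]
  rw [h1]
  have hpi := Real.pi_pos
  have h2 : |Real.sin (Real.pi * q)| = Real.sin (Real.pi * |q|) := by
    rw [Real.abs_sin_eq_sin_abs_of_abs_le_pi, abs_mul, abs_of_pos hpi]
    rw [abs_mul, abs_of_pos hpi]; nlinarith
  rw [h2]
  have h0 := abs_nonneg q
  rcases le_total |q| (1 / 2) with h3 | h3
  · have h4 := Real.mul_le_sin (x := Real.pi * |q|) (by positivity) (by nlinarith)
    have h5 : 2 / Real.pi * (Real.pi * |q|) = 2 * |q| := by field_simp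
    linarith
  · have h4 := Real.mul_le_sin (x := Real.pi * (1 - |q|)) (by nlinarith) (by nlinarith)
    have h5 : 2 / Real.pi * (Real.pi * (1 - |q|)) = 2 * (1 - |q|) := by field_simp
    rw [show Real.pi * (1 - |q|) = Real.pi - Real.pi * |q| by ring, Real.sin_pi_sub] at h4
    linarith

/-! ### Cutoff functions -/

/-- A smooth cutoff to the left half line. -/
noncomputable def leftCut (z : ℝ) : ℝ := Real.smoothTransition (-2 - z)

/-- The difference of two left cutoffs at consecutive scales. -/
noncomputable def ringCut (j z : ℝ) : ℝ := leftCut z - leftCut ((z + j) / 2)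

/-- A smooth cutoff adapted to a neighbourhood of the support of `ringCut`. -/
noncomputable def fatCut (z : ℝ) : ℝ :=
  Real.smoothTransition (z + 8) * Real.smoothTransition (-1 - z)

lemma leftCut_one {z : ℝ} (h : z ≤ -3) : leftCut z = 1 :=
  Real.smoothTransition.one_of_one_le (by linarith)

lemma leftCut_zero {z : ℝ} (h : -2 ≤ z) : leftCut z = 0 :=
  Real.smoothTransition.zero_of_nonpos (by linarith)

lemma leftCut_nonneg (z : ℝ) : 0 ≤ leftCut z := Real.smoothTransition.nonneg _

lemma leftCut_le_one (z : ℝ) : leftCut z ≤ 1 := Real.smoothTransition.le_one _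

lemma contDiff_leftCut : ContDiff ℝ ((⊤ : ℕ∞) : WithTop ℕ∞) leftCut :=
  Real.smoothTransition.contDiff.comp (contDiff_const.sub contDiff_id)

@[fun_prop] lemma continuous_leftCut : Continuous leftCut := contDiff_leftCut.continuous

lemma contDiff_ringCut (j : ℝ) : ContDiff ℝ ((⊤ : ℕ∞) : WithTop ℕ∞) (ringCut j) :=
  contDiff_leftCut.sub (contDiff_leftCut.comp ((contDiff_id.add contDiff_const).div_const 2))

lemma abs_ringCut_le (j z : ℝ) : |ringCut j z| ≤ 1 := by
  have h1 := leftCut_nonneg z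
  have h2 := leftCut_le_one z
  have h3 := leftCut_nonneg ((z + j) / 2)
  have h4 := leftCut_le_one ((z + j) / 2)
  unfold ringCut
  rw [abs_le]; constructor <;> linarith

lemma ringCut_eq_zero {j z : ℝ} (h0 : 0 ≤ j) (h1 : j ≤ 1) (hz : z ≤ -7 ∨ -2 ≤ z) :
    ringCut j z = 0 := by
  unfold ringCut
  rcases hz with hz | hz
  · rw [leftCut_one (by linarith), leftCut_one (by linarith), sub_self]
  · rw [leftCut_zero (by linarith), leftCut_zero (by linarith), sub_self]

lemma contDiff_fatCut : ContDiff ℝ ((⊤ : ℕ∞) : WithTop ℕ∞) fatCut :=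
  (Real.smoothTransition.contDiff.comp (contDiff_id.add contDiff_const)).mul
    (Real.smoothTransition.contDiff.comp (contDiff_const.sub contDiff_id))

lemma fatCut_one {z : ℝ} (h1 : -7 ≤ z) (h2 : z ≤ -2) : fatCut z = 1 := by
  unfold fatCut
  rw [Real.smoothTransition.one_of_one_le (by linarith),
    Real.smoothTransition.one_of_one_le (by linarith), mul_one]

lemma fatCut_zero {z : ℝ} (hz : z ≤ -8 ∨ -1 ≤ z) : fatCut z = 0 := by
  unfold fatCut
  rcases hz with hz | hz
  · rw [Real.smoothTransition.zero_of_nonpos (by linarith), zero_mul]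
  · rw [Real.smoothTransition.zero_of_nonpos (x := -1 - z) (by linarith), mul_zero]

lemma hasCompactSupport_ringCut {j : ℝ} (h0 : 0 ≤ j) (h1 : j ≤ 1) :
    HasCompactSupport (fun z => (ringCut j z : ℂ)) := by
  refine HasCompactSupport.intro (isCompact_Icc (a := -7) (b := -2)) fun z hz => ?_
  rw [ringCut_eq_zero h0 h1, Complex.ofReal_zero]
  rw [Set.mem_Icc, not_and_or, not_le, not_le] at hz
  exact hz.imp le_of_lt le_of_lt

/-- The cutoff as a Schwartz function. -/
noncomputable def ringSchwartz (l : ℤ) : 𝓢(ℝ, ℂ) :=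
  (hasCompactSupport_ringCut (j := ((l % 2 : ℤ) : ℝ))
    (by exact_mod_cast Int.emod_nonneg l (by norm_num))
    (by have : l % 2 ≤ 1 := by omega
        exact_mod_cast this)).toSchwartzMap
      (Complex.ofRealCLM.contDiff.comp (contDiff_ringCut _))

lemma ringSchwartz_apply (l : ℤ) (z : ℝ) :
    ringSchwartz l z = (ringCut ((l % 2 : ℤ) : ℝ) z : ℂ) := rfl

lemma ringSchwartz_eq_zero (l : ℤ) {z : ℝ} (hz : z ≤ -7 ∨ -2 ≤ z) : ringSchwartz l z = 0 := by
  rw [ringSchwartz_apply, ringCut_eq_zero _ _ hz, Complex.ofReal_zero]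
  · exact_mod_cast Int.emod_nonneg l (by norm_num)
  · have : l % 2 ≤ 1 := by omega
    exact_mod_cast this

lemma ringSchwartz_mod (l : ℤ) : ringSchwartz l = ringSchwartz (l % 2) := by
  ext z; rw [ringSchwartz_apply, ringSchwartz_apply]; congr 3; omega

/-- A quantity bounded for every parity is bounded uniformly. -/
lemma exists_bound_of_parity {p : ℤ → ℝ → Prop} (hm : ∀ l a b, a ≤ b → p l a → p l b)
    (hp : ∀ l, p l = p (l % 2)) (h : ∀ l, ∃ a, p l a) : ∃ a, 1 ≤ a ∧ ∀ l, p l a := by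
  obtain ⟨a, ha⟩ := h 0
  obtain ⟨b, hb⟩ := h 1
  refine ⟨max 1 (max a b), le_max_left _ _, fun l => ?_⟩
  rw [hp]
  rcases Int.emod_two_eq_zero_or_one l with h | h
  · rw [h]; exact hm _ _ _ (by simp) ha
  · rw [h]; exact hm _ _ _ (by simp) hb

/-- The profile of the dual wave packets. -/
noncomputable def waveProfile (l : ℤ) (y : ℝ) : ℂ := 𝓕 (ringSchwartz l) (-(y / 8))

lemma waveProfile_eq (l : ℤ) (y : ℝ) :
    waveProfile l y = ∫ z, ringSchwartz l z * eChar (z * y / 8) := by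
  unfold waveProfile
  rw [SchwartzMap.fourier_coe, Real.fourier_eq']
  refine integral_congr_ae (Filter.Eventually.of_forall fun z => ?_)
  simp only [RCLike.inner_apply, conj_trivial, smul_eq_mul]
  rw [mul_comm]; congr 1
  unfold eChar; congr 1; push_cast; ring

lemma waveProfile_bound : ∃ A, 1 ≤ A ∧ ∀ l y, ‖waveProfile l y‖ ≤ A * ((1 + |y|) ^ 6)⁻¹ ∧
    ∃ d, HasDerivAt (waveProfile l) d y ∧ ‖d‖ ≤ A * ((1 + |y|) ^ 6)⁻¹ := by
  let F : ℤ → 𝓢(ℝ, ℂ) := fun l => 𝓕 (ringSchwartz l)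
  have key : ∀ f : 𝓢(ℝ, ℂ), ∃ A, ∀ y, ‖f (-(y / 8))‖ ≤ A * ((1 + |y|) ^ 6)⁻¹ := by
    intro f
    refine ⟨2 ^ 6 * (Finset.Iic (6, 0)).sup (fun m => SchwartzMap.seminorm ℝ m.1 m.2) f * 8 ^ 6,
      fun y => ?_⟩
    have h := SchwartzMap.one_add_le_sup_seminorm_apply (𝕜 := ℝ) (m := (6, 0)) (k := 6) (n := 0)
      le_rfl le_rfl f (-(y / 8))
    rw [norm_iteratedFDeriv_zero] at h
    have h1 : 0 < (1 + |y|) ^ 6 := by positivity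
    rw [← div_eq_mul_inv, le_div_iff₀ h1]
    have h2 : (1 + |y|) ^ 6 ≤ (1 + ‖-(y / 8)‖) ^ 6 * 8 ^ 6 := by
      rw [← mul_pow]
      have h3 : ‖-(y / 8)‖ = |y| / 8 := by rw [norm_neg, Real.norm_eq_abs, abs_div]; norm_num
      rw [h3]
      gcongr
      linarith [abs_nonneg y]
    calc _ ≤ ‖f (-(y / 8))‖ * ((1 + ‖-(y / 8)‖) ^ 6 * 8 ^ 6) := by gcongr
      _ = ((1 + ‖-(y / 8)‖) ^ 6 * ‖f (-(y / 8))‖) * 8 ^ 6 := by ring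
      _ ≤ _ := by gcongr
  refine exists_bound_of_parity (p := fun l A => ∀ y, ‖waveProfile l y‖ ≤ A * ((1 + |y|) ^ 6)⁻¹ ∧
    ∃ d, HasDerivAt (waveProfile l) d y ∧ ‖d‖ ≤ A * ((1 + |y|) ^ 6)⁻¹) ?_ ?_ ?_ |>.imp ?_
  · intro l a b hab h y
    have h1 : 0 < ((1 + |y|) ^ 6)⁻¹ := by positivity
    obtain ⟨h2, d, h3, h4⟩ := h y
    exact ⟨h2.trans (by gcongr), d, h3, h4.trans (by gcongr)⟩
  · intro l
    have : waveProfile l = waveProfile (l % 2) := by unfold waveProfile; rw [ringSchwartz_mod]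
    rw [this]
  · intro l
    obtain ⟨A1, h1⟩ := key (F l)
    obtain ⟨A2, h2⟩ := key (SchwartzMap.derivCLM ℂ ℂ (F l))
    refine ⟨max A1 A2, fun y => ?_⟩
    have h0 : 0 < ((1 + |y|) ^ 6)⁻¹ := by positivity
    refine ⟨(h1 y).trans (by gcongr; exact le_max_left _ _),
      deriv (F l) (-(y / 8)) * (-(1 / 8) : ℝ), ?_, ?_⟩
    · have h3 : HasDerivAt (F l) (deriv (F l) (-(y / 8))) (-(y / 8)) :=
        (SchwartzMap.differentiable _ _).hasDerivAt
      have h4 : HasDerivAt (fun y : ℝ => -(y / 8)) (-(1 / 8)) y := ((hasDerivAt_id y).div_const 8).neg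
      have h5 := h3.scomp y h4
      convert! h5 using 1
      rw [Complex.real_smul, mul_comm]
    · have h3 := h2 y
      rw [SchwartzMap.derivCLM_apply] at h3
      rw [norm_mul]
      have h4 : ‖((-(1 / 8) : ℝ) : ℂ)‖ ≤ 1 := by
        rw [Complex.norm_real]; norm_num
      calc _ ≤ ‖deriv (F l) (-(y / 8))‖ * 1 := by gcongr
        _ ≤ A2 * ((1 + |y|) ^ 6)⁻¹ := by rw [mul_one]; exact h3
        _ ≤ _ := by gcongr; exact le_max_right _ _
  · rintro a ⟨h1, h2⟩
    exact ⟨h1, fun l y => h2 l y⟩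

/-! ### The dual wave packets: decay, smoothness, cancellation -/

/-- The normalized position of `x` with respect to the tile `s`. -/
noncomputable def Tile.pos (s : Tile) (x : ℤ) : ℝ := ((x : ℝ) - s.m * 2 ^ s.k) / 2 ^ s.k

lemma Tile.dyWt_eq (s : Tile) (x : ℤ) : dyWt s.k s.m x = 1 + |s.pos x| := by
  unfold dyWt Tile.pos; rw [abs_div, abs_of_pos (show (0 : ℝ) < 2 ^ s.k by positivity)]

/-- The dual wave packets. -/
noncomputable def wave (s : Tile) (x : ℤ) : ℂ :=
  1 / 8 * eChar (s.l * s.pos x / 8) * waveProfile s.l (s.pos x)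

lemma wave_demod (s : Tile) (ξ : ℝ) (x : ℤ) :
    eChar (-(ξ * x / 8)) * wave s x = eChar (-(ξ * (s.m * 2 ^ s.k) / 8)) * (1 / 8) *
      (eChar ((s.l - ξ * 2 ^ s.k) / 8 * s.pos x) * waveProfile s.l (s.pos x)) := by
  have h : eChar (-(ξ * x / 8)) * eChar (s.l * s.pos x / 8) =
      eChar (-(ξ * (s.m * 2 ^ s.k) / 8)) * eChar ((s.l - ξ * 2 ^ s.k) / 8 * s.pos x) := by
    rw [← eChar_add, ← eChar_add]
    congr 1
    unfold Tile.pos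
    field_simp
    ring
  unfold wave
  calc _ = 1 / 8 * (eChar (-(ξ * x / 8)) * eChar (s.l * s.pos x / 8)) *
        waveProfile s.l (s.pos x) := by ring
    _ = _ := by rw [h]; ring

lemma Tile.LacFreq.abs_le {s : Tile} {ξ : ℝ} (h : s.LacFreq ξ) :
    -(3 / 2) ≤ s.l - ξ * 2 ^ s.k ∧ s.l - ξ * 2 ^ s.k ≤ 1 / 2 := by
  obtain ⟨h1, h2⟩ := h
  constructor <;> linarith

lemma wave_decay : ∃ B, 1 ≤ B ∧ ∀ s x, ‖wave s x‖ ≤ B * (dyWt s.k s.m x ^ 6)⁻¹ := by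
  obtain ⟨A, hA, h⟩ := waveProfile_bound
  refine ⟨A, hA, fun s x => ?_⟩
  have h1 := (h s.l (s.pos x)).1
  rw [s.dyWt_eq, wave, norm_mul, norm_mul, norm_eChar, mul_one]
  have h2 : ‖(1 / 8 : ℂ)‖ ≤ 1 := by norm_num
  calc _ ≤ 1 * ‖waveProfile s.l (s.pos x)‖ := by gcongr
    _ ≤ _ := by rw [one_mul]; exact h1

lemma wave_smooth : ∃ B, 1 ≤ B ∧ ∀ s ξ, s.LacFreq ξ → ∀ x y : ℤ, |(x : ℝ) - y| ≤ 2 ^ s.k →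
    ‖eChar (-(ξ * x / 8)) * wave s x - eChar (-(ξ * y / 8)) * wave s y‖ ≤
      B * (|(x : ℝ) - y| / 2 ^ s.k) * (dyWt s.k s.m x ^ 2)⁻¹ := by
  obtain ⟨A, hA, h⟩ := waveProfile_bound
  refine ⟨2 * A, by linarith, fun s ξ hξ x y hxy => ?_⟩
  rw [wave_demod, wave_demod, ← mul_sub, norm_mul, norm_mul, norm_eChar, one_mul, s.dyWt_eq]
  obtain ⟨hb1, hb2⟩ := hξ.abs_le
  set β := s.l - ξ * 2 ^ s.k
  set X := s.pos x
  set Y := s.pos y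
  have hp : (0 : ℝ) < 2 ^ s.k := by positivity
  have hXY : |X - Y| = |(x : ℝ) - y| / 2 ^ s.k := by
    nth_rewrite 1 [← abs_of_pos hp]
    rw [← abs_div]; congr 1
    simp only [X, Y, Tile.pos]; ring
  have hXY1 : |X - Y| ≤ 1 := by rw [hXY]; exact div_le_one_of_le₀ hxy hp.le
  rw [← hXY]
  have hX : 0 < 1 + |X| := by positivity
  choose hφ φ' hd hφ' using h s.l
  have hder : ∀ z, HasDerivAt (fun z => eChar (β / 8 * z) * waveProfile s.l z)
      ((2 * Real.pi * (β / 8) : ℝ) * Complex.I * eChar (β / 8 * z) * waveProfile s.l z +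
        eChar (β / 8 * z) * φ' z) z := fun z => (hasDerivAt_eChar_mul _ z).mul (hd z)
  have hbound : ∀ z ∈ Set.uIcc Y X, ‖(2 * Real.pi * (β / 8) : ℝ) * Complex.I * eChar (β / 8 * z) *
      waveProfile s.l z + eChar (β / 8 * z) * φ' z‖ ≤ 12 * A * ((1 + |X|) ^ 2)⁻¹ := by
    intro z hz
    have hz1 : |X - z| ≤ 1 := by
      refine le_trans ?_ hXY1
      exact Set.abs_sub_left_of_mem_uIcc (Set.uIcc_comm Y X ▸ hz) |>.trans (abs_sub_comm _ _).le
        |> fun h => by rwa [abs_sub_comm X z]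
    have hz2 : 1 + |X| ≤ 2 * (1 + |z|) := by
      have h1 := abs_sub_abs_le_abs_sub X z
      have := abs_nonneg z
      linarith
    have hz3 : ((1 + |z|) ^ 6)⁻¹ ≤ 4 * ((1 + |X|) ^ 2)⁻¹ := by
      have h1 : ((1 + |z|) ^ 6)⁻¹ ≤ ((1 + |z|) ^ 2)⁻¹ := by
        gcongr <;> linarith [abs_nonneg z]
      have h2 : (1 + |X|) ^ 2 ≤ (2 * (1 + |z|)) ^ 2 := by gcongr
      refine h1.trans ?_
      rw [← div_eq_mul_inv, le_div_iff₀ (by positivity), inv_mul_le_iff₀ (by positivity)]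
      nlinarith
    have hc : ‖((2 * Real.pi * (β / 8) : ℝ) : ℂ)‖ ≤ 2 := by
      rw [Complex.norm_real, Real.norm_eq_abs, abs_mul, abs_of_pos (by positivity : 0 < 2 * Real.pi)]
      have h1 : |β / 8| ≤ 3 / 16 := by rw [abs_le]; constructor <;> linarith
      have := Real.pi_lt_four
      have := Real.pi_pos
      nlinarith [abs_nonneg (β / 8)]
    refine (norm_add_le _ _).trans ?_
    rw [norm_mul, norm_mul, norm_mul, norm_mul, norm_eChar, Complex.norm_I, mul_one, mul_one, one_mul]
    calc _ ≤ 2 * (A * ((1 + |z|) ^ 6)⁻¹) + A * ((1 + |z|) ^ 6)⁻¹ := by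
          gcongr
          · exact hφ z
          · exact hφ' z
      _ = 3 * A * ((1 + |z|) ^ 6)⁻¹ := by ring
      _ ≤ 3 * A * (4 * ((1 + |X|) ^ 2)⁻¹) := by gcongr
      _ = _ := by ring
  have hmain := (convex_uIcc Y X).norm_image_sub_le_of_norm_hasDerivWithin_le
    (fun z _ => (hder z).hasDerivWithinAt) hbound Set.left_mem_uIcc Set.right_mem_uIcc
  rw [Real.norm_eq_abs] at hmain
  have h8 : ‖(1 / 8 : ℂ)‖ = 1 / 8 := by norm_num
  rw [h8]
  have : 0 ≤ |X - Y| * ((1 + |X|) ^ 2)⁻¹ := by positivity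
  nlinarith

/-- Integration by parts twice against a character. -/
lemma exists_osc_decay (f : 𝓢(ℝ, ℂ)) {p q : ℝ} (hpq : p ≤ q) (hf : ∀ z, z ≤ p ∨ q ≤ z → f z = 0) :
    ∃ A, 0 ≤ A ∧ ∀ (h h1 h2 : ℝ → ℂ), (∀ z ∈ Set.Icc p q, HasDerivAt h (h1 z) z) →
      (∀ z ∈ Set.Icc p q, HasDerivAt h1 (h2 z) z) → ContinuousOn h2 (Set.Icc p q) → ∀ Q,
      (∀ z ∈ Set.Icc p q, ‖h z‖ ≤ Q ∧ ‖h1 z‖ ≤ Q ∧ ‖h2 z‖ ≤ Q) → ∀ Y : ℝ,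
      ‖∫ z in p..q, f z * h z * eChar (Y / 8 * z)‖ ≤ A * Q * ((1 + |Y|) ^ 2)⁻¹ := by
  set f1 : 𝓢(ℝ, ℂ) := SchwartzMap.derivCLM ℂ ℂ f with hf1
  set f2 : 𝓢(ℝ, ℂ) := SchwartzMap.derivCLM ℂ ℂ f1 with hf2
  have d1 : ∀ z, HasDerivAt f (f1 z) z := fun z => by
    rw [hf1, SchwartzMap.derivCLM_apply]; exact (f.differentiable z).hasDerivAt
  have d2 : ∀ z, HasDerivAt f1 (f2 z) z := fun z => by
    rw [hf2, SchwartzMap.derivCLM_apply]; exact (f1.differentiable z).hasDerivAt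
  have f1p : f1 p = 0 := by
    refine (uniqueDiffOn_Iic p p Set.self_mem_Iic).eq_deriv _ (d1 p).hasDerivWithinAt
      ((hasDerivWithinAt_const p (Set.Iic p) (0 : ℂ)).congr (fun z hz => hf z (Or.inl hz))
        (hf p (Or.inl le_rfl)))
  have f1q : f1 q = 0 := by
    refine (uniqueDiffOn_Ici q q Set.self_mem_Ici).eq_deriv _ (d1 q).hasDerivWithinAt
      ((hasDerivWithinAt_const q (Set.Ici q) (0 : ℂ)).congr (fun z hz => hf z (Or.inr hz))
        (hf q (Or.inr le_rfl)))
  obtain ⟨C, hC⟩ : ∃ C, ∀ z, ‖f z‖ ≤ C ∧ ‖f1 z‖ ≤ C ∧ ‖f2 z‖ ≤ C := by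
    have hb : ∀ g : 𝓢(ℝ, ℂ), ∀ z, ‖g z‖ ≤ SchwartzMap.seminorm ℝ 0 0 g :=
      fun g z => g.norm_le_seminorm ℝ z
    exact ⟨max (SchwartzMap.seminorm ℝ 0 0 f) (max (SchwartzMap.seminorm ℝ 0 0 f1)
      (SchwartzMap.seminorm ℝ 0 0 f2)), fun z => ⟨(hb f z).trans (le_max_left _ _),
      (hb f1 z).trans ((le_max_left _ _).trans (le_max_right _ _)),
      (hb f2 z).trans ((le_max_right _ _).trans (le_max_right _ _))⟩⟩
  have hC0 : 0 ≤ C := (norm_nonneg _).trans (hC 0).1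
  refine ⟨18 * (C * (q - p)), by have := sub_nonneg.2 hpq; positivity,
    fun h h1 h2 hh1 hh2 hc Q hQ Y => ?_⟩
  have hQ0 : 0 ≤ Q := (norm_nonneg _).trans (hQ p ⟨le_rfl, hpq⟩).1
  have hu : Set.uIcc p q = Set.Icc p q := Set.uIcc_of_le hpq
  have hh : ContinuousOn h (Set.Icc p q) := fun z hz => (hh1 z hz).continuousAt.continuousWithinAt
  have hhc : ContinuousOn h1 (Set.Icc p q) := fun z hz => (hh2 z hz).continuousAt.continuousWithinAt
  have hfc := f.continuous
  have hf1c := f1.continuous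
  have hf2c := f2.continuous
  have c1 : ContinuousOn (fun z => f1 z * h z + f z * h1 z) (Set.Icc p q) := by fun_prop
  have c2 : ContinuousOn (fun z => f2 z * h z + f1 z * h1 z + (f1 z * h1 z + f z * h2 z))
    (Set.Icc p q) := by fun_prop
  have e1 : ∀ z ∈ Set.uIcc p q, HasDerivAt (fun z => f z * h z) (f1 z * h z + f z * h1 z) z :=
    fun z hz => (d1 z).mul (hh1 z (hu ▸ hz))
  have e2 : ∀ z ∈ Set.uIcc p q, HasDerivAt (fun z => f1 z * h z + f z * h1 z)
      (f2 z * h z + f1 z * h1 z + (f1 z * h1 z + f z * h2 z)) z :=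
    fun z hz => ((d2 z).mul (hh1 z (hu ▸ hz))).add ((d1 z).mul (hh2 z (hu ▸ hz)))
  set κ : ℂ := (2 * Real.pi * (Y / 8) : ℝ) * Complex.I with hκ
  have e3 : ∀ z ∈ Set.uIcc p q, HasDerivAt (fun z : ℝ => eChar (Y / 8 * z))
      (κ * eChar (Y / 8 * z)) z := fun z _ => hasDerivAt_eChar_mul _ z
  have i3 : IntervalIntegrable (fun z => κ * eChar (Y / 8 * z)) volume p q :=
    Continuous.intervalIntegrable (by fun_prop) _ _
  have p1 := intervalIntegral.integral_mul_deriv_eq_deriv_mul e1 e3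
    (ContinuousOn.intervalIntegrable (hu ▸ c1)) i3
  have p2 := intervalIntegral.integral_mul_deriv_eq_deriv_mul e2 e3
    (ContinuousOn.intervalIntegrable (hu ▸ c2)) i3
  simp only [hf p (Or.inl le_rfl), hf q (Or.inr le_rfl), f1p, f1q, zero_mul, add_zero, sub_zero,
    zero_sub] at p1 p2
  set I := ∫ z in p..q, f z * h z * eChar (Y / 8 * z)
  have hI : κ ^ 2 * I = ∫ z in p..q, (f2 z * h z + f1 z * h1 z + (f1 z * h1 z + f z * h2 z)) *
      eChar (Y / 8 * z) := by
    have q1 : κ * I = ∫ z in p..q, f z * h z * (κ * eChar (Y / 8 * z)) := by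
      rw [← intervalIntegral.integral_const_mul]; congr 1; ext z; ring
    have q2 : κ * ∫ z in p..q, (f1 z * h z + f z * h1 z) * eChar (Y / 8 * z) =
        ∫ z in p..q, (f1 z * h z + f z * h1 z) * (κ * eChar (Y / 8 * z)) := by
      rw [← intervalIntegral.integral_const_mul]; congr 1; ext z; ring
    rw [pow_two, mul_assoc, q1, p1, mul_neg, q2, p2, neg_neg]
  have b1 : ‖I‖ ≤ C * Q * (q - p) := by
    rw [← abs_of_nonneg (sub_nonneg.2 hpq)]
    refine intervalIntegral.norm_integral_le_of_norm_le_const fun z hz => ?_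
    have hz' : z ∈ Set.Icc p q := by
      rw [Set.uIoc_of_le hpq] at hz; exact Set.Ioc_subset_Icc_self hz
    rw [norm_mul, norm_mul, norm_eChar, mul_one]
    exact mul_le_mul (hC z).1 (hQ z hz').1 (norm_nonneg _) hC0
  have b2 : ‖κ ^ 2 * I‖ ≤ 4 * (C * Q) * (q - p) := by
    rw [hI, ← abs_of_nonneg (sub_nonneg.2 hpq)]
    refine intervalIntegral.norm_integral_le_of_norm_le_const fun z hz => ?_
    have hz' : z ∈ Set.Icc p q := by
      rw [Set.uIoc_of_le hpq] at hz; exact Set.Ioc_subset_Icc_self hz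
    rw [norm_mul, norm_eChar, mul_one]
    obtain ⟨k0, k1, k2⟩ := hC z
    obtain ⟨l0, l1, l2⟩ := hQ z hz'
    have m1 : ‖f2 z * h z‖ ≤ C * Q := by
      rw [norm_mul]; exact mul_le_mul k2 l0 (norm_nonneg _) hC0
    have m2 : ‖f1 z * h1 z‖ ≤ C * Q := by
      rw [norm_mul]; exact mul_le_mul k1 l1 (norm_nonneg _) hC0
    have m3 : ‖f z * h2 z‖ ≤ C * Q := by
      rw [norm_mul]; exact mul_le_mul k0 l2 (norm_nonneg _) hC0
    have n1 := norm_add_le (f2 z * h z + f1 z * h1 z) (f1 z * h1 z + f z * h2 z)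
    have n2 := norm_add_le (f2 z * h z) (f1 z * h1 z)
    have n3 := norm_add_le (f1 z * h1 z) (f z * h2 z)
    linarith
  have b3 : Y ^ 2 / 2 ≤ ‖κ ^ 2‖ := by
    have : ‖κ‖ = 2 * Real.pi * (|Y| / 8) := by
      rw [hκ, norm_mul, Complex.norm_I, Complex.norm_real, Real.norm_eq_abs, abs_mul, abs_div,
        abs_of_pos (by positivity : 0 < 2 * Real.pi)]; norm_num
    rw [norm_pow, this, ← sq_abs Y]
    have h3 := Real.pi_gt_three
    have h4 : 9 ≤ Real.pi ^ 2 := by nlinarith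
    have h5 : 0 ≤ |Y| ^ 2 := by positivity
    nlinarith
  rw [norm_mul] at b2
  rw [← div_eq_mul_inv, le_div_iff₀ (by positivity)]
  have h6 : (1 + |Y|) ^ 2 ≤ 2 + 2 * Y ^ 2 := by rw [← sq_abs Y]; nlinarith [sq_nonneg (1 - |Y|)]
  have h7 := norm_nonneg I
  have h8 : Y ^ 2 / 2 * ‖I‖ ≤ 4 * (C * Q) * (q - p) := le_trans (by gcongr) b2
  have h9 : 0 ≤ C * Q * (q - p) := h7.trans b1
  nlinarith

lemma waveProfile_eq_interval (l : ℤ) (y : ℝ) :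
    waveProfile l y = ∫ z in (-7 : ℝ)..(-2), ringSchwartz l z * eChar (z * y / 8) := by
  rw [waveProfile_eq, intervalIntegral.integral_of_le (by norm_num), ← integral_indicator
    measurableSet_Ioc]
  refine integral_congr_ae (Filter.Eventually.of_forall fun z => ?_)
  by_cases hz : z ∈ Set.Ioc (-7 : ℝ) (-2)
  · rw [Set.indicator_of_mem hz]
  · rw [Set.indicator_of_notMem hz]
    rw [Set.mem_Ioc, not_and_or, not_lt, not_le] at hz
    simp only [ringSchwartz_eq_zero l (hz.imp id le_of_lt), zero_mul]

/-- The resolvent `u / (eChar (u (z + β) / 8) - 1)` and its derivatives. -/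
lemma resolvent_bounds {u β z : ℝ} (hu : 0 < u) (hu1 : u ≤ 1 / 2) (hβ : -(3 / 2) ≤ β)
    (hβ' : β ≤ 1 / 2) (hz : z ∈ Set.Icc (-7 : ℝ) (-2)) :
    eChar (u * (z + β) / 8) - 1 ≠ 0 ∧ ‖(eChar (u * (z + β) / 8) - 1)⁻¹‖ ≤ 3 / u := by
  obtain ⟨h1, h2⟩ := hz
  have h3 : |u * (z + β) / 8| = u * -(z + β) / 8 := by
    rw [abs_of_nonpos] <;> nlinarith
  have h4 := norm_eChar_sub_one_ge (q := u * (z + β) / 8) (by rw [h3]; nlinarith)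
  rw [h3] at h4
  have h5 : u / 3 ≤ ‖eChar (u * (z + β) / 8) - 1‖ := by nlinarith
  refine ⟨fun h => ?_, ?_⟩
  · rw [h, norm_zero] at h5; linarith
  · rw [norm_inv, show 3 / u = (u / 3)⁻¹ by rw [inv_div]]
    gcongr

lemma exists_resolvent_decay (l : ℤ) : ∃ A, 0 ≤ A ∧ ∀ u : ℝ, 0 < u → u ≤ 1 / 2 → ∀ β : ℝ,
    -(3 / 2) ≤ β → β ≤ 1 / 2 → ∀ Y : ℝ,
    ‖∫ z in (-7 : ℝ)..(-2), ringSchwartz l z * (eChar (u * (z + β) / 8) - 1)⁻¹ *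
      eChar (Y / 8 * z)‖ ≤ A * (100 / u) * ((1 + |Y|) ^ 2)⁻¹ := by
  obtain ⟨A, hA, h⟩ := exists_osc_decay (ringSchwartz l) (show (-7 : ℝ) ≤ -2 by norm_num)
    (fun z hz => ringSchwartz_eq_zero l hz)
  refine ⟨A, hA, fun u hu hu1 β hβ hβ' Y => ?_⟩
  set T : ℝ → ℂ := fun z => (eChar (u * (z + β) / 8) - 1)⁻¹ with hT
  set κ : ℂ := (2 * Real.pi * (u / 8) : ℝ) * Complex.I with hκ
  have hne : ∀ z ∈ Set.Icc (-7 : ℝ) (-2), eChar (u * (z + β) / 8) - 1 ≠ 0 ∧ ‖T z‖ ≤ 3 / u :=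
    fun z hz => resolvent_bounds hu hu1 hβ hβ' hz
  have d1 : ∀ z ∈ Set.Icc (-7 : ℝ) (-2), HasDerivAt T (-κ * (T z + T z ^ 2)) z := by
    intro z hz
    have h0 := (hne z hz).1
    have h1 : HasDerivAt (fun z : ℝ => eChar (u * (z + β) / 8)) (κ * eChar (u * (z + β) / 8)) z := by
      have e : (fun z : ℝ => eChar (u * (z + β) / 8)) =
          fun z => eChar (u * β / 8) * eChar (u / 8 * z) := by
        ext z; rw [← eChar_add]; congr 1; ring
      rw [e]
      have h2 := (hasDerivAt_eChar_mul (u / 8) z).const_mul (eChar (u * β / 8))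
      convert! h2 using 1
      rw [show u * (z + β) / 8 = u * β / 8 + u / 8 * z by ring, eChar_add]
      ring
    have h2 := (h1.sub_const 1).inv h0
    convert! h2 using 1
    simp only [hT]
    field_simp
    ring
  have d2 : ∀ z ∈ Set.Icc (-7 : ℝ) (-2), HasDerivAt (fun z => -κ * (T z + T z ^ 2))
      (κ ^ 2 * ((1 + 2 * T z) * (T z + T z ^ 2))) z := by
    intro z hz
    have h1 := d1 z hz
    have h2 := (h1.add (h1.pow 2)).const_mul (-κ)
    convert! h2 using 1
    push_cast
    ring
  have hTc : ContinuousOn T (Set.Icc (-7) (-2)) := fun z hz =>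
    (d1 z hz).continuousAt.continuousWithinAt
  have hκn : ‖κ‖ ≤ u := by
    rw [hκ, norm_mul, Complex.norm_I, Complex.norm_real, Real.norm_eq_abs, mul_one,
      abs_of_pos (by positivity)]
    have := Real.pi_lt_four
    nlinarith
  refine h T (fun z => -κ * (T z + T z ^ 2)) (fun z => κ ^ 2 * ((1 + 2 * T z) * (T z + T z ^ 2)))
    d1 d2 (by fun_prop) (100 / u) (fun z hz => ?_) Y
  obtain ⟨-, hTz⟩ := hne z hz
  set a := ‖T z‖
  have ha : 0 ≤ a := norm_nonneg _
  have hau : a * u ≤ 3 := by rwa [le_div_iff₀ hu] at hTz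
  have n1 : ‖T z + T z ^ 2‖ ≤ a + a ^ 2 := (norm_add_le _ _).trans (by rw [norm_pow])
  have n2 : ‖1 + 2 * T z‖ ≤ 1 + 2 * a := (norm_add_le _ _).trans (by simp [a])
  have m1 : (a + a ^ 2) * u * u ≤ 11 := by nlinarith [mul_nonneg ha hu.le]
  refine ⟨?_, ?_, ?_⟩
  · rw [le_div_iff₀ hu]; linarith
  · rw [le_div_iff₀ hu, norm_mul, norm_neg]
    calc ‖κ‖ * ‖T z + T z ^ 2‖ * u ≤ u * (a + a ^ 2) * u := by gcongr
      _ ≤ 100 := by nlinarith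
  · rw [le_div_iff₀ hu, norm_mul, norm_mul, norm_pow]
    calc ‖κ‖ ^ 2 * (‖1 + 2 * T z‖ * ‖T z + T z ^ 2‖) * u ≤
          u ^ 2 * ((1 + 2 * a) * (a + a ^ 2)) * u := by gcongr
      _ = ((1 + 2 * a) * u) * ((a + a ^ 2) * u * u) := by ring
      _ ≤ 7 * 11 := by gcongr; nlinarith
      _ ≤ 100 := by norm_num

lemma wave_cancel : ∃ B, 1 ≤ B ∧ ∀ s ξ, 1 ≤ s.k → s.LacFreq ξ → ∀ a b : ℤ, a ≤ b →
    ‖∑ y ∈ Finset.Ico a b, eChar (-(ξ * y / 8)) * wave s y‖ ≤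
      B * 2 ^ s.k * ((dyWt s.k s.m a ^ 2)⁻¹ + (dyWt s.k s.m b ^ 2)⁻¹) := by
  obtain ⟨A, hA, h⟩ := exists_bound_of_parity (p := fun l A => 0 ≤ A ∧ ∀ u : ℝ, 0 < u → u ≤ 1 / 2 →
    ∀ β : ℝ, -(3 / 2) ≤ β → β ≤ 1 / 2 → ∀ Y : ℝ,
    ‖∫ z in (-7 : ℝ)..(-2), ringSchwartz l z * (eChar (u * (z + β) / 8) - 1)⁻¹ *
      eChar (Y / 8 * z)‖ ≤ A * (100 / u) * ((1 + |Y|) ^ 2)⁻¹)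
    (fun l a b hab ha => ⟨ha.1.trans hab, fun u hu hu1 β hβ hβ' Y =>
      (ha.2 u hu hu1 β hβ hβ' Y).trans (by gcongr)⟩)
    (fun l => by rw [ringSchwartz_mod]) exists_resolvent_decay
  refine ⟨100 * A, by linarith, fun s ξ hk hξ a b hab => ?_⟩
  obtain ⟨hb1, hb2⟩ := hξ.abs_le
  set β := s.l - ξ * 2 ^ s.k with hβ
  set u : ℝ := (2 ^ s.k)⁻¹ with hu
  have hp : (0 : ℝ) < 2 ^ s.k := by positivity
  have hu0 : 0 < u := by positivity
  have hu1 : u ≤ 1 / 2 := by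
    rw [hu, one_div]
    have : (2 : ℝ) ^ 1 ≤ 2 ^ s.k := pow_le_pow_right₀ (by norm_num) hk
    gcongr; linarith
  set J : ℝ → ℂ := fun Y => ∫ z in (-7 : ℝ)..(-2), ringSchwartz s.l z *
    (eChar (u * (z + β) / 8) - 1)⁻¹ * eChar (Y / 8 * z) with hJ
  set σ : ℝ → ℂ := fun Y => eChar (β / 8 * Y) * J Y with hσ
  have hrc := (ringSchwartz s.l).continuous
  have hTc : ContinuousOn (fun z => (eChar (u * (z + β) / 8) - 1)⁻¹) (Set.uIcc (-7 : ℝ) (-2)) := by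
    rw [Set.uIcc_of_le (by norm_num)]
    exact ContinuousOn.inv₀ (by fun_prop)
      fun z hz => (resolvent_bounds hu0 hu1 hb1 hb2 hz).1
  have step : ∀ Y, σ (Y + u) - σ Y = eChar (β / 8 * Y) * waveProfile s.l Y := by
    intro Y
    have e1 : σ (Y + u) = eChar (β / 8 * Y) * ∫ z in (-7 : ℝ)..(-2), ringSchwartz s.l z *
        (eChar (u * (z + β) / 8) - 1)⁻¹ * (eChar (u * (z + β) / 8) * eChar (Y / 8 * z)) := by
      simp only [hσ, hJ]
      rw [mul_add, eChar_add, mul_assoc, ← intervalIntegral.integral_const_mul]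
      congr 2
      ext z
      rw [show (Y + u) / 8 * z = Y / 8 * z + u / 8 * z by ring,
        show u * (z + β) / 8 = β / 8 * u + u / 8 * z by ring, eChar_add, eChar_add]
      ring
    rw [e1]
    simp only [hσ, hJ]
    rw [← mul_sub, ← intervalIntegral.integral_sub (ContinuousOn.intervalIntegrable (by fun_prop))
      (ContinuousOn.intervalIntegrable (by fun_prop)), waveProfile_eq_interval]
    congr 1
    refine intervalIntegral.integral_congr fun z hz => ?_
    rw [Set.uIcc_of_le (by norm_num)] at hz
    have h0 := (resolvent_bounds hu0 hu1 hb1 hb2 hz).1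
    rw [show z * Y / 8 = Y / 8 * z by ring]
    field_simp
  have hpos : ∀ y : ℤ, s.pos (y + 1) = s.pos y + u := by
    intro y; unfold Tile.pos; rw [hu]; push_cast; field_simp; ring
  have tele : ∀ b : ℤ, a ≤ b → ∑ y ∈ Finset.Ico a b, eChar (-(ξ * y / 8)) * wave s y =
      eChar (-(ξ * (s.m * 2 ^ s.k) / 8)) * (1 / 8) * (σ (s.pos b) - σ (s.pos a)) := by
    intro b hab
    induction b, hab using Int.leInduction with
    | base => simp
    | succ b hab ih =>
      rw [← Finset.insert_Ico_right_eq_Ico_add_one hab, Finset.sum_insert (by simp), ih, wave_demod,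
        ← step, hpos]
      ring
  rw [tele b hab, norm_mul, norm_mul, norm_eChar, one_mul, s.dyWt_eq, s.dyWt_eq]
  have hJb : ∀ Y, ‖σ Y‖ ≤ A * (100 / u) * ((1 + |Y|) ^ 2)⁻¹ := fun Y => by
    simp only [hσ]
    rw [norm_mul, norm_eChar, one_mul]
    exact (h s.l).2 u hu0 hu1 β hb1 hb2 Y
  have h8 : ‖(1 / 8 : ℂ)‖ ≤ 1 := by norm_num
  calc _ ≤ 1 * (‖σ (s.pos b)‖ + ‖σ (s.pos a)‖) := by gcongr; exact norm_sub_le _ _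
    _ ≤ 1 * (A * (100 / u) * ((1 + |s.pos b|) ^ 2)⁻¹ + A * (100 / u) * ((1 + |s.pos a|) ^ 2)⁻¹) := by
      gcongr
      · exact hJb _
      · exact hJb _
    _ = _ := by rw [hu, div_inv_eq_mul]; ring

/-! ### Bessel's inequality for lacunary families -/

lemma integral_eChar {L : ℝ} (hL : 0 < L) (a : ℝ) (n : ℤ) :
    ∫ t in a..(a + L), eChar (n / L * t) = if n = 0 then (L : ℂ) else 0 := by
  split_ifs with h
  · simp [h]
  · have hn : (n : ℝ) ≠ 0 := by exact_mod_cast h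
    set κ : ℂ := (2 * Real.pi * (n / L) : ℝ) * Complex.I with hκ
    have hκ0 : κ ≠ 0 := by
      rw [hκ]
      refine mul_ne_zero (Complex.ofReal_ne_zero.2 ?_) Complex.I_ne_zero
      have := Real.pi_pos
      positivity
    have h1 : ∀ t ∈ Set.uIcc a (a + L), HasDerivAt (fun t : ℝ => κ⁻¹ * eChar (n / L * t))
        (eChar (n / L * t)) t := fun t _ => by
      have h2 := (hasDerivAt_eChar_mul (n / L) t).const_mul κ⁻¹
      convert! h2 using 1
      rw [← hκ, ← mul_assoc, inv_mul_cancel₀ hκ0, one_mul]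
    rw [intervalIntegral.integral_eq_sub_of_hasDerivAt h1
      (Continuous.intervalIntegrable (by fun_prop) _ _)]
    rw [show (n : ℝ) / L * (a + L) = n / L * a + n by field_simp, eChar_add, eChar_int, mul_one,
      sub_self]

lemma ofReal_norm_sq (z : ℂ) : ((‖z‖ ^ 2 : ℝ) : ℂ) = (starRingEnd ℂ) z * z := by
  rw [Complex.conj_mul', Complex.ofReal_pow]

lemma integral_norm_sq_trig {ι : Type*} {L : ℝ} (hL : 0 < L) (a : ℝ) (F : Finset ι) (n : ι → ℤ)
    (hn : Set.InjOn n F) (α : ι → ℂ) :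
    ∫ t in a..(a + L), ‖∑ i ∈ F, α i * eChar (n i / L * t)‖ ^ 2 = L * ∑ i ∈ F, ‖α i‖ ^ 2 := by
  classical
  apply Complex.ofReal_injective
  rw [← intervalIntegral.integral_ofReal]
  have h1 : ∀ t : ℝ, ((‖∑ i ∈ F, α i * eChar (n i / L * t)‖ ^ 2 : ℝ) : ℂ) =
      ∑ i ∈ F, ∑ j ∈ F, (starRingEnd ℂ) (α i) * α j * eChar (((n j - n i : ℤ) : ℝ) / L * t) := by
    intro t
    rw [ofReal_norm_sq, map_sum, Finset.sum_mul_sum]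
    refine Finset.sum_congr rfl fun i _ => Finset.sum_congr rfl fun j _ => ?_
    rw [map_mul, conj_eChar]
    push_cast
    rw [show ((n j : ℝ) - n i) / L * t = -(n i / L * t) + n j / L * t by ring, eChar_add]
    ring
  simp_rw [h1]
  rw [intervalIntegral.integral_finsetSum fun i _ =>
    Continuous.intervalIntegrable (by fun_prop) _ _]
  rw [Complex.ofReal_mul, Complex.ofReal_sum, Finset.mul_sum]
  refine Finset.sum_congr rfl fun i hi => ?_
  rw [intervalIntegral.integral_finsetSum fun j _ =>
    Continuous.intervalIntegrable (by fun_prop) _ _]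
  simp_rw [intervalIntegral.integral_const_mul, integral_eChar hL]
  rw [Finset.sum_eq_single_of_mem i hi]
  · rw [sub_self, if_pos rfl, Complex.conj_mul', Complex.ofReal_pow]; ring
  · intro j hj hji
    rw [if_neg, mul_zero]
    intro h0
    exact hji (hn hj hi (by omega))

lemma bessel_continuous {L : ℝ} (hL : 0 < L) (a : ℝ) {f : ℝ → ℂ} (hf : Continuous f)
    (X : Finset ℤ) :
    ∑ x ∈ X, ‖∫ t in a..(a + L), f t * eChar (x / L * t)‖ ^ 2 ≤
      L * ∫ t in a..(a + L), ‖f t‖ ^ 2 := by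
  set c : ℤ → ℂ := fun x => ∫ t in a..(a + L), f t * eChar (x / L * t) with hc
  set S := ∑ x ∈ X, ‖c x‖ ^ 2 with hS
  set P : ℝ → ℂ := fun t => ∑ x ∈ X, c x * eChar (((-x : ℤ) : ℝ) / L * t) with hP
  have hPc : Continuous P := by simp only [hP]; fun_prop
  have h0 : 0 ≤ ∫ t in a..(a + L), ‖f t - (L⁻¹ : ℝ) * P t‖ ^ 2 :=
    intervalIntegral.integral_nonneg (by linarith) fun t _ => by positivity
  have h1 : ∫ t in a..(a + L), ‖P t‖ ^ 2 = L * S :=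
    integral_norm_sq_trig hL a X (fun x => -x) (fun x _ y _ h => by simpa using h) c
  have h2 : ∫ t in a..(a + L), (starRingEnd ℂ) (P t) * f t = (S : ℂ) := by
    have : ∀ t, (starRingEnd ℂ) (P t) * f t =
        ∑ x ∈ X, (starRingEnd ℂ) (c x) * (f t * eChar (x / L * t)) := by
      intro t
      simp only [hP]
      rw [map_sum, Finset.sum_mul]
      refine Finset.sum_congr rfl fun x _ => ?_
      rw [map_mul, conj_eChar]
      push_cast
      rw [show -(-(x : ℝ) / L * t) = x / L * t by ring]
      ring
    simp_rw [this]
    rw [intervalIntegral.integral_finsetSum fun i _ =>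
      Continuous.intervalIntegrable (by fun_prop) _ _]
    simp_rw [intervalIntegral.integral_const_mul]
    rw [hS]
    push_cast
    refine Finset.sum_congr rfl fun x _ => ?_
    rw [← Complex.conj_mul']
  have h3 : ∫ t in a..(a + L), ((starRingEnd ℂ) (P t) * f t).re = S := by
    have := intervalIntegral.intervalIntegral_re (𝕜 := ℂ) (μ := volume) (a := a) (b := a + L)
      (f := fun t => (starRingEnd ℂ) (P t) * f t)
      (Continuous.intervalIntegrable (by fun_prop) _ _)
    simp only [RCLike.re_to_complex] at this
    rw [this, h2, Complex.ofReal_re]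
  have h4 : ∀ t, ‖f t - (L⁻¹ : ℝ) * P t‖ ^ 2 =
      ‖f t‖ ^ 2 - 2 * L⁻¹ * ((starRingEnd ℂ) (P t) * f t).re + (L⁻¹) ^ 2 * ‖P t‖ ^ 2 := by
    intro t
    simp only [← Complex.normSq_eq_norm_sq, Complex.normSq_apply, Complex.sub_re, Complex.sub_im,
      Complex.mul_re, Complex.mul_im, Complex.ofReal_re, Complex.ofReal_im, Complex.conj_re,
      Complex.conj_im]
    ring
  simp_rw [h4] at h0
  rw [intervalIntegral.integral_add (Continuous.intervalIntegrable (by fun_prop) _ _)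
    (Continuous.intervalIntegrable (by fun_prop) _ _), intervalIntegral.integral_sub
    (Continuous.intervalIntegrable (by fun_prop) _ _)
    (Continuous.intervalIntegrable (by fun_prop) _ _), intervalIntegral.integral_const_mul,
    intervalIntegral.integral_const_mul, h1, h3] at h0
  have h5 : (L⁻¹) ^ 2 * (L * S) = L⁻¹ * S := by field_simp
  rw [h5] at h0
  have h6 : L⁻¹ * S ≤ ∫ t in a..(a + L), ‖f t‖ ^ 2 := by linarith
  rwa [inv_mul_le_iff₀ hL] at h6

/-- The multiplier piece attached to a tile, modulated. -/
noncomputable def ringPiece (s : Tile) (t : ℝ) : ℂ :=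
  (2 ^ s.k / 8 : ℝ) * ringSchwartz s.l (2 ^ s.k * t - s.l) * eChar (((-s.m : ℤ) : ℝ) / (8 / 2 ^ s.k) * t)

lemma continuous_ringPiece (s : Tile) : Continuous (ringPiece s) := by
  have := (ringSchwartz s.l).continuous
  unfold ringPiece; fun_prop

lemma ringPiece_support {s : Tile} {t : ℝ} (h : ringPiece s t ≠ 0) :
    -7 < 2 ^ s.k * t - s.l ∧ 2 ^ s.k * t - s.l < -2 := by
  by_contra hc
  rw [not_and_or, not_lt, not_lt] at hc
  exact h (by rw [ringPiece, ringSchwartz_eq_zero _ hc, mul_zero, zero_mul])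

lemma wave_eq_integral (s : Tile) (x : ℤ) :
    wave s x = ∫ t, ringPiece s t * eChar (x / 8 * t) := by
  have hp : (0 : ℝ) < 2 ^ s.k := by positivity
  have h1 : wave s x = (1 / 8) * ∫ z, ringSchwartz s.l z * eChar ((z + s.l) * s.pos x / 8) := by
    rw [wave, waveProfile_eq, mul_assoc, ← integral_const_mul]
    congr 2; ext z
    rw [show (z + s.l) * s.pos x / 8 = s.l * s.pos x / 8 + z * s.pos x / 8 by ring, eChar_add]
    ring
  have h2 := integral_sub_right_eq_self (μ := volume)
    (fun z => ringSchwartz s.l z * eChar ((z + s.l) * s.pos x / 8)) (s.l : ℝ)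
  have h3 := Measure.integral_comp_mul_left
    (fun z => ringSchwartz s.l (z - s.l) * eChar ((z - s.l + s.l) * s.pos x / 8)) (2 ^ s.k : ℝ)
  rw [h1, ← h2]
  rw [abs_of_pos (by positivity), eq_inv_smul_iff₀ hp.ne'] at h3
  rw [← h3, Complex.real_smul, ← integral_const_mul, ← integral_const_mul]
  congr 1; ext t
  rw [ringPiece]
  have : eChar ((2 ^ s.k * t - s.l + s.l) * s.pos x / 8) =
      eChar (((-s.m : ℤ) : ℝ) / (8 / 2 ^ s.k) * t) * eChar (x / 8 * t) := by
    rw [← eChar_add]; congr 1; unfold Tile.pos; push_cast; field_simp; ring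
  rw [this]
  push_cast
  ring

lemma sum_norm_sq_le_card {ι : Type*} (F : Finset ι) (f : ι → ℂ) {N : ℝ}
    (hN : ((F.filter fun i => f i ≠ 0).card : ℝ) ≤ N) :
    ‖∑ i ∈ F, f i‖ ^ 2 ≤ N * ∑ i ∈ F, ‖f i‖ ^ 2 := by
  have h0 : ∑ i ∈ F, f i = ∑ i ∈ F.filter (fun i => f i ≠ 0), f i :=
    (Finset.sum_filter_ne_zero F).symm
  calc ‖∑ i ∈ F, f i‖ ^ 2 ≤ (∑ i ∈ F.filter (fun i => f i ≠ 0), ‖f i‖) ^ 2 := by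
        rw [h0]; gcongr; exact norm_sum_le _ _
    _ ≤ (F.filter fun i => f i ≠ 0).card * ∑ i ∈ F.filter (fun i => f i ≠ 0), ‖f i‖ ^ 2 :=
        sq_sum_le_card_mul_sum_sq
    _ ≤ N * ∑ i ∈ F, ‖f i‖ ^ 2 := by
        refine mul_le_mul hN ?_ (by positivity) (le_trans (by positivity) hN)
        exact Finset.sum_le_sum_of_subset_of_nonneg (Finset.filter_subset _ _)
          fun _ _ _ => by positivity

lemma LacFreq_ringPiece {s : Tile} {ξ t : ℝ} (hs : s.LacFreq ξ) (h : ringPiece s t ≠ 0) :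
    3 / 2 < 2 ^ s.k * (ξ - t) ∧ 2 ^ s.k * (ξ - t) < 17 / 2 := by
  obtain ⟨h1, h2⟩ := ringPiece_support h
  obtain ⟨h3, h4⟩ := hs
  constructor <;> nlinarith

lemma ringPiece_window {s : Tile} {ξ t : ℝ} (hk : 1 ≤ s.k) (hs : s.LacFreq ξ)
    (h : ringPiece s t ≠ 0) : t ∈ Set.Ioc (ξ - 8) (ξ - 8 + 8) := by
  obtain ⟨h1, h2⟩ := LacFreq_ringPiece hs h
  have h3 : (2 : ℝ) ^ 1 ≤ 2 ^ s.k := pow_le_pow_right₀ (by norm_num) hk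
  constructor
  · by_contra hc
    nlinarith
  · by_contra hc
    nlinarith

lemma integral_norm_sq_ringPiece (k : ℕ) (l : ℤ) (F : Finset Tile)
    (hF : ∀ s ∈ F, s.k = k ∧ s.l = l) (α : Tile → ℂ) :
    ∫ t, ‖∑ s ∈ F, α s * ringPiece s t‖ ^ 2 ≤ 2 ^ k / 8 * ∑ s ∈ F, ‖α s‖ ^ 2 := by
  have hp : (0 : ℝ) < 2 ^ k := by positivity
  set L : ℝ := 8 / 2 ^ k with hL
  have hL0 : 0 < L := by positivity
  set a : ℝ := (l - 8) / 2 ^ k with ha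
  have h1 : ∀ t, ∑ s ∈ F, α s * ringPiece s t = (2 ^ k / 8 : ℝ) * ringSchwartz l (2 ^ k * t - l) *
      ∑ s ∈ F, α s * eChar (((-s.m : ℤ) : ℝ) / L * t) := by
    intro t
    rw [Finset.mul_sum]
    refine Finset.sum_congr rfl fun s hs => ?_
    obtain ⟨rfl, rfl⟩ := hF s hs
    rw [ringPiece]; ring
  have hc : Continuous fun t => ‖∑ s ∈ F, α s * ringPiece s t‖ ^ 2 := by
    have := continuous_ringPiece
    fun_prop
  rw [← intervalIntegral.integral_eq_integral_of_support_subset (a := a) (b := a + L)]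
  · calc ∫ t in a..(a + L), ‖∑ s ∈ F, α s * ringPiece s t‖ ^ 2
        ≤ ∫ t in a..(a + L),
          (2 ^ k / 8) ^ 2 * ‖∑ s ∈ F, α s * eChar (((-s.m : ℤ) : ℝ) / L * t)‖ ^ 2 := by
          refine intervalIntegral.integral_mono_on (by linarith) (hc.intervalIntegrable _ _)
            (Continuous.intervalIntegrable (by fun_prop) _ _) fun t _ => ?_
          rw [h1, norm_mul, norm_mul, mul_pow, mul_pow, Complex.norm_real, Real.norm_eq_abs,
            abs_of_pos (by positivity), mul_assoc]
          refine mul_le_mul_of_nonneg_left ?_ (by positivity)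
          refine mul_le_of_le_one_left (by positivity) ?_
          rw [ringSchwartz_apply, Complex.norm_real, Real.norm_eq_abs]
          exact pow_le_one₀ (abs_nonneg _) (abs_ringCut_le _ _)
      _ = 2 ^ k / 8 * ∑ s ∈ F, ‖α s‖ ^ 2 := by
          rw [intervalIntegral.integral_const_mul, integral_norm_sq_trig hL0]
          · rw [hL]; field_simp
          · intro s hs s' hs' h
            obtain ⟨h3, h4⟩ := hF s hs
            obtain ⟨h5, h6⟩ := hF s' hs'
            obtain ⟨k1, m1, l1⟩ := s
            obtain ⟨k2, m2, l2⟩ := s'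
            simp only [neg_inj] at *
            subst h3 h4 h5 h6 h
            rfl
  · intro t ht
    rw [Function.mem_support, h1] at ht
    have h2 : ringSchwartz l (2 ^ k * t - l) ≠ 0 := fun h0 => ht (by rw [h0]; simp)
    have h3 : ¬(2 ^ k * t - l ≤ -7 ∨ -2 ≤ 2 ^ k * t - l) := fun h => h2 (ringSchwartz_eq_zero l h)
    rw [not_or, not_le, not_le] at h3
    rw [ha, hL, Set.mem_Ioc, ← add_div, div_lt_iff₀ hp, le_div_iff₀ hp]
    constructor <;> linarith [h3.1, h3.2]

lemma wave_bessel (T : Finset Tile) (ξ : ℝ) (hT : ∀ s ∈ T, 1 ≤ s.k ∧ s.LacFreq ξ)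
    (hsep : ∀ s ∈ T, ∀ s' ∈ T, s'.k < s.k → s'.k + 8 ≤ s.k) (α : Tile → ℂ) (X : Finset ℤ) :
    ∑ x ∈ X, ‖∑ s ∈ T, α s * wave s x‖ ^ 2 ≤ 3 * ∑ s ∈ T, 2 ^ s.k * ‖α s‖ ^ 2 := by
  classical
  set f : ℝ → ℂ := fun t => ∑ s ∈ T, α s * ringPiece s t with hf
  have hrc := continuous_ringPiece
  have hfc : Continuous f := by simp only [hf]; fun_prop
  have hr0 : ∀ s ∈ T, ∀ t, t ∉ Set.Ioc (ξ - 8) (ξ - 8 + 8) → ringPiece s t = 0 := fun s hs t ht => by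
    by_contra h
    exact ht (ringPiece_window (hT s hs).1 (hT s hs).2 h)
  have hw : ∀ x : ℤ, ∑ s ∈ T, α s * wave s x =
      ∫ t in (ξ - 8)..(ξ - 8 + 8), f t * eChar (x / 8 * t) := by
    intro x
    have h1 : ∀ s ∈ T, wave s x = ∫ t in (ξ - 8)..(ξ - 8 + 8), ringPiece s t * eChar (x / 8 * t) := by
      intro s hs
      rw [wave_eq_integral, intervalIntegral.integral_eq_integral_of_support_subset]
      intro t ht
      by_contra hc
      exact ht (by simp only; rw [hr0 s hs t hc, zero_mul])
    simp only [hf, Finset.sum_mul]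
    rw [intervalIntegral.integral_finsetSum fun i _ =>
      Continuous.intervalIntegrable (by fun_prop) _ _]
    refine Finset.sum_congr rfl fun s hs => ?_
    rw [h1 s hs, ← intervalIntegral.integral_const_mul]
    simp_rw [mul_assoc]
  simp_rw [hw]
  refine (bessel_continuous (by norm_num) _ hfc X).trans ?_
  set Q := T.image fun s => (s.k, s.l) with hQ
  set F : ℕ × ℤ → ℝ → ℂ :=
    fun q t => ∑ s ∈ T with (s.k, s.l) = q, α s * ringPiece s t with hF
  have hFc : ∀ q, Continuous (F q) := fun q => by simp only [hF]; fun_prop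
  have hFne : ∀ q t, F q t ≠ 0 → ∃ s ∈ T, (s.k, s.l) = q ∧ ringPiece s t ≠ 0 := by
    intro q t h
    obtain ⟨s, hs, hs0⟩ := Finset.exists_ne_zero_of_sum_ne_zero h
    rw [Finset.mem_filter] at hs
    exact ⟨s, hs.1, hs.2, right_ne_zero_of_mul hs0⟩
  have hfF : ∀ t, f t = ∑ q ∈ Q, F q t := fun t =>
    (Finset.sum_fiberwise_of_maps_to (fun s hs => Finset.mem_image_of_mem _ hs) _).symm
  have hpt : ∀ t, ‖f t‖ ^ 2 ≤ 3 * ∑ q ∈ Q, ‖F q t‖ ^ 2 := by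
    intro t
    rw [hfF]
    refine sum_norm_sq_le_card Q _ ?_
    rcases (Q.filter fun q => F q t ≠ 0).eq_empty_or_nonempty with h0 | ⟨q0, hq0⟩
    · rw [h0]; norm_num
    obtain ⟨s0, hs0, hsq0, hr⟩ := hFne q0 t (Finset.mem_filter.1 hq0).2
    have hsub : (Q.filter fun q => F q t ≠ 0) ⊆
        {s0.k} ×ˢ Finset.Icc (⌊ξ * 2 ^ s0.k⌋ - 1) (⌊ξ * 2 ^ s0.k⌋ + 1) := by
      intro q hq
      obtain ⟨s, hs, rfl, hsr⟩ := hFne q t (Finset.mem_filter.1 hq).2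
      have key : ∀ s ∈ T, ∀ s' ∈ T, ringPiece s t ≠ 0 → ringPiece s' t ≠ 0 → ¬ s'.k < s.k := by
        intro s hs s' hs' h h' hlt
        obtain ⟨d, hd⟩ := Nat.exists_eq_add_of_le (hsep s hs s' hs' hlt)
        obtain ⟨h1, h2⟩ := LacFreq_ringPiece (hT s hs).2 h
        obtain ⟨h3, h4⟩ := LacFreq_ringPiece (hT s' hs').2 h'
        have h5 : (1 : ℝ) ≤ 2 ^ d := one_le_pow₀ (by norm_num)
        rw [hd, pow_add, pow_add] at h2
        nlinarith
      have hk : s.k = s0.k :=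
        le_antisymm (not_lt.1 (key s hs s0 hs0 hsr hr)) (not_lt.1 (key s0 hs0 s hs hr hsr))
      obtain ⟨h1, h2⟩ := (hT s hs).2
      rw [hk] at h1 h2
      have h3 := Int.floor_le (ξ * 2 ^ s0.k)
      have h4 := Int.lt_floor_add_one (ξ * 2 ^ s0.k)
      have h5 : (s.l : ℝ) < ((⌊ξ * 2 ^ s0.k⌋ + 2 : ℤ) : ℝ) := by push_cast; linarith
      have h6 : ((⌊ξ * 2 ^ s0.k⌋ - 2 : ℤ) : ℝ) < s.l := by push_cast; linarith
      rw [Int.cast_lt] at h5 h6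
      simp only [Finset.mem_product, Finset.mem_singleton, Finset.mem_Icc]
      exact ⟨hk, by omega, by omega⟩
    have := Finset.card_le_card hsub
    rw [Finset.card_product, Finset.card_singleton, Int.card_Icc] at this
    have h3 : (Q.filter fun q => F q t ≠ 0).card ≤ 3 := by omega
    exact_mod_cast h3
  have h2 : ∫ t in (ξ - 8)..(ξ - 8 + 8), ‖f t‖ ^ 2 ≤
      3 * ∑ q ∈ Q, ∫ t in (ξ - 8)..(ξ - 8 + 8), ‖F q t‖ ^ 2 := by
    rw [← intervalIntegral.integral_finsetSum fun i _ =>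
      Continuous.intervalIntegrable (by fun_prop) _ _, ← intervalIntegral.integral_const_mul]
    exact intervalIntegral.integral_mono_on (by linarith)
      (Continuous.intervalIntegrable (by fun_prop) _ _)
      (Continuous.intervalIntegrable (by fun_prop) _ _) fun t _ => hpt t
  have h3 : ∀ q ∈ Q, ∫ t in (ξ - 8)..(ξ - 8 + 8), ‖F q t‖ ^ 2 ≤
      2 ^ q.1 / 8 * ∑ s ∈ T with (s.k, s.l) = q, ‖α s‖ ^ 2 := by
    intro q hq
    rw [intervalIntegral.integral_eq_integral_of_support_subset]
    · refine integral_norm_sq_ringPiece q.1 q.2 _ (fun s hs => ?_) α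
      rw [Finset.mem_filter] at hs
      rw [← hs.2]; exact ⟨rfl, rfl⟩
    · intro t ht
      obtain ⟨s, hs, -, hr⟩ := hFne q t (fun h => ht (by simp [h]))
      exact ringPiece_window (hT s hs).1 (hT s hs).2 hr
  have h4 : ∑ q ∈ Q, (2 : ℝ) ^ q.1 / 8 * ∑ s ∈ T with (s.k, s.l) = q, ‖α s‖ ^ 2 =
      1 / 8 * ∑ s ∈ T, 2 ^ s.k * ‖α s‖ ^ 2 := by
    rw [← Finset.sum_fiberwise_of_maps_to (g := fun s : Tile => (s.k, s.l)) (t := Q)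
      (fun s hs => Finset.mem_image_of_mem _ hs), Finset.mul_sum]
    refine Finset.sum_congr rfl fun q _ => ?_
    rw [Finset.mul_sum, Finset.mul_sum]
    refine Finset.sum_congr rfl fun s hs => ?_
    rw [← (Finset.mem_filter.1 hs).2]; ring
  have h5 := Finset.sum_le_sum h3
  rw [h4] at h5
  linarith

lemma exists_waveBound : ∃ B₀, ∀ B, B₀ ≤ B → WaveBound wave B := by
  obtain ⟨B₁, h1, hd⟩ := wave_decay
  obtain ⟨B₂, h2, hs⟩ := wave_smooth
  obtain ⟨B₃, h3, hc⟩ := wave_cancel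
  refine ⟨B₁ + B₂ + B₃ + 3, fun B hB => ⟨fun s x => (hd s x).trans ?_,
    fun s ξ h x y hxy => (hs s ξ h x y hxy).trans ?_,
    fun s ξ hk h a b hab => (hc s ξ hk h a b hab).trans ?_,
    fun T ξ hT hsep α X => (wave_bessel T ξ hT hsep α X).trans ?_⟩⟩
  · have := dyWt_pos s.k s.m x
    gcongr; linarith
  · gcongr; linarith
  · gcongr; linarith
  · refine mul_le_mul_of_nonneg_right (by linarith) (Finset.sum_nonneg fun s _ => by positivity)

/-! ### Expansion of the multipliers into wave packets -/

lemma fourier_modulated_ring (l : ℤ) (y : ℝ) (n : ℤ) :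
    𝓕 (fun u : ℝ => ringSchwartz l (8 * u) * eChar (y * u)) (n : ℝ) =
      1 / 8 * waveProfile l (y - n) := by
  rw [Real.fourier_real_eq_integral_exp_smul, waveProfile_eq]
  have h := Measure.integral_comp_mul_left
    (fun z => ringSchwartz l z * eChar (z * (y - n) / 8)) (8 : ℝ)
  rw [abs_of_pos (by norm_num), Complex.real_smul] at h
  rw [show (1 / 8 : ℂ) = (((8 : ℝ)⁻¹ : ℝ) : ℂ) by push_cast; norm_num, ← h]
  congr 1; ext u
  rw [smul_eq_mul, show 8 * u * (y - n) / 8 = -(n * u) + y * u by ring, eChar_add]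
  have : eChar (-(n * u)) = Complex.exp (↑(-2 * Real.pi * u * n) * Complex.I) := by
    unfold eChar; congr 1; push_cast; ring
  rw [this]; ring

lemma summable_waveProfile (l : ℤ) (y : ℝ) : Summable fun n : ℤ => waveProfile l (y - n) := by
  obtain ⟨A, hA, h⟩ := waveProfile_bound
  have hs : Summable fun n : ℤ => A * (1 + |y|) ^ 2 * (1 / (n : ℝ) ^ 2) :=
    (Real.summable_one_div_int_pow.2 one_lt_two).mul_left _
  refine hs.of_norm_bounded_eventually ?_
  filter_upwards [(Set.finite_singleton (0 : ℤ)).eventually_cofinite_notMem] with n hn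
  have hn0 : (n : ℝ) ≠ 0 := by exact_mod_cast hn
  refine (h l (y - n)).1.trans ?_
  rw [mul_assoc]
  refine mul_le_mul_of_nonneg_left ?_ (by linarith)
  have h1 : |(n : ℝ)| ≤ |y| + |y - n| := by
    have := abs_sub_abs_le_abs_sub (n : ℝ) y
    rw [abs_sub_comm] at this; linarith
  have h2 := abs_nonneg y
  have h3 := abs_nonneg (y - n)
  have h4 : |(n : ℝ)| ≤ (1 + |y|) * (1 + |y - n|) := by nlinarith
  have h5 : (n : ℝ) ^ 2 ≤ (1 + |y|) ^ 2 * (1 + |y - n|) ^ 6 := by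
    calc (n : ℝ) ^ 2 = |(n : ℝ)| ^ 2 := (sq_abs _).symm
      _ ≤ ((1 + |y|) * (1 + |y - n|)) ^ 2 := by gcongr
      _ = (1 + |y|) ^ 2 * (1 + |y - n|) ^ 2 := by ring
      _ ≤ _ := by
        gcongr ?_ * ?_
        exact pow_le_pow_right₀ (by linarith) (by norm_num)
  have h6 : (0 : ℝ) < (n : ℝ) ^ 2 := by positivity
  rw [mul_one_div, le_div_iff₀ h6, inv_mul_le_iff₀ (by positivity)]
  linarith

lemma hasSum_waveProfile (l : ℤ) (y : ℝ) {z : ℝ} (h1 : -8 ≤ z) (h2 : z ≤ -1) :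
    HasSum (fun n : ℤ => 1 / 8 * waveProfile l (y - n) * eChar (n * z / 8))
      (ringSchwartz l z * eChar (y * z / 8)) := by
  set f : ℝ → ℂ := fun u => ringSchwartz l (8 * u) * eChar (y * u) with hf
  have hfc : Continuous f := by
    have := (ringSchwartz l).continuous
    simp only [hf]; fun_prop
  have hs := summable_waveProfile l y
  have hfs : Summable fun n : ℤ => 𝓕 f n := by
    simp_rw [hf, fourier_modulated_ring]; exact hs.mul_left _
  have hcs : HasCompactSupport f := by
    refine HasCompactSupport.intro (isCompact_Icc (a := -1) (b := 0)) fun u hu => ?_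
    simp only [hf]
    rw [ringSchwartz_eq_zero, zero_mul]
    rw [Set.mem_Icc, not_and_or, not_le, not_le] at hu
    rcases hu with hu | hu
    · left; linarith
    · right; linarith
  have hO : f =O[Filter.cocompact ℝ] fun x : ℝ => |x| ^ (-(2 : ℝ)) := by
    refine Filter.EventuallyEq.trans_isBigO ?_ (Asymptotics.isBigO_zero _ _)
    rw [← Filter.coclosedCompact_eq_cocompact]
    exact hasCompactSupport_iff_eventuallyEq.1 hcs
  have hp := Real.tsum_eq_tsum_fourier_of_rpow_decay_of_summable hfc one_lt_two hO hfs (z / 8)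
  have hl : ∑' n : ℤ, f (z / 8 + n) = ringSchwartz l z * eChar (y * z / 8) := by
    rw [tsum_eq_single 0]
    · simp only [hf]; congr 2
      · push_cast; ring
      · push_cast; ring
    · intro n hn
      simp only [hf]
      rw [ringSchwartz_eq_zero, zero_mul]
      rcases lt_or_gt_of_ne hn with hn | hn
      · left
        have : (n : ℝ) ≤ -1 := by exact_mod_cast (by omega : n ≤ -1)
        linarith
      · right
        have : (1 : ℝ) ≤ n := by exact_mod_cast (by omega : 1 ≤ n)
        linarith
  have he : ∀ n : ℤ, 𝓕 f (n : ℝ) * fourier n ((z / 8 : ℝ) : UnitAddCircle) =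
      1 / 8 * waveProfile l (y - n) * eChar (n * z / 8) := by
    intro n
    rw [hf, fourier_modulated_ring, fourier_coe_apply]
    congr 1; unfold eChar; congr 1; push_cast; ring
  rw [hl] at hp
  simp_rw [he] at hp
  rw [hp]
  refine Summable.hasSum (Summable.of_norm ?_)
  simp_rw [norm_mul, norm_eChar, mul_one]
  exact hs.norm.mul_left _

lemma hasSum_wave (k : ℕ) (l x : ℤ) {t : ℝ} (h1 : -8 ≤ 2 ^ k * t - l) (h2 : 2 ^ k * t - l ≤ -1) :
    HasSum (fun m : ℤ => wave ⟨k, m, l⟩ x * eChar (m * 2 ^ k * t / 8))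
      (ringSchwartz l (2 ^ k * t - l) * eChar (x / 8 * t)) := by
  have hp : (0 : ℝ) < 2 ^ k := by positivity
  have h := (hasSum_waveProfile l (x / 2 ^ k) h1 h2).mul_left (eChar (l * (x / 2 ^ k) / 8))
  convert! h using 1
  · ext m
    have h3 : Tile.pos ⟨k, m, l⟩ x = x / 2 ^ k - m := by unfold Tile.pos; field_simp
    have h4 : eChar (l * (x / 2 ^ k - m) / 8) * eChar (m * 2 ^ k * t / 8) =
        eChar (l * (x / 2 ^ k) / 8) * eChar (m * (2 ^ k * t - l) / 8) := by
      rw [← eChar_add, ← eChar_add]; congr 1; ring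
    rw [wave, h3]
    calc _ = 1 / 8 * waveProfile l (x / 2 ^ k - m) *
          (eChar (l * (x / 2 ^ k - m) / 8) * eChar (m * 2 ^ k * t / 8)) := by ring
      _ = _ := by rw [h4]; ring
  · rw [mul_left_comm, ← eChar_add]
    congr 2; field_simp; ring

/-! ### The analysing packets -/

/-- The analysing packet attached to a tile, as a function. -/
noncomputable def packetFun (s : Tile) (t : ℝ) : ℂ :=
  fatCut (2 ^ s.k * t - s.l) * eChar (-(s.m * 2 ^ s.k * t / 8))

@[fun_prop] lemma continuous_fatCut : Continuous fatCut := contDiff_fatCut.continuous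

lemma continuous_packetFun (s : Tile) : Continuous (packetFun s) := by
  unfold packetFun; fun_prop

lemma packetFun_support {s : Tile} {t : ℝ} (h : packetFun s t ≠ 0) :
    -8 < 2 ^ s.k * t - s.l ∧ 2 ^ s.k * t - s.l < -1 := by
  by_contra hc
  rw [not_and_or, not_lt, not_lt] at hc
  exact h (by rw [packetFun, fatCut_zero hc, Complex.ofReal_zero, zero_mul])

lemma memLp_packetFun (s : Tile) : MemLp (packetFun s) 2 := by
  refine (continuous_packetFun s).memLp_of_hasCompactSupport ?_
  have hp : (0 : ℝ) < 2 ^ s.k := by positivity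
  refine HasCompactSupport.intro
    (isCompact_Icc (a := ((s.l : ℝ) - 8) / 2 ^ s.k) (b := ((s.l : ℝ) - 1) / 2 ^ s.k)) fun t ht => ?_
  by_contra hc
  obtain ⟨h1, h2⟩ := packetFun_support hc
  refine ht ⟨?_, ?_⟩
  · rw [div_le_iff₀ hp]; linarith
  · rw [le_div_iff₀ hp]; linarith

/-- The analysing packet attached to a tile, as an element of `L²`. -/
noncomputable def packet (s : Tile) : Lp ℂ 2 (volume : Measure ℝ) := (memLp_packetFun s).toLp _

lemma inner_packet (s : Tile) {g : ℝ → ℂ} (hg : MemLp g 2) :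
    inner ℂ (packet s) (hg.toLp g) =
      ∫ t, g t * (fatCut (2 ^ s.k * t - s.l) * eChar (s.m * 2 ^ s.k * t / 8)) := by
  rw [L2.inner_def]
  refine integral_congr_ae ?_
  filter_upwards [(memLp_packetFun s).coeFn_toLp, hg.coeFn_toLp] with t h1 h2
  rw [packet, h1, h2, RCLike.inner_apply, packetFun, map_mul, conj_eChar, Complex.conj_ofReal,
    neg_neg]

lemma hasCompactSupport_fatCut : HasCompactSupport (fun z => (fatCut z : ℂ)) := by
  refine HasCompactSupport.intro (isCompact_Icc (a := -8) (b := -1)) fun z hz => ?_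
  rw [fatCut_zero, Complex.ofReal_zero]
  rw [Set.mem_Icc, not_and_or, not_le, not_le] at hz
  exact hz.imp le_of_lt le_of_lt

/-- The cutoff `fatCut` as a Schwartz function. -/
noncomputable def fatSchwartz : 𝓢(ℝ, ℂ) :=
  hasCompactSupport_fatCut.toSchwartzMap (Complex.ofRealCLM.contDiff.comp contDiff_fatCut)

lemma fatSchwartz_apply (z : ℝ) : fatSchwartz z = (fatCut z : ℂ) := rfl

lemma exists_bound_schwartz (f : 𝓢(ℝ, ℂ)) : ∃ C, ∀ z, ‖f z‖ ≤ C := by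
  obtain ⟨C, -, hC⟩ := f.decay 0 0
  exact ⟨C, fun z => by simpa using hC z⟩

lemma exists_fat_decay : ∃ A, 0 ≤ A ∧ ∀ a c : ℝ, 0 ≤ a → a ≤ 1 → ∀ Y : ℝ,
    ‖∫ z in (-8 : ℝ)..(-1), fatSchwartz z * fatSchwartz (a * z + c) * eChar (Y / 8 * z)‖ ≤
      A * ((1 + |Y|) ^ 2)⁻¹ := by
  obtain ⟨A, hA, h⟩ := exists_osc_decay fatSchwartz (p := -8) (q := -1) (by norm_num)
    (fun z hz => by rw [fatSchwartz_apply, fatCut_zero hz, Complex.ofReal_zero])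
  set f1 : 𝓢(ℝ, ℂ) := SchwartzMap.derivCLM ℂ ℂ fatSchwartz with hf1
  set f2 : 𝓢(ℝ, ℂ) := SchwartzMap.derivCLM ℂ ℂ f1 with hf2
  have d1 : ∀ z, HasDerivAt fatSchwartz (f1 z) z := fun z => by
    rw [hf1, SchwartzMap.derivCLM_apply]; exact (fatSchwartz.differentiable z).hasDerivAt
  have d2 : ∀ z, HasDerivAt f1 (f2 z) z := fun z => by
    rw [hf2, SchwartzMap.derivCLM_apply]; exact (f1.differentiable z).hasDerivAt
  obtain ⟨C0, hC0⟩ := exists_bound_schwartz fatSchwartz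
  obtain ⟨C1, hC1⟩ := exists_bound_schwartz f1
  obtain ⟨C2, hC2⟩ := exists_bound_schwartz f2
  have p0 := (norm_nonneg _).trans (hC0 0)
  have p1 := (norm_nonneg _).trans (hC1 0)
  have p2 := (norm_nonneg _).trans (hC2 0)
  refine ⟨A * (C0 + C1 + C2), by positivity, fun a c ha ha1 Y => ?_⟩
  have hlin : ∀ z : ℝ, HasDerivAt (fun z : ℝ => a * z + c) a z := fun z => by
    simpa using ((hasDerivAt_id z).const_mul a).add_const c
  refine h (fun z => fatSchwartz (a * z + c)) (fun z => a • f1 (a * z + c))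
    (fun z => a • (a • f2 (a * z + c))) (fun z _ => (d1 _).scomp z (hlin z))
    (fun z _ => ((d2 _).scomp z (hlin z)).const_smul a) ?_ _ (fun z _ => ⟨?_, ?_, ?_⟩) Y
  · have := f2.continuous
    fun_prop
  · linarith [hC0 (a * z + c)]
  · rw [norm_smul, Real.norm_eq_abs, abs_of_nonneg ha]
    have := mul_le_of_le_one_left (norm_nonneg (f1 (a * z + c))) ha1
    linarith [hC1 (a * z + c)]
  · rw [norm_smul, norm_smul, Real.norm_eq_abs, abs_of_nonneg ha]
    have := mul_le_of_le_one_left (norm_nonneg (f2 (a * z + c))) ha1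
    have := mul_le_of_le_one_left (mul_nonneg ha (norm_nonneg (f2 (a * z + c)))) ha1
    linarith [hC2 (a * z + c)]

lemma exists_packetBound : ∃ B₀, ∀ B, B₀ ≤ B → PacketBound packet B := by
  obtain ⟨A, hA, h⟩ := exists_fat_decay
  refine ⟨A, fun B hB => ⟨fun s s' hne => ?_, fun s s' hk => ?_⟩⟩
  · rw [show packet s' = (memLp_packetFun s').toLp _ from rfl, inner_packet] at hne
    obtain ⟨t, ht⟩ := exists_ne_zero_of_integral_ne_zero hne
    have h1 := packetFun_support (left_ne_zero_of_mul ht)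
    have h2 : packetFun s t ≠ 0 := by
      intro h0
      rw [packetFun, mul_eq_zero] at h0
      rcases h0 with h0 | h0
      · exact ht (by simp [h0])
      · have := norm_eChar (-(s.m * 2 ^ s.k * t / 8))
        rw [h0, norm_zero] at this
        norm_num at this
    have h3 := packetFun_support h2
    exact ⟨t, ⟨by linarith, by linarith⟩, by linarith, by linarith⟩
  · have hp : (0 : ℝ) < 2 ^ s.k := by positivity
    have hp' : (0 : ℝ) < 2 ^ s'.k := by positivity
    have hpp : (2 : ℝ) ^ s'.k ≤ 2 ^ s.k := pow_le_pow_right₀ (by norm_num) hk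
    set a : ℝ := 2 ^ s'.k / 2 ^ s.k with ha
    set Y : ℝ := (s.m * 2 ^ s.k - s'.m * 2 ^ s'.k) / 2 ^ s.k with hY
    have h1 := h a (a * s.l - s'.l) (by positivity) ((div_le_one hp).2 hpp) Y
    have hw : dyWt s.k s.m (s'.m * 2 ^ s'.k) = 1 + |Y| := by
      rw [hY, abs_div, abs_of_pos hp, abs_sub_comm]; simp [dyWt]
    rw [intervalIntegral.integral_eq_integral_of_support_subset] at h1
    · set G : ℝ → ℂ := fun z => fatSchwartz z * fatSchwartz (a * z + (a * s.l - s'.l)) *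
        eChar (Y / 8 * z) with hG
      have h2 := Measure.integral_comp_mul_left (fun z => G (z - s.l)) (2 ^ s.k : ℝ)
      rw [integral_sub_right_eq_self G (s.l : ℝ), abs_of_pos (by positivity)] at h2
      have h3 : inner ℂ (packet s) (packet s') =
          eChar (Y * s.l / 8) * ∫ t, G (2 ^ s.k * t - s.l) := by
        rw [show packet s' = (memLp_packetFun s').toLp _ from rfl, inner_packet,
          ← integral_const_mul]
        congr 1; ext t
        have e1 : a * (2 ^ s.k * t - s.l) + (a * s.l - s'.l) = 2 ^ s'.k * t - s'.l := by
          rw [ha]; field_simp; ring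
        have e2 : eChar (-(s'.m * 2 ^ s'.k * t / 8)) * eChar (s.m * 2 ^ s.k * t / 8) =
            eChar (Y * s.l / 8) * eChar (Y / 8 * (2 ^ s.k * t - s.l)) := by
          rw [← eChar_add, ← eChar_add]; congr 1; rw [hY]; field_simp; ring
        simp only [hG]
        rw [e1, packetFun, fatSchwartz_apply, fatSchwartz_apply]
        calc _ = (fatCut (2 ^ s.k * t - s.l) * fatCut (2 ^ s'.k * t - s'.l) : ℂ) *
            (eChar (-(s'.m * 2 ^ s'.k * t / 8)) * eChar (s.m * 2 ^ s.k * t / 8)) := by ring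
          _ = _ := by rw [e2]; ring
      rw [h3, h2, norm_mul, norm_eChar, one_mul, norm_smul, hw, Real.norm_eq_abs,
        abs_of_pos (by positivity)]
      calc (2 ^ s.k : ℝ)⁻¹ * ‖∫ z, G z‖ ≤ (2 ^ s.k : ℝ)⁻¹ * (A * ((1 + |Y|) ^ 2)⁻¹) := by gcongr
        _ = A / 2 ^ s.k * ((1 + |Y|) ^ 2)⁻¹ := by ring
        _ ≤ _ := by gcongr
    · intro z hz
      by_contra hc
      refine hz ?_
      simp only
      rw [fatSchwartz_apply, fatCut_zero, Complex.ofReal_zero, zero_mul, zero_mul]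
      rw [Set.mem_Ioc, not_and_or, not_lt, not_le] at hc
      exact hc.imp id le_of_lt

/-! ### The maximal partial Fourier integral of a square integrable function -/

lemma hasSum_packet_wave {g : ℝ → ℂ} (hg : MemLp g 2) (hgi : Integrable g) (k : ℕ) (l x : ℤ) :
    HasSum (fun m : ℤ => inner ℂ (packet ⟨k, m, l⟩) (hg.toLp g) * wave ⟨k, m, l⟩ x)
      (∫ t, g t * (ringSchwartz l (2 ^ k * t - l) * eChar (x / 8 * t))) := by
  set F : ℤ → ℝ → ℂ := fun m t => wave ⟨k, m, l⟩ x *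
    (g t * (fatCut (2 ^ k * t - l) * eChar (m * 2 ^ k * t / 8))) with hF
  have hfat : ∀ z, ‖(fatCut z : ℂ)‖ ≤ 1 := fun z => by
    rw [Complex.norm_real, Real.norm_eq_abs, fatCut, abs_mul]
    refine mul_le_one₀ ?_ (abs_nonneg _) ?_ <;> rw [abs_of_nonneg (Real.smoothTransition.nonneg _)] <;>
      exact Real.smoothTransition.le_one _
  have hint : ∀ m, Integrable (F m) := fun m => by
    refine (hgi.mul_bdd (c := 1) (Continuous.aestronglyMeasurable (by fun_prop)) ?_).const_mul _
    refine Filter.Eventually.of_forall fun t => ?_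
    rw [norm_mul, norm_eChar, mul_one]; exact hfat _
  have hnorm : ∀ m, ∫ t, ‖F m t‖ = ‖wave ⟨k, m, l⟩ x‖ * ∫ t, ‖g t‖ * ‖(fatCut (2 ^ k * t - l) : ℂ)‖ := by
    intro m
    rw [← integral_const_mul]
    simp_rw [hF, norm_mul, norm_eChar, mul_one]
  have hws : Summable fun m : ℤ => ‖wave ⟨k, m, l⟩ x‖ := by
    have h := ((summable_waveProfile l (x / 2 ^ k)).norm.mul_left (1 / 8))
    refine h.congr fun m => ?_
    have h3 : Tile.pos ⟨k, m, l⟩ x = x / 2 ^ k - m := by unfold Tile.pos; field_simp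
    rw [wave, norm_mul, norm_mul, norm_eChar, h3]
    norm_num
  have hsum : Summable fun m => ∫ t, ‖F m t‖ := by
    simp_rw [hnorm]; exact hws.mul_right _
  have h := hasSum_integral_of_summable_integral_norm hint hsum
  have h1 : ∀ t, ∑' m, F m t = g t * (ringSchwartz l (2 ^ k * t - l) * eChar (x / 8 * t)) := by
    intro t
    by_cases hz : -8 ≤ 2 ^ k * t - l ∧ 2 ^ k * t - l ≤ -1
    · have h2 := (hasSum_wave k l x hz.1 hz.2).mul_left (g t * fatCut (2 ^ k * t - l))
      have h3 : (fatCut (2 ^ k * t - l) : ℂ) * ringSchwartz l (2 ^ k * t - l) =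
          ringSchwartz l (2 ^ k * t - l) := by
        by_cases hr : -7 ≤ 2 ^ k * t - l ∧ 2 ^ k * t - l ≤ -2
        · rw [fatCut_one hr.1 hr.2, Complex.ofReal_one, one_mul]
        · rw [not_and_or, not_le, not_le] at hr
          rw [ringSchwartz_eq_zero l (hr.imp le_of_lt le_of_lt), mul_zero]
      rw [← h3, mul_assoc, ← mul_assoc, ← h2.tsum_eq]
      refine tsum_congr fun m => ?_
      simp only [hF]; ring
    · rw [not_and_or, not_le, not_le] at hz
      have h2 : ringSchwartz l (2 ^ k * t - l) = 0 :=
        ringSchwartz_eq_zero l (by rcases hz with hz | hz; left; linarith; right; linarith)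
      simp only [hF]
      rw [h2, fatCut_zero (hz.imp le_of_lt le_of_lt)]
      simp
  simp_rw [h1] at h
  convert! h using 1
  ext m
  rw [inner_packet]
  simp only [hF]
  rw [integral_const_mul, mul_comm]

lemma sum_ring_telescope (η t : ℝ) (K : ℕ) :
    ∑ k ∈ Finset.Icc 1 K, ringSchwartz ⌊η * 2 ^ k⌋ (2 ^ k * t - ⌊η * 2 ^ k⌋) =
      ((leftCut (2 ^ K * t - ⌊η * 2 ^ K⌋) - leftCut (t - ⌊η⌋) : ℝ) : ℂ) := by
  induction K with
  | zero => simp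
  | succ K ih =>
    rw [Finset.sum_Icc_succ_top (by omega), ih, ringSchwartz_apply, ringCut, ← Complex.ofReal_add]
    congr 1
    have h1 : ⌊η * 2 ^ (K + 1)⌋ / 2 = ⌊η * 2 ^ K⌋ := by
      have := Int.floor_div_natCast (η * 2 ^ (K + 1)) 2
      rw [show η * 2 ^ (K + 1) / (2 : ℕ) = η * 2 ^ K by push_cast; ring] at this
      rw [this]; rfl
    have h2 : (⌊η * 2 ^ (K + 1)⌋ : ℝ) =
        2 * ⌊η * 2 ^ K⌋ + ((⌊η * 2 ^ (K + 1)⌋ % 2 : ℤ) : ℝ) := by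
      rw [← h1]
      exact_mod_cast (Int.mul_ediv_add_emod _ 2).symm
    have h3 : (2 ^ (K + 1) * t - ⌊η * 2 ^ (K + 1)⌋ + ((⌊η * 2 ^ (K + 1)⌋ % 2 : ℤ) : ℝ)) / 2 =
        2 ^ K * t - ⌊η * 2 ^ K⌋ := by
      rw [pow_succ] at *
      linarith
    rw [h3]; ring

lemma tendsto_leftCut (η t : ℝ) :
    Filter.Tendsto (fun K : ℕ => leftCut (2 ^ K * t - ⌊η * 2 ^ K⌋)) Filter.atTop
      (nhds (if t < η then 1 else 0)) := by
  refine tendsto_const_nhds.congr' ?_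
  split_ifs with h
  · have h1 : Filter.Tendsto (fun K : ℕ => (2 : ℝ) ^ K * (η - t)) Filter.atTop Filter.atTop :=
      (tendsto_pow_atTop_atTop_of_one_lt one_lt_two).atTop_mul_const (sub_pos.2 h)
    filter_upwards [h1.eventually_ge_atTop 4] with K hK
    have := Int.lt_floor_add_one (η * 2 ^ K)
    refine (leftCut_one ?_).symm
    nlinarith
  · refine Filter.Eventually.of_forall fun K => ?_
    have h1 := Int.floor_le (η * 2 ^ K)
    have h2 : η * 2 ^ K ≤ t * 2 ^ K := by
      refine mul_le_mul_of_nonneg_right (not_lt.1 h) (by positivity)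
    refine (leftCut_zero ?_).symm
    linarith

lemma carleson_truncated : ∃ C, 0 ≤ C ∧ ∀ (g : ℝ → ℂ) (hg : MemLp g 2), Integrable g →
    ∀ (E : Finset ℤ) (η : ℤ → ℝ) (K : ℕ), ∑ x ∈ E, ‖∑ k ∈ Finset.Icc 1 K,
      ∫ t, g t * (ringSchwartz ⌊η x * 2 ^ k⌋ (2 ^ k * t - ⌊η x * 2 ^ k⌋) * eChar (x / 8 * t))‖ ≤
        C * (‖hg.toLp g‖ * √E.card) := by
  classical
  obtain ⟨B₁, h1⟩ := exists_waveBound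
  obtain ⟨B₂, h2⟩ := exists_packetBound
  set B := max 1 (max B₁ B₂)
  have hB : 1 ≤ B := le_max_left _ _
  have hw := h1 B ((le_max_left _ _).trans (le_max_right _ _))
  have hv := h2 B ((le_max_right _ _).trans (le_max_right _ _))
  refine ⟨96 * modelConst B, ?_, fun g hg hgi E η K => ?_⟩
  · unfold modelConst; positivity
  set α : Tile → ℂ := fun s => inner ℂ (packet s) (hg.toLp g) with hα
  let P : Finset ℤ → Finset Tile := fun A => (Finset.Icc 1 K ×ˢ A ×ˢ E).image
    fun q => ⟨q.1, q.2.1, ⌊η q.2.2 * 2 ^ q.1⌋⟩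
  have hk : ∀ A, ∀ s ∈ P A, 1 ≤ s.k := by
    intro A s hs
    obtain ⟨q, hq, rfl⟩ := Finset.mem_image.1 hs
    rw [Finset.mem_product, Finset.mem_Icc] at hq
    exact hq.1.1
  have hsum : ∀ A, modelSum wave α η E (P A) = ∑ x ∈ E, ‖∑ k ∈ Finset.Icc 1 K, ∑ m ∈ A,
      α ⟨k, m, ⌊η x * 2 ^ k⌋⟩ * wave ⟨k, m, ⌊η x * 2 ^ k⌋⟩ x‖ := by
    intro A
    rw [modelSum]
    refine Finset.sum_congr rfl fun x hx => ?_
    congr 1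
    rw [← Finset.sum_product']
    symm
    refine Finset.sum_bij (fun q _ => (⟨q.1, q.2, ⌊η x * 2 ^ q.1⌋⟩ : Tile)) ?_ ?_ ?_ ?_
    · intro q hq
      rw [Finset.mem_product] at hq
      refine Finset.mem_filter.2 ⟨Finset.mem_image.2 ⟨(q.1, q.2, x), ?_, rfl⟩, rfl⟩
      simp only [Finset.mem_product]
      exact ⟨hq.1, hq.2, hx⟩
    · intro q _ q' _ h
      rw [Tile.mk.injEq] at h
      exact Prod.ext h.1 h.2.1
    · intro s hs
      obtain ⟨hs, hh⟩ := Finset.mem_filter.1 hs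
      obtain ⟨q, hq, rfl⟩ := Finset.mem_image.1 hs
      simp only [Finset.mem_product] at hq
      refine ⟨(q.1, q.2.1), Finset.mem_product.2 ⟨hq.1, hq.2.1⟩, ?_⟩
      exact Tile.ext rfl rfl hh
    · intro q _; rfl
  have hlim : Filter.Tendsto (fun A => modelSum wave α η E (P A)) Filter.atTop
      (nhds (∑ x ∈ E, ‖∑ k ∈ Finset.Icc 1 K, ∫ t, g t *
        (ringSchwartz ⌊η x * 2 ^ k⌋ (2 ^ k * t - ⌊η x * 2 ^ k⌋) * eChar (x / 8 * t))‖)) := by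
    simp_rw [hsum]
    exact tendsto_finsetSum _ fun x _ => (tendsto_finsetSum _ fun k _ =>
      hasSum_packet_wave hg hgi k ⌊η x * 2 ^ k⌋ x).norm
  exact le_of_tendsto' hlim fun A => modelSum_le_norm hB hv hw (hk A)

lemma carleson_linearized : ∃ C, 0 ≤ C ∧ ∀ (g : ℝ → ℂ) (hg : MemLp g 2), Integrable g →
    (∀ t, t ∉ Set.Icc (0 : ℝ) 1 → g t = 0) → ∀ (E : Finset ℤ) (η : ℤ → ℝ),
      (∀ x ∈ E, η x ∈ Set.Icc (0 : ℝ) 1) →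
      ∑ x ∈ E, ‖∫ t in (0 : ℝ)..(η x), g t * eChar (x / 8 * t)‖ ≤ C * (‖hg.toLp g‖ * √E.card) := by
  obtain ⟨C, hC, h⟩ := carleson_truncated
  refine ⟨C, hC, fun g hg hgi hg0 E η hη => ?_⟩
  suffices hx : ∀ x ∈ E, Filter.Tendsto (fun K : ℕ => ∑ k ∈ Finset.Icc 1 K, ∫ t, g t *
      (ringSchwartz ⌊η x * 2 ^ k⌋ (2 ^ k * t - ⌊η x * 2 ^ k⌋) * eChar (x / 8 * t))) Filter.atTop
      (nhds (∫ t in (0 : ℝ)..(η x), g t * eChar (x / 8 * t))) from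
    le_of_tendsto' (tendsto_finsetSum _ fun x hxE => (hx x hxE).norm) (h g hg hgi E η)
  intro x hx
  have h1 : ∀ K : ℕ, ∑ k ∈ Finset.Icc 1 K, ∫ t, g t *
      (ringSchwartz ⌊η x * 2 ^ k⌋ (2 ^ k * t - ⌊η x * 2 ^ k⌋) * eChar (x / 8 * t)) =
      ∫ t, (leftCut (2 ^ K * t - ⌊η x * 2 ^ K⌋) : ℂ) * (g t * eChar (x / 8 * t)) := by
    intro K
    rw [← integral_finsetSum]
    · congr 1; ext t
      by_cases ht : t ∈ Set.Icc (0 : ℝ) 1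
      · have h2 := sum_ring_telescope (η x) t K
        have h3 : leftCut (t - ⌊η x⌋) = 0 := by
          refine leftCut_zero ?_
          have h4 : ⌊η x⌋ < 2 := Int.floor_lt.2 (by have := (hη x hx).2; push_cast; linarith)
          have h5 : ((⌊η x⌋ : ℤ) : ℝ) ≤ 1 := by exact_mod_cast (by omega : ⌊η x⌋ ≤ 1)
          linarith [ht.1]
        rw [h3, sub_zero] at h2
        rw [← h2, Finset.sum_mul]
        refine Finset.sum_congr rfl fun k _ => ?_
        ring
      · simp [hg0 t ht]
    · intro k _
      obtain ⟨c, hc⟩ := exists_bound_schwartz (ringSchwartz ⌊η x * 2 ^ k⌋)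
      have := (ringSchwartz ⌊η x * 2 ^ k⌋).continuous
      refine hgi.mul_bdd (c := c) (Continuous.aestronglyMeasurable (by fun_prop)) ?_
      refine Filter.Eventually.of_forall fun t => ?_
      rw [norm_mul, norm_eChar, mul_one]; exact hc _
  simp_rw [h1]
  have h2 : ∫ t in (0 : ℝ)..(η x), g t * eChar (x / 8 * t) =
      ∫ t, ((if t < η x then 1 else 0 : ℝ) : ℂ) * (g t * eChar (x / 8 * t)) := by
    rw [intervalIntegral.integral_of_le (hη x hx).1, integral_Ioc_eq_integral_Ioo,
      ← integral_Ico_eq_integral_Ioo, ← integral_indicator measurableSet_Ico]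
    congr 1; ext t
    by_cases ht : t ∈ Set.Icc (0 : ℝ) 1
    · by_cases h3 : t < η x
      · rw [Set.indicator_of_mem (show t ∈ Set.Ico 0 (η x) from ⟨ht.1, h3⟩)]; simp [h3]
      · rw [Set.indicator_of_notMem fun h => h3 h.2]; simp [h3]
    · simp [hg0 t ht]
  rw [h2]
  refine tendsto_integral_of_dominated_convergence (fun t => ‖g t‖) (fun K => ?_) hgi.norm
    (fun K => Filter.Eventually.of_forall fun t => ?_) (Filter.Eventually.of_forall fun t => ?_)
  · have h3 := hgi.aestronglyMeasurable
    exact (Continuous.aestronglyMeasurable (by fun_prop)).mul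
      (h3.mul (Continuous.aestronglyMeasurable (by fun_prop)))
  · rw [norm_mul, norm_mul, norm_eChar, mul_one, Complex.norm_real, Real.norm_eq_abs,
      abs_of_nonneg (leftCut_nonneg _)]
    exact mul_le_of_le_one_left (norm_nonneg _) (leftCut_le_one _)
  · exact ((Complex.continuous_ofReal.tendsto _).comp (tendsto_leftCut (η x) t)).mul_const _

/-! ### The weak type estimate below `L²` -/

lemma norm_toLp_sq {g : ℝ → ℂ} (hg : MemLp g 2) : ‖hg.toLp g‖ ^ 2 = ∫ t, ‖g t‖ ^ 2 := by
  apply Complex.ofReal_injective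
  rw [Complex.ofReal_pow, ← Complex.coe_algebraMap, ← inner_self_eq_norm_sq_to_K (𝕜 := ℂ),
    L2.inner_def, Complex.coe_algebraMap, ← integral_complex_ofReal]
  refine integral_congr_ae ?_
  filter_upwards [hg.coeFn_toLp] with t ht
  rw [ht, inner_self_eq_norm_sq_to_K]
  simp

lemma weak_type_two : ∃ C, 0 ≤ C ∧ ∀ (g : ℝ → ℂ), MemLp g 2 → Integrable g →
    (∀ t, t ∉ Set.Icc (0 : ℝ) 1 → g t = 0) → ∀ (E : Finset ℤ) (η : ℤ → ℝ),
      (∀ x ∈ E, η x ∈ Set.Icc (0 : ℝ) 1) → ∀ δ, 0 ≤ δ →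
      (∀ x ∈ E, δ ≤ ‖∫ t in (0 : ℝ)..(η x), g t * eChar (x / 8 * t)‖) →
      δ ^ 2 * E.card ≤ C * ∫ t, ‖g t‖ ^ 2 := by
  obtain ⟨C, hC, h⟩ := carleson_linearized
  refine ⟨C ^ 2, by positivity, fun g hg hgi hg0 E η hη δ hδ hE => ?_⟩
  have h1 := h g hg hgi hg0 E η hη
  have h2 := Finset.sum_le_sum hE
  rw [Finset.sum_const, nsmul_eq_mul] at h2
  have h3 := h2.trans h1
  rw [← norm_toLp_sq hg]
  have hs : √(E.card : ℝ) ^ 2 = E.card := Real.sq_sqrt (by positivity)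
  have h0 := Real.sqrt_nonneg (E.card : ℝ)
  rcases h0.eq_or_lt with h0 | h0
  · rw [← hs, ← h0]; norm_num; positivity
  · have h4 : δ * √E.card ≤ C * ‖hg.toLp g‖ := by
      refine le_of_mul_le_mul_right ?_ h0
      calc δ * √E.card * √E.card = √E.card ^ 2 * δ := by ring
        _ = E.card * δ := by rw [hs]
        _ ≤ _ := h3
        _ = _ := by ring
    calc δ ^ 2 * E.card = (δ * √E.card) ^ 2 := by rw [mul_pow, hs]
      _ ≤ (C * ‖hg.toLp g‖) ^ 2 := by gcongr
      _ = _ := by ring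

lemma weak_type {p : ℝ} (hp1 : 1 < p) (hp2 : p ≤ 2) : ∃ C, 0 < C ∧ ∀ r, 0 < r → ∀ (g : ℝ → ℂ),
    Measurable g → Integrable (fun t => ‖g t‖ ^ p) → Integrable g →
    (∀ t, t ∉ Set.Icc (0 : ℝ) 1 → g t = 0) → ∫ t, ‖g t‖ ^ p ≤ r ^ p →
    ∀ (E : Finset ℤ) (η : ℤ → ℝ), (∀ x ∈ E, η x ∈ Set.Icc (0 : ℝ) 1) → ∀ δ, 0 < δ →
      (∀ x ∈ E, δ ≤ ‖∫ t in (0 : ℝ)..(η x), g t * eChar (x / 8 * t)‖) →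
      (E.card : ℝ) ≤ C * (r / δ) ^ (p / (p - 1)) := by
  obtain ⟨C, hC, hw⟩ := weak_type_two
  have hp : 0 < p - 1 := by linarith
  refine ⟨4 * C * 2 ^ ((2 - p) / (p - 1)) + 1, by positivity,
    fun r hr g hgm hgp hgi hg0 hgr E η hη δ hδ hE => ?_⟩
  set ρ := r / δ with hρ
  have hρ0 : 0 < ρ := by positivity
  set T := r * (2 * ρ) ^ (1 / (p - 1)) with hT
  have hT0 : 0 < T := by positivity
  have hT1 : T ^ (1 - p) * r ^ p = δ / 2 := by
    rw [hT, Real.mul_rpow hr.le (by positivity), ← Real.rpow_mul (by positivity),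
      show 1 / (p - 1) * (1 - p) = -1 by field_simp; ring, Real.rpow_neg_one, mul_right_comm,
      ← Real.rpow_add hr, show 1 - p + p = 1 by ring, Real.rpow_one, hρ]
    field_simp
  have hT2 : T ^ (2 - p) * r ^ p / δ ^ 2 =
      2 ^ ((2 - p) / (p - 1)) * ρ ^ (p / (p - 1)) := by
    rw [hT, Real.mul_rpow hr.le (by positivity), ← Real.rpow_mul (by positivity), mul_right_comm,
      ← Real.rpow_add hr, show 2 - p + p = (2 : ℕ) by push_cast; ring, Real.rpow_natCast,
      Real.mul_rpow (by norm_num) hρ0.le,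
      show p / (p - 1) = (2 : ℕ) + 1 / (p - 1) * (2 - p) by push_cast; field_simp; ring,
      Real.rpow_add hρ0, Real.rpow_natCast, hρ, div_pow,
      show (2 - p) / (p - 1) = 1 / (p - 1) * (2 - p) by ring]
    ring
  set S : Set ℝ := {t | ‖g t‖ ≤ T} with hS
  have hSm : MeasurableSet S := measurableSet_le hgm.norm measurable_const
  have hg2i : Integrable (S.indicator g) := hgi.indicator hSm
  have hg1i : Integrable (Sᶜ.indicator g) := hgi.indicator hSm.compl
  have hb2 : ∀ t, ‖S.indicator g t‖ ^ 2 ≤ T ^ (2 - p) * ‖g t‖ ^ p := by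
    intro t
    by_cases ht : t ∈ S
    · rw [Set.indicator_of_mem ht]
      have h1 : ‖g t‖ ≤ T := ht
      rcases (norm_nonneg (g t)).eq_or_lt with h0 | h0
      · rw [← h0]; norm_num; positivity
      · calc ‖g t‖ ^ 2 = ‖g t‖ ^ (2 - p) * ‖g t‖ ^ p := by
              rw [← Real.rpow_add h0, sub_add_cancel, Real.rpow_two]
          _ ≤ _ := by
            gcongr
    · rw [Set.indicator_of_notMem ht]; norm_num; positivity
  have hb1 : ∀ t, ‖Sᶜ.indicator g t‖ ≤ T ^ (1 - p) * ‖g t‖ ^ p := by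
    intro t
    by_cases ht : t ∈ S
    · rw [Set.indicator_of_notMem (by simpa using ht)]; norm_num; positivity
    · rw [Set.indicator_of_mem ht]
      have h1 : T < ‖g t‖ := not_le.1 ht
      have h0 : 0 < ‖g t‖ := hT0.trans h1
      calc ‖g t‖ = ‖g t‖ ^ (1 - p) * ‖g t‖ ^ p := by
              rw [← Real.rpow_add h0, sub_add_cancel, Real.rpow_one]
        _ ≤ _ := mul_le_mul_of_nonneg_right
              (Real.rpow_le_rpow_of_nonpos hT0 h1.le (by linarith)) (by positivity)
  have hI2 : ∫ t, ‖S.indicator g t‖ ^ 2 ≤ T ^ (2 - p) * r ^ p := by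
    calc _ ≤ ∫ t, T ^ (2 - p) * ‖g t‖ ^ p :=
          integral_mono_of_nonneg (Filter.Eventually.of_forall fun t => by positivity)
            (hgp.const_mul _) (Filter.Eventually.of_forall hb2)
      _ ≤ _ := by rw [integral_const_mul]; gcongr
  have hI1 : ∫ t, ‖Sᶜ.indicator g t‖ ≤ δ / 2 := by
    calc _ ≤ ∫ t, T ^ (1 - p) * ‖g t‖ ^ p :=
          integral_mono_of_nonneg (Filter.Eventually.of_forall fun t => by positivity)
            (hgp.const_mul _) (Filter.Eventually.of_forall hb1)
      _ ≤ _ := by rw [integral_const_mul, ← hT1]; gcongr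
  have hm2 : MemLp (S.indicator g) 2 := by
    rw [memLp_two_iff_integrable_sq_norm hg2i.aestronglyMeasurable]
    refine (hgp.const_mul (T ^ (2 - p))).mono' ?_ (Filter.Eventually.of_forall fun t => ?_)
    · exact (hg2i.aestronglyMeasurable.norm).pow 2
    · rw [Real.norm_eq_abs, abs_of_nonneg (by positivity)]; exact hb2 t
  have hE2 : ∀ x ∈ E, δ / 2 ≤ ‖∫ t in (0 : ℝ)..(η x), S.indicator g t * eChar (x / 8 * t)‖ := by
    intro x hx
    have hmul : ∀ f : ℝ → ℂ, Integrable f → Integrable fun t => f t * eChar (x / 8 * t) :=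
      fun f hf => hf.mul_bdd (c := 1) (Continuous.aestronglyMeasurable (by fun_prop))
        (Filter.Eventually.of_forall fun t => (norm_eChar _).le)
    have h1 : ∫ t in (0 : ℝ)..(η x), g t * eChar (x / 8 * t) =
        (∫ t in (0 : ℝ)..(η x), S.indicator g t * eChar (x / 8 * t)) +
        ∫ t in (0 : ℝ)..(η x), Sᶜ.indicator g t * eChar (x / 8 * t) := by
      rw [← intervalIntegral.integral_add (hmul _ hg2i).intervalIntegrable
        (hmul _ hg1i).intervalIntegrable]
      congr 1; ext t
      rw [← add_mul, Set.indicator_self_add_compl_apply]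
    have h2 : ‖∫ t in (0 : ℝ)..(η x), Sᶜ.indicator g t * eChar (x / 8 * t)‖ ≤ δ / 2 := by
      refine (intervalIntegral.norm_integral_le_integral_norm (hη x hx).1).trans ?_
      simp_rw [norm_mul, norm_eChar, mul_one]
      rw [intervalIntegral.integral_of_le (hη x hx).1]
      exact (setIntegral_le_integral hg1i.norm
        (Filter.Eventually.of_forall fun t => norm_nonneg _)).trans hI1
    have h3 := hE x hx
    rw [h1] at h3
    linarith [norm_add_le (∫ t in (0 : ℝ)..(η x), S.indicator g t * eChar (x / 8 * t))
      (∫ t in (0 : ℝ)..(η x), Sᶜ.indicator g t * eChar (x / 8 * t))]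
  have h1 := hw _ hm2 hg2i (fun t ht => by
    rw [Set.indicator_apply_eq_zero]; exact fun _ => hg0 t ht) E η hη (δ / 2) (by positivity) hE2
  have h2 : (E.card : ℝ) ≤ 4 * C * (T ^ (2 - p) * r ^ p / δ ^ 2) := by
    rw [mul_div_assoc', le_div_iff₀ (by positivity)]
    have := mul_le_mul_of_nonneg_left hI2 hC
    nlinarith
  rw [hT2] at h2
  have h3 : 0 ≤ ρ ^ (p / (p - 1)) := by positivity
  linarith

/-! ### From discrete frequencies to boxes in the complex plane -/

lemma integral_mul_eq_sub_integral_primitive {G φ φ' : ℝ → ℂ} (hG : Integrable G)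
    (hφ : ∀ t, HasDerivAt φ (φ' t) t) (hφ' : Continuous φ') {y : ℝ} (hy : 0 ≤ y) :
    ∫ t in (0 : ℝ)..y, G t * φ t =
      (∫ t in (0 : ℝ)..y, G t) * φ y - ∫ s in (0 : ℝ)..y, φ' s * ∫ t in (0 : ℝ)..s, G t := by
  set μ := volume.restrict (Set.Ioc 0 y)
  have hGμ : Integrable G μ := hG.restrict
  have hφμ : Integrable φ' μ :=
    (hφ'.integrableOn_Icc (a := 0) (b := y)).mono_set Set.Ioc_subset_Icc_self
  have hφc : Continuous φ := continuous_iff_continuousAt.2 fun t => (hφ t).continuousAt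
  have hprod : Integrable ({z : ℝ × ℝ | z.1 < z.2}.indicator fun z => G z.1 * φ' z.2)
      (μ.prod μ) := (hGμ.mul_prod hφμ).indicator (measurableSet_lt measurable_fst measurable_snd)
  have h1 : ∀ t ∈ Set.Ioc 0 y, ∫ s, ({z : ℝ × ℝ | z.1 < z.2}.indicator
      fun z => G z.1 * φ' z.2) (t, s) ∂μ = G t * (φ y - φ t) := by
    intro t ht
    have : ∀ s, ({z : ℝ × ℝ | z.1 < z.2}.indicator fun z => G z.1 * φ' z.2) (t, s) =
        (Set.Ioi t).indicator (fun s => G t * φ' s) s := fun s => by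
      simp [Set.indicator_apply]
    simp_rw [this]
    rw [integral_indicator measurableSet_Ioi, Measure.restrict_restrict measurableSet_Ioi,
      Set.inter_comm, Set.Ioc_inter_Ioi, max_eq_right ht.1.le, integral_const_mul,
      ← intervalIntegral.integral_of_le ht.2,
      intervalIntegral.integral_eq_sub_of_hasDerivAt (fun s _ => hφ s)
        (hφ'.intervalIntegrable _ _)]
  have h2 : ∀ s ∈ Set.Ioc 0 y, ∫ t, ({z : ℝ × ℝ | z.1 < z.2}.indicator
      fun z => G z.1 * φ' z.2) (t, s) ∂μ = φ' s * ∫ t in (0 : ℝ)..s, G t := by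
    intro s hs
    have : ∀ t, ({z : ℝ × ℝ | z.1 < z.2}.indicator fun z => G z.1 * φ' z.2) (t, s) =
        (Set.Iio s).indicator (fun t => φ' s * G t) t := fun t => by
      simp [Set.indicator_apply, mul_comm]
    simp_rw [this]
    have hset : Set.Iio s ∩ Set.Ioc 0 y = Set.Ioo 0 s := by
      ext t; simp only [Set.mem_inter_iff, Set.mem_Iio, Set.mem_Ioc, Set.mem_Ioo]
      exact ⟨fun h => ⟨h.2.1, h.1⟩, fun h => ⟨h.2, h.1, h.2.le.trans hs.2⟩⟩
    rw [integral_indicator measurableSet_Iio, Measure.restrict_restrict measurableSet_Iio,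
      hset, integral_const_mul, ← integral_Ioc_eq_integral_Ioo,
      ← intervalIntegral.integral_of_le hs.1.le]
  have hswap := integral_integral_swap
    (f := fun t s => ({z : ℝ × ℝ | z.1 < z.2}.indicator fun z => G z.1 * φ' z.2) (t, s)) hprod
  rw [setIntegral_congr_fun measurableSet_Ioc h1, setIntegral_congr_fun measurableSet_Ioc h2,
    ← intervalIntegral.integral_of_le hy, ← intervalIntegral.integral_of_le hy] at hswap
  rw [← hswap]
  simp_rw [mul_sub]
  rw [intervalIntegral.integral_sub, intervalIntegral.integral_mul_const]
  · ring
  · exact hG.intervalIntegrable.mul_const _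
  · exact hG.intervalIntegrable.mul_continuousOn hφc.continuousOn

lemma norm_integral_mul_cexp_le {G : ℝ → ℂ} (hG : Integrable G) {ε R : ℝ}
    {κ : ℂ} (hκ : ‖κ‖ ≤ R)
    (hS : ∀ y ∈ Set.Icc (0 : ℝ) 1, ‖∫ t in (0 : ℝ)..y, G t‖ ≤ ε) {y : ℝ}
    (hy : y ∈ Set.Icc (0 : ℝ) 1) :
    ‖∫ t in (0 : ℝ)..y, G t * Complex.exp (Complex.I * κ * t)‖ ≤ Real.exp R * (1 + R) * ε := by
  have hR : 0 ≤ R := (norm_nonneg _).trans hκ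
  have hε : 0 ≤ ε := (norm_nonneg _).trans (hS y hy)
  have hexp : ∀ t ∈ Set.Icc (0 : ℝ) 1, ‖Complex.exp (Complex.I * κ * t)‖ ≤ Real.exp R := by
    intro t ht
    refine (Complex.norm_exp_le_exp_norm _).trans (Real.exp_le_exp.2 ?_)
    rw [norm_mul, norm_mul, Complex.norm_I, one_mul, Complex.norm_real, Real.norm_eq_abs,
      abs_of_nonneg ht.1]
    nlinarith [ht.1, ht.2, norm_nonneg κ]
  have hd : ∀ t : ℝ, HasDerivAt (fun t : ℝ => Complex.exp (Complex.I * κ * t))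
      (Complex.exp (Complex.I * κ * t) * (Complex.I * κ)) t := fun t => by
    have := ((Complex.ofRealCLM.hasDerivAt (x := t)).const_mul (Complex.I * κ)).cexp
    simpa using this
  rw [integral_mul_eq_sub_integral_primitive hG hd (by fun_prop) hy.1]
  have h1 : ‖(∫ t in (0 : ℝ)..y, G t) * Complex.exp (Complex.I * κ * y)‖ ≤ ε * Real.exp R := by
    rw [norm_mul]
    exact mul_le_mul (hS y hy) (hexp y hy) (norm_nonneg _) hε
  have h2 : ‖∫ s in (0 : ℝ)..y, Complex.exp (Complex.I * κ * s) * (Complex.I * κ) *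
      ∫ t in (0 : ℝ)..s, G t‖ ≤ Real.exp R * R * ε * |y - 0| := by
    refine intervalIntegral.norm_integral_le_of_norm_le_const fun s hs => ?_
    rw [Set.uIoc_of_le hy.1] at hs
    have hs1 : s ∈ Set.Icc (0 : ℝ) 1 := ⟨hs.1.le, hs.2.trans hy.2⟩
    rw [norm_mul, norm_mul, norm_mul, Complex.norm_I, one_mul]
    have := hexp s hs1
    have := hS s hs1
    gcongr
  have h3 : Real.exp R * R * ε * |y - 0| ≤ Real.exp R * R * ε := by
    rw [sub_zero, abs_of_nonneg hy.1]
    exact mul_le_of_le_one_right (by positivity) hy.2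
  linarith [norm_sub_le ((∫ t in (0 : ℝ)..y, G t) * Complex.exp (Complex.I * κ * y))
    (∫ s in (0 : ℝ)..y, Complex.exp (Complex.I * κ * s) * (Complex.I * κ) *
      ∫ t in (0 : ℝ)..s, G t)]

lemma card_le_mul_card_image_floor {a : ℝ} (ha : a ≠ 0) (F : Finset ℤ) :
    (F.card : ℝ) ≤ (|a|⁻¹ + 1) * (F.image fun n : ℤ => ⌊a * n⌋).card := by
  have key : F.card ≤ (⌊|a|⁻¹⌋₊ + 1) * (F.image fun n : ℤ => ⌊a * n⌋).card := by
    refine Finset.card_le_mul_card_image F _ fun k _ => ?_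
    rcases (F.filter fun n : ℤ => ⌊a * n⌋ = k).eq_empty_or_nonempty with h | h
    · rw [h]; simp
    set s := F.filter fun n : ℤ => ⌊a * n⌋ = k
    set m := s.min' h
    have hsub : s ⊆ Finset.Icc m (m + ⌊|a|⁻¹⌋₊) := by
      intro n hn
      have hmn : m ≤ n := s.min'_le n hn
      have h1 := (Finset.mem_filter.1 hn).2
      have h2 := (Finset.mem_filter.1 (s.min'_mem h)).2
      have h3 := Int.abs_sub_lt_one_of_floor_eq_floor (h1.trans h2.symm)
      change |a * (n : ℝ) - a * (m : ℝ)| < 1 at h3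
      rw [← mul_sub, abs_mul] at h3
      have h4 : (n : ℝ) - m ≤ |a|⁻¹ := by
        have h5 : |(n : ℝ) - m| < |a|⁻¹ := by
          rw [← one_div, lt_div_iff₀ (abs_pos.2 ha), mul_comm]; exact h3
        exact (le_abs_self _).trans h5.le
      rw [Finset.mem_Icc]
      refine ⟨hmn, ?_⟩
      have h6 : (n - m).toNat ≤ ⌊|a|⁻¹⌋₊ := by
        apply Nat.le_floor
        have h7 : (((n - m).toNat : ℤ) : ℝ) = ((n - m : ℤ) : ℝ) := by
          rw [Int.toNat_of_nonneg (by linarith)]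
        rw [Int.cast_natCast] at h7
        rw [h7]; push_cast; exact h4
      omega
    calc s.card ≤ (Finset.Icc m (m + ⌊|a|⁻¹⌋₊)).card := Finset.card_le_card hsub
      _ = ⌊|a|⁻¹⌋₊ + 1 := by rw [Int.card_Icc]; omega
  calc (F.card : ℝ) ≤ ((⌊|a|⁻¹⌋₊ : ℝ) + 1) * (F.image fun n : ℤ => ⌊a * n⌋).card := by
        exact_mod_cast key
    _ ≤ _ := by gcongr; exact Nat.floor_le (by positivity)

lemma finite_and_ncard_le {α : Type*} {B : Set α} {K : ℝ}
    (h : ∀ F : Finset α, (F : Set α) ⊆ B → (F.card : ℝ) ≤ K) :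
    B.Finite ∧ (B.ncard : ℝ) ≤ K := by
  have hfin : B.Finite := by
    by_contra hinf
    obtain ⟨F, hF, hcard⟩ := Set.Infinite.exists_subset_card_eq hinf (⌊K⌋₊ + 1)
    have h1 := h F hF
    rw [hcard] at h1
    push_cast at h1
    linarith [Nat.lt_floor_add_one K]
  refine ⟨hfin, ?_⟩
  rw [Set.ncard_eq_toFinset_card _ hfin]
  exact h _ (by simp)

lemma norm_sub_floor_le {b h : ℝ} {n : ℤ} {lam : ℂ}
    (hre : lam.re ∈ Set.Icc (n : ℝ) (n + 1)) (him : lam.im ∈ Set.Icc (-h) h) :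
    ‖(b : ℂ) * lam - ((Real.pi / 4 * ⌊4 * b / Real.pi * n⌋ : ℝ) : ℂ)‖ ≤ |b| * (1 + h) + 1 := by
  have hπ := Real.pi_pos
  set x := ⌊4 * b / Real.pi * n⌋
  have h1 : |4 * b / Real.pi * n - x| ≤ 1 := by
    rw [abs_le]
    constructor <;> linarith [Int.floor_le (4 * b / Real.pi * n),
      Int.lt_floor_add_one (4 * b / Real.pi * n)]
  have h2 : |lam.re - n| ≤ 1 := abs_le.2 ⟨by linarith [hre.1], by linarith [hre.2]⟩
  have h3 : |lam.im| ≤ h := abs_le.2 him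
  refine (Complex.norm_le_abs_re_add_abs_im _).trans ?_
  simp only [Complex.sub_re, Complex.sub_im, Complex.mul_re, Complex.mul_im, Complex.ofReal_re,
    Complex.ofReal_im, zero_mul, sub_zero, add_zero]
  have h4 : b * lam.re - Real.pi / 4 * x =
      b * (lam.re - n) + Real.pi / 4 * (4 * b / Real.pi * n - x) := by field_simp; ring
  have h5 : |b * (lam.re - n)| ≤ |b| := by
    rw [abs_mul]; exact mul_le_of_le_one_right (abs_nonneg b) h2
  have h6 : |Real.pi / 4 * (4 * b / Real.pi * n - x)| ≤ 1 := by
    rw [abs_mul, abs_of_pos (by positivity)]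
    nlinarith [Real.pi_le_four, abs_nonneg (4 * b / Real.pi * n - x)]
  have h7 : |b * lam.im| ≤ |b| * h := by
    rw [abs_mul]; exact mul_le_mul_of_nonneg_left h3 (abs_nonneg b)
  rw [h4]
  linarith [abs_add_le (b * (lam.re - n)) (Real.pi / 4 * (4 * b / Real.pi * n - x))]

lemma maxFourier_le_of_forall_norm_le {g G : ℝ → ℂ} (hG : Integrable G)
    (hgG : ∀ t ∈ Set.Ioc (0 : ℝ) 1, g t = G t) {b h ε : ℝ} {n : ℤ}
    (hS : ∀ y ∈ Set.Icc (0 : ℝ) 1,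
      ‖∫ t in (0 : ℝ)..y, G t * eChar ((⌊4 * b / Real.pi * n⌋ : ℤ) / 8 * t)‖ ≤ ε)
    {lam : ℂ} (hre : lam.re ∈ Set.Icc (n : ℝ) (n + 1)) (him : lam.im ∈ Set.Icc (-h) h) :
    maxFourier g ((b : ℂ) * lam) ≤
      Real.exp (|b| * (1 + h) + 1) * (1 + (|b| * (1 + h) + 1)) * ε := by
  have : Nonempty (Set.Icc (0 : ℝ) 1) := ⟨⟨0, by simp⟩⟩
  refine ciSup_le fun y => ?_
  have hGe : Integrable fun t => G t * eChar ((⌊4 * b / Real.pi * n⌋ : ℤ) / 8 * t) :=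
    hG.mul_bdd (c := 1) (Continuous.aestronglyMeasurable (by fun_prop))
      (Filter.Eventually.of_forall fun t => (norm_eChar _).le)
  refine Eq.trans_le (congrArg _ (intervalIntegral.integral_congr_ae
    (Filter.Eventually.of_forall fun t ht => ?_)))
    (norm_integral_mul_cexp_le hGe (norm_sub_floor_le hre him) hS y.2)
  rw [Set.uIoc_of_le y.2.1] at ht
  rw [hgG t ⟨ht.1, ht.2.trans y.2.2⟩, eChar, mul_assoc (G t), ← Complex.exp_add]
  congr 2
  push_cast
  ring

/-- Uniform Riemann–Lebesgue-type lemma for the maximal Fourier transform: there is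
`C = C(p,h,b) > 0` such that for every `r > 0`, every `g ∈ L^p[0,1]` with `‖g‖_p ≤ r`,
and every `δ > 0`, there is a set `I ⊆ ℤ` with `card(ℤ∖I) ≤ C (r/δ)^{p'}` such that
`𝓕[g](bλ) < δ` for all `λ ∈ ⋃_{n∈I} [n,n+1] × [-h,h]`. -/
theorem stmt7 (p : ℝ) (hp1 : 1 < p) (hp2 : p ≤ 2) (b : ℝ) (hb : b ≠ 0)
    (h : ℝ) (hh : 0 ≤ h) :
    ∃ C : ℝ, 0 < C ∧ ∀ r : ℝ, 0 < r → ∀ g : ℝ → ℂ, Measurable g →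
      IntervalIntegrable (fun t => ‖g t‖ ^ p) volume 0 1 → lpNorm01 p g ≤ r →
      ∀ δ : ℝ, 0 < δ →
      ∃ I : Set ℤ, Iᶜ.Finite ∧ (Iᶜ.ncard : ℝ) ≤ C * (r / δ) ^ (p / (p - 1)) ∧
        ∀ n ∈ I, ∀ lam : ℂ, lam.re ∈ Set.Icc (n : ℝ) (n + 1) → lam.im ∈ Set.Icc (-h) h →
          maxFourier g ((b : ℂ) * lam) < δ := by
  obtain ⟨C, hC, hw⟩ := weak_type hp1 hp2
  have hπ := Real.pi_pos
  have hp0 : 0 < p := by linarith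
  set a := 4 * b / Real.pi with ha
  have ha0 : a ≠ 0 := by positivity
  set M := Real.exp (|b| * (1 + h) + 1) * (1 + (|b| * (1 + h) + 1)) with hM
  have hM0 : 0 < M := by positivity
  refine ⟨(|a|⁻¹ + 1) * (C * (2 * M) ^ (p / (p - 1))), by positivity,
    fun r hr g hgm hgp hgr δ hδ => ?_⟩
  set G := (Set.Ioc (0 : ℝ) 1).indicator g with hGdef
  have hGpow : (fun t => ‖G t‖ ^ p) = (Set.Ioc (0 : ℝ) 1).indicator fun t => ‖g t‖ ^ p := by
    ext t
    by_cases ht : t ∈ Set.Ioc (0 : ℝ) 1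
    · simp only [hGdef, Set.indicator_of_mem ht]
    · simp only [hGdef, Set.indicator_of_notMem ht, norm_zero, Real.zero_rpow hp0.ne']
  rw [intervalIntegrable_iff_integrableOn_Ioc_of_le zero_le_one] at hgp
  have hGp : Integrable fun t => ‖G t‖ ^ p := by
    rw [hGpow]; exact hgp.integrable_indicator measurableSet_Ioc
  have hG : Integrable G := by
    refine IntegrableOn.integrable_indicator ?_ measurableSet_Ioc
    refine Integrable.mono' (g := fun t => 1 + ‖g t‖ ^ p)
      ((integrableOn_const (by simp)).add hgp) hgm.aestronglyMeasurable
      (Filter.Eventually.of_forall fun t => ?_)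
    rcases le_total ‖g t‖ 1 with h1 | h1
    · have : 0 ≤ ‖g t‖ ^ p := by positivity
      linarith
    · linarith [Real.self_le_rpow_of_one_le h1 hp1.le]
  have hGr : ∫ t, ‖G t‖ ^ p ≤ r ^ p := by
    rw [hGpow, integral_indicator measurableSet_Ioc,
      ← intervalIntegral.integral_of_le zero_le_one]
    have h0 : 0 ≤ ∫ t in (0 : ℝ)..1, ‖g t‖ ^ p :=
      intervalIntegral.integral_nonneg zero_le_one fun t _ => by positivity
    rwa [lpNorm01, one_div, Real.rpow_inv_le_iff_of_pos h0 hr.le hp0] at hgr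
  set ε := δ / (2 * M) with hε
  have hε0 : 0 < ε := by positivity
  set S : ℤ → ℝ → ℂ := fun x y => ∫ t in (0 : ℝ)..y, G t * eChar (x / 8 * t) with hS
  have hex : ∀ x : ℤ, ∃ y ∈ Set.Icc (0 : ℝ) 1,
      (∃ z ∈ Set.Icc (0 : ℝ) 1, ε < ‖S x z‖) → ε ≤ ‖S x y‖ := by
    intro x
    by_cases hx : ∃ z ∈ Set.Icc (0 : ℝ) 1, ε < ‖S x z‖
    · obtain ⟨z, hz, hz'⟩ := hx
      exact ⟨z, hz, fun _ => hz'.le⟩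
    · exact ⟨0, by simp, fun hx' => absurd hx' hx⟩
  choose η hη hηS using hex
  have hcount : ∀ F : Finset ℤ,
      (F : Set ℤ) ⊆ {n : ℤ | ∃ z ∈ Set.Icc (0 : ℝ) 1, ε < ‖S ⌊a * n⌋ z‖} →
      (F.card : ℝ) ≤ (|a|⁻¹ + 1) * (C * (2 * M) ^ (p / (p - 1))) * (r / δ) ^ (p / (p - 1)) := by
    intro F hF
    have h1 := hw r hr G (hgm.indicator measurableSet_Ioc) hGp hG
      (fun t ht => Set.indicator_of_notMem (fun ht' => ht (Set.Ioc_subset_Icc_self ht')) g) hGr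
      (F.image fun n : ℤ => ⌊a * n⌋) η (fun x _ => hη x) ε hε0 (fun x hx => by
        obtain ⟨n, hn, rfl⟩ := Finset.mem_image.1 hx
        exact hηS _ (hF hn))
    have h2 : r / ε = 2 * M * (r / δ) := by rw [hε]; field_simp
    rw [h2, Real.mul_rpow (by positivity) (by positivity)] at h1
    refine (card_le_mul_card_image_floor ha0 F).trans ?_
    rw [mul_assoc, mul_assoc]
    gcongr
  obtain ⟨hfin, hcard⟩ := finite_and_ncard_le hcount
  refine ⟨{n : ℤ | ∃ z ∈ Set.Icc (0 : ℝ) 1, ε < ‖S ⌊a * n⌋ z‖}ᶜ, ?_⟩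
  rw [compl_compl]
  refine ⟨hfin, hcard, fun n hn lam hre him => ?_⟩
  have hn' : ∀ y ∈ Set.Icc (0 : ℝ) 1, ‖S ⌊a * n⌋ y‖ ≤ ε := fun y hy =>
    not_lt.1 fun hlt => hn ⟨y, hy, hlt⟩
  refine (maxFourier_le_of_forall_norm_le hG
    (fun t ht => (Set.indicator_of_mem ht g).symm) hn' hre him).trans_lt ?_
  rw [← hM, hε, show M * (δ / (2 * M)) = δ / 2 by field_simp]
  linarith
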